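/- Let n ≥ 3 and let R₀ : ℝ^n → ℝ be smooth, nonnegative, and bounded. Let v : ℝ^n → ℝ be a smooth positive bounded function satisfying −c_n Δv + R₀ v = R₀ on ℝ^n with v(x) → 0 as x → ∞, and let C ≥ 1 be a constant with C · sup v < 1. Let u₀ : ℝ^n → ℝ be smooth with |u₀(x) − 1| ≤ C v(x) for all x. Then there exists a smooth positive function u : [0,∞) × ℝ^n → ℝ with u(0,·) = u₀, satisfying the Yamabe flow equation ((n+2)/(n−2)) u^{4/(n−2)} ∂_t u = c_n Δ_x u − R₀ u on [0,∞) × ℝ^n, such that |u(t,x) − 1| ≤ C v(x) for all t ≥ 0 and all x, and such that u(t,x) converges pointwise, as t → ∞, to a positive C² function w satisfying −c_n Δw + R₀ w = 0 on ℝ^n and w(x) → 1 as x → ∞. -/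

import Mathlib

open Filter

/-- The Euclidean Laplacian on `ℝ^n`: the sum of the second partial derivatives. -/
noncomputable def lap {n : ℕ} (f : EuclideanSpace ℝ (Fin n) → ℝ)
    (x : EuclideanSpace ℝ (Fin n)) : ℝ :=
  ∑ i, fderiv ℝ (fun y => fderiv ℝ f y (EuclideanSpace.single i 1)) x (EuclideanSpace.single i 1)

namespace Yamabe

set_option linter.unusedSectionVars false

/-- The Japanese bracket `√(1 + w²)`. -/
noncomputable def jb (w : ℝ) : ℝ := Real.sqrt (1 + w ^ 2)

lemma jb_sq (w : ℝ) : jb w ^ 2 = 1 + w ^ 2 := Real.sq_sqrt (by positivity)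

lemma one_le_jb (w : ℝ) : 1 ≤ jb w := by
  rw [jb, Real.one_le_sqrt]; nlinarith [sq_nonneg w]

lemma jb_pos (w : ℝ) : 0 < jb w := lt_of_lt_of_le one_pos (one_le_jb w)

lemma abs_le_jb (w : ℝ) : |w| ≤ jb w := by
  apply Real.abs_le_sqrt; linarith

lemma jb_le (w : ℝ) : jb w ≤ 1 + |w| := by
  rw [jb, Real.sqrt_le_left (by positivity)]
  nlinarith [abs_nonneg w, sq_abs w]

lemma abs_jb_sub_le (a b : ℝ) : |jb b - jb a| ≤ |b - a| := by
  rw [← sq_le_sq]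
  have h1 := jb_sq a
  have h2 := jb_sq b
  have h3 : 1 + a * b ≤ jb a * jb b := by
    have : (1 + a * b) ^ 2 ≤ (jb a * jb b) ^ 2 := by
      rw [mul_pow, h1, h2]; nlinarith [sq_nonneg (a - b)]
    exact le_of_abs_le (abs_le_of_sq_le_sq this (mul_pos (jb_pos a) (jb_pos b)).le)
  nlinarith

lemma rpow_sub_rpow_le {a b q : ℝ} (ha : 0 < a) (hab : a ≤ b) (hq : 0 ≤ q) :
    b ^ q - a ^ q ≤ (1 + q) * b ^ (q - 1) * (b - a) := by
  have hb : 0 < b := ha.trans_le hab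
  have hx : 0 ≤ a / b := by positivity
  have hx1 : a / b ≤ 1 := by rw [div_le_one hb]; exact hab
  have key : 1 - (a / b) ^ q ≤ (1 + q) * (1 - a / b) := by
    rcases le_total 1 q with h | h
    · have := one_add_mul_self_le_rpow_one_add (s := a / b - 1) (by linarith) h
      simp only [add_sub_cancel] at this
      nlinarith
    · have : (a / b) ^ (1 : ℝ) ≤ (a / b) ^ q :=
        Real.rpow_le_rpow_of_exponent_ge (by positivity) hx1 h
      rw [Real.rpow_one] at this
      nlinarith
  have e1 : (a / b) ^ q = a ^ q / b ^ q := Real.div_rpow ha.le hb.le q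
  have e2 : b ^ (q - 1) = b ^ q / b := by rw [Real.rpow_sub_one hb.ne']
  have hbq : 0 < b ^ q := Real.rpow_pos_of_pos hb q
  rw [e1] at key
  have := mul_le_mul_of_nonneg_left key hbq.le
  rw [e2]
  have e3 : b ^ q * (1 - a ^ q / b ^ q) = b ^ q - a ^ q := by field_simp
  have e4 : b ^ q * ((1 + q) * (1 - a / b)) = (1 + q) * (b ^ q / b) * (b - a) := by field_simp
  rw [e3, e4] at this
  exact this

lemma le_rpow_sub_rpow {a b q : ℝ} (ha : 0 < a) (hab : a ≤ b) (hq : 0 ≤ q) (hq1 : q ≤ 1) :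
    q * b ^ (q - 1) * (b - a) ≤ b ^ q - a ^ q := by
  have hb : 0 < b := ha.trans_le hab
  have hx : 0 ≤ a / b := by positivity
  have key : q * (1 - a / b) ≤ 1 - (a / b) ^ q := by
    have := rpow_one_add_le_one_add_mul_self (s := a / b - 1) (by linarith) hq hq1
    simp only [add_sub_cancel] at this
    nlinarith
  have e1 : (a / b) ^ q = a ^ q / b ^ q := Real.div_rpow ha.le hb.le q
  have e2 : b ^ (q - 1) = b ^ q / b := by rw [Real.rpow_sub_one hb.ne']
  have hbq : 0 < b ^ q := Real.rpow_pos_of_pos hb q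
  rw [e1] at key
  have := mul_le_mul_of_nonneg_left key hbq.le
  rw [e2]
  have e3 : b ^ q * (1 - a ^ q / b ^ q) = b ^ q - a ^ q := by field_simp
  have e4 : b ^ q * (q * (1 - a / b)) = q * (b ^ q / b) * (b - a) := by field_simp
  rw [e3, e4] at this
  exact this

lemma abs_rpow_sub_rpow_le {a b q : ℝ} (ha : 0 < a) (hb : 0 < b) (hq : 0 ≤ q) :
    |b ^ q - a ^ q| ≤ (1 + q) * (max a b) ^ (q - 1) * |b - a| := by
  rcases le_total a b with h | h
  · rw [max_eq_right h, abs_of_nonneg (sub_nonneg.2 h),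
      abs_of_nonneg (sub_nonneg.2 (Real.rpow_le_rpow ha.le h hq))]
    exact rpow_sub_rpow_le ha h hq
  · rw [max_eq_left h, abs_of_nonpos (sub_nonpos.2 h),
      abs_of_nonpos (sub_nonpos.2 (Real.rpow_le_rpow hb.le h hq)), neg_sub, neg_sub]
    exact rpow_sub_rpow_le hb h hq

/-- Monotonicity of `w ↦ ⟨w⟩^q w` in quantitative form. -/
lemma jb_rpow_mul_sub_ge {q w w' : ℝ} (hq : -(1 / 2) ≤ q) :
    (1 / 2) * (max (jb w) (jb w')) ^ q * (w' - w) ^ 2 ≤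
      (jb w' ^ q * w' - jb w ^ q * w) * (w' - w) := by
  wlog hle : jb w ≤ jb w' generalizing w w'
  · have := this (w := w') (w' := w) (le_of_not_ge hle)
    rw [max_comm]
    nlinarith
  rw [max_eq_right hle]
  have ha := jb_pos w
  have hb := jb_pos w'
  have h1 := jb_sq w
  have h2 := jb_sq w'
  have hd := abs_jb_sub_le w w'
  rw [← sq_le_sq] at hd
  set a := jb w
  set b := jb w'
  have hA : 0 < a ^ q := Real.rpow_pos_of_pos ha q
  have hB : 0 < b ^ q := Real.rpow_pos_of_pos hb q
  have id1 : (b ^ q * w' - a ^ q * w) * (w' - w) =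
      (1 / 2) * (a ^ q + b ^ q) * (w' - w) ^ 2 + (1 / 2) * (b ^ 2 - a ^ 2) * (b ^ q - a ^ q) := by
    rw [h1, h2]; ring
  rw [id1]
  rcases le_total 0 q with h | h
  · have : a ^ q ≤ b ^ q := Real.rpow_le_rpow ha.le hle h
    have h3 : 0 ≤ (b ^ 2 - a ^ 2) * (b ^ q - a ^ q) :=
      mul_nonneg (by nlinarith) (by linarith)
    nlinarith [mul_nonneg hA.le (sq_nonneg (w' - w))]
  · have hba : b ^ q ≤ a ^ q := Real.rpow_le_rpow_of_nonpos ha hle h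
    have hc := le_rpow_sub_rpow ha hle (q := q + 1) (by linarith) (by linarith)
    rw [add_sub_cancel_right, Real.rpow_add_one ha.ne', Real.rpow_add_one hb.ne'] at hc
    have hc' : (q + 1) * b ^ q * (b - a) ^ 2 ≤ (b - a) * (b ^ q * b - a ^ q * a) := by
      nlinarith [mul_le_mul_of_nonneg_left hc (sub_nonneg.2 hle)]
    have h4 : b ^ q * ((w' - w) ^ 2 - (b - a) ^ 2) ≤
        (1 / 2) * (a ^ q + b ^ q) * ((w' - w) ^ 2 - (b - a) ^ 2) := by
      apply mul_le_mul_of_nonneg_right _ (by linarith)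
      linarith
    have h5 : (1 / 2) * (b ^ q * (b - a) ^ 2) ≤ (q + 1) * b ^ q * (b - a) ^ 2 := by
      have : 0 ≤ b ^ q * (b - a) ^ 2 := by positivity
      nlinarith
    have h6 : b ^ q * (b - a) ^ 2 ≤ b ^ q * (w' - w) ^ 2 := mul_le_mul_of_nonneg_left hd hB.le
    nlinarith

lemma abs_jb_rpow_mul_sub_le {q w w' : ℝ} (hq : -(1 / 2) ≤ q) :
    |jb w' ^ q * w' - jb w ^ q * w| ≤ (3 + |q|) * (max (jb w) (jb w')) ^ q * |w' - w| := by
  wlog hle : jb w ≤ jb w' generalizing w w'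
  · have := this (w := w') (w' := w) (le_of_not_ge hle)
    rwa [max_comm, abs_sub_comm, abs_sub_comm w'] 
  rw [max_eq_right hle]
  have ha := jb_pos w
  have hb := jb_pos w'
  have hd := abs_jb_sub_le w w'
  have hw := abs_le_jb w
  set a := jb w
  set b := jb w'
  have hA : 0 < a ^ q := Real.rpow_pos_of_pos ha q
  have hB : 0 < b ^ q := Real.rpow_pos_of_pos hb q
  rw [abs_of_nonneg (sub_nonneg.2 hle)] at hd
  have key : |b ^ q - a ^ q| * a ≤ (2 + |q|) * b ^ q * (b - a) := by
    rcases le_total 0 q with h | h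
    · have h1 := rpow_sub_rpow_le ha hle h
      rw [abs_of_nonneg (sub_nonneg.2 (Real.rpow_le_rpow ha.le hle h)), abs_of_nonneg h]
      have e2 : b ^ (q - 1) * b = b ^ q := by rw [Real.rpow_sub_one hb.ne']; field_simp
      have h0 : 0 ≤ b ^ q - a ^ q := sub_nonneg.2 (Real.rpow_le_rpow ha.le hle h)
      calc (b ^ q - a ^ q) * a ≤ (b ^ q - a ^ q) * b := mul_le_mul_of_nonneg_left hle h0
        _ ≤ ((1 + q) * b ^ (q - 1) * (b - a)) * b := mul_le_mul_of_nonneg_right h1 hb.le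
        _ = (1 + q) * b ^ q * (b - a) := by rw [← e2]; ring
        _ ≤ _ := by
          have : 0 ≤ b ^ q * (b - a) := mul_nonneg hB.le (sub_nonneg.2 hle)
          nlinarith
    · have h1 : b ^ q ≤ a ^ q := Real.rpow_le_rpow_of_nonpos ha hle h
      rw [abs_of_nonpos (by linarith), neg_sub]
      have h3 : (1 : ℝ) ≤ b / a := by rw [one_le_div ha]; exact hle
      have h2 : (b / a) ^ (-q) ≤ b / a := by
        calc (b / a) ^ (-q) ≤ (b / a) ^ (1 : ℝ) :=
              Real.rpow_le_rpow_of_exponent_le h3 (by linarith)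
          _ = b / a := Real.rpow_one _
      rw [Real.div_rpow hb.le ha.le, Real.rpow_neg hb.le, Real.rpow_neg ha.le, inv_div_inv,
        div_le_div_iff₀ hB ha] at h2
      have : 0 ≤ b ^ q * (b - a) := mul_nonneg hB.le (sub_nonneg.2 hle)
      nlinarith [abs_nonneg q]
  have e : b ^ q * w' - a ^ q * w = b ^ q * (w' - w) + (b ^ q - a ^ q) * w := by ring
  rw [e]
  calc |b ^ q * (w' - w) + (b ^ q - a ^ q) * w| ≤ |b ^ q * (w' - w)| + |(b ^ q - a ^ q) * w| :=
        abs_add_le _ _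
    _ = b ^ q * |w' - w| + |b ^ q - a ^ q| * |w| := by rw [abs_mul, abs_mul, abs_of_pos hB]
    _ ≤ b ^ q * |w' - w| + |b ^ q - a ^ q| * a := by
        gcongr
    _ ≤ b ^ q * |w' - w| + (2 + |q|) * b ^ q * (b - a) := by linarith
    _ ≤ b ^ q * |w' - w| + (2 + |q|) * b ^ q * |w' - w| := by
        gcongr
    _ = _ := by ring

lemma abs_jb_rpow_sub_le {q w w' : ℝ} (hq : 0 ≤ q) :
    |jb w' ^ q - jb w ^ q| ≤ (1 + q) * (max (jb w) (jb w')) ^ (q - 1) * |w' - w| := by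
  refine (abs_rpow_sub_rpow_le (jb_pos w) (jb_pos w') hq).trans ?_
  have : 0 < max (jb w) (jb w') := lt_max_of_lt_left (jb_pos w)
  exact mul_le_mul_of_nonneg_left (abs_jb_sub_le w w') (by positivity)

lemma young_rpow {p ε : ℝ} (hp : 0 ≤ p) (hε : 0 < ε) {a y : ℝ} (ha : 0 ≤ a) (hy : 0 ≤ y) :
    a ^ p * y ≤ ε * a ^ (p + 1) + ε ^ (-p) * y ^ (p + 1) := by
  rcases le_total y (ε * a) with h | h
  · have h1 : a ^ p * y ≤ ε * a ^ (p + 1) := by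
      rw [Real.rpow_add_one' ha (by linarith)]
      nlinarith [mul_le_mul_of_nonneg_left h (Real.rpow_nonneg ha p)]
    have : 0 ≤ ε ^ (-p) * y ^ (p + 1) := by positivity
    linarith
  · have h1 : a ≤ y / ε := by rw [le_div_iff₀ hε]; linarith
    have h2 : a ^ p ≤ (y / ε) ^ p := Real.rpow_le_rpow ha h1 hp
    rw [Real.div_rpow hy hε.le] at h2
    have h3 : a ^ p * y ≤ ε ^ (-p) * y ^ (p + 1) := by
      rw [Real.rpow_add_one' hy (by linarith), Real.rpow_neg hε.le]
      calc a ^ p * y ≤ (y ^ p / ε ^ p) * y := mul_le_mul_of_nonneg_right h2 hy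
        _ = _ := by rw [div_eq_mul_inv]; ring
    have : 0 ≤ ε * a ^ (p + 1) := by positivity
    linarith

/-- The discrete torus `(ℤ/N)^n`. -/
abbrev Grid (n N : ℕ) := Fin n → ZMod N

section Lattice

variable {n N : ℕ}

/-- The unit step in direction `i`. -/
def stp (i : Fin n) : Grid n N := Pi.single i 1

/-- Forward difference quotient. -/
noncomputable def ldiff (h : ℝ) (i : Fin n) (f : Grid n N → ℝ) (x : Grid n N) : ℝ :=
  (f (x + stp i) - f x) / h

/-- Discrete Laplacian. -/
noncomputable def llap (h : ℝ) (f : Grid n N → ℝ) (x : Grid n N) : ℝ :=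
  ∑ i, (f (x + stp i) + f (x - stp i) - 2 * f x) / h ^ 2

variable [NeZero N]

/-- Riemann sum of a lattice function. -/
noncomputable def lsum (h : ℝ) (f : Grid n N → ℝ) : ℝ := h ^ n * ∑ x, f x

/-- Riemann sum over the edges of the lattice. -/
noncomputable def esum (h : ℝ) (f : Fin n → Grid n N → ℝ) : ℝ := ∑ i, lsum h (f i)

variable {h : ℝ} {f g : Grid n N → ℝ}

lemma lsum_mono (hh : 0 ≤ h) (hfg : ∀ x, f x ≤ g x) : lsum h f ≤ lsum h g :=
  mul_le_mul_of_nonneg_left (Finset.sum_le_sum fun x _ => hfg x) (by positivity)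

lemma lsum_nonneg (hh : 0 ≤ h) (hf : ∀ x, 0 ≤ f x) : 0 ≤ lsum h f :=
  mul_nonneg (by positivity) (Finset.sum_nonneg fun x _ => hf x)

lemma lsum_add (f g : Grid n N → ℝ) : lsum h (fun x => f x + g x) = lsum h f + lsum h g := by
  simp only [lsum, Finset.sum_add_distrib, mul_add]

lemma lsum_sub (f g : Grid n N → ℝ) : lsum h (fun x => f x - g x) = lsum h f - lsum h g := by
  simp only [lsum, Finset.sum_sub_distrib, mul_sub]

lemma lsum_neg (f : Grid n N → ℝ) : lsum h (fun x => - f x) = - lsum h f := by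
  simp only [lsum, Finset.sum_neg_distrib, mul_neg]

lemma lsum_const_mul (c : ℝ) (f : Grid n N → ℝ) : lsum h (fun x => c * f x) = c * lsum h f := by
  simp only [lsum, ← Finset.mul_sum]; ring

lemma lsum_sum {ι : Type*} (s : Finset ι) (f : ι → Grid n N → ℝ) :
    lsum h (fun x => ∑ i ∈ s, f i x) = ∑ i ∈ s, lsum h (f i) := by
  simp only [lsum]
  rw [Finset.sum_comm, Finset.mul_sum]

lemma abs_lsum_le (hh : 0 ≤ h) (f : Grid n N → ℝ) : |lsum h f| ≤ lsum h (fun x => |f x|) := by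
  simp only [lsum, abs_mul, abs_of_nonneg (pow_nonneg hh n)]
  exact mul_le_mul_of_nonneg_left (Finset.abs_sum_le_sum_abs _ _) (by positivity)

lemma lsum_add_right (a : Grid n N) (f : Grid n N → ℝ) : lsum h (fun x => f (x + a)) = lsum h f := by
  simp only [lsum]
  congr 1
  exact Equiv.sum_comp (Equiv.addRight a) f

lemma lsum_sub_right (a : Grid n N) (f : Grid n N → ℝ) : lsum h (fun x => f (x - a)) = lsum h f := by
  simpa only [sub_eq_add_neg] using lsum_add_right (-a) f

variable {e e' : Fin n → Grid n N → ℝ}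

lemma esum_mono (hh : 0 ≤ h) (he : ∀ i x, e i x ≤ e' i x) : esum h e ≤ esum h e' :=
  Finset.sum_le_sum fun i _ => lsum_mono hh (he i)

lemma esum_nonneg (hh : 0 ≤ h) (he : ∀ i x, 0 ≤ e i x) : 0 ≤ esum h e :=
  Finset.sum_nonneg fun i _ => lsum_nonneg hh (he i)

lemma esum_add (e e' : Fin n → Grid n N → ℝ) :
    esum h (fun i x => e i x + e' i x) = esum h e + esum h e' := by
  simp only [esum, lsum_add, Finset.sum_add_distrib]

lemma esum_sub (e e' : Fin n → Grid n N → ℝ) :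
    esum h (fun i x => e i x - e' i x) = esum h e - esum h e' := by
  simp only [esum, lsum_sub, Finset.sum_sub_distrib]

lemma esum_const_mul (c : ℝ) (e : Fin n → Grid n N → ℝ) :
    esum h (fun i x => c * e i x) = c * esum h e := by
  simp only [esum, lsum_const_mul, Finset.mul_sum]

lemma abs_esum_le (hh : 0 ≤ h) (e : Fin n → Grid n N → ℝ) :
    |esum h e| ≤ esum h (fun i x => |e i x|) :=
  (Finset.abs_sum_le_sum_abs _ _).trans (Finset.sum_le_sum fun _ _ => abs_lsum_le hh _)

lemma esum_const (f : Grid n N → ℝ) : esum h (fun _ x => f x) = n * lsum h f := by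
  simp [esum]

/-- A sum over vertices of second differences as a sum over edges. -/
lemma lsum_sum_second_diff (A B : Fin n → Grid n N → ℝ) (F : Grid n N → ℝ)
    (hB : ∀ i x, B i (x + stp i) = - A i x) :
    lsum h (fun x => F x * ∑ i, (A i x + B i x)) =
      - esum h (fun i x => (F (x + stp i) - F x) * A i x) := by
  simp only [Finset.mul_sum, lsum_sum, esum, ← Finset.sum_neg_distrib]
  refine Finset.sum_congr rfl fun i _ => ?_
  simp only [mul_add, lsum_add, sub_mul, lsum_sub]
  rw [← lsum_add_right (stp i) (fun x => F x * B i x)]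
  simp only [hB, mul_neg, lsum_neg]
  ring

lemma lsum_mul_llap (hh : h ≠ 0) (F g : Grid n N → ℝ) :
    lsum h (fun x => F x * llap h g x) = - esum h (fun i x => ldiff h i F x * ldiff h i g x) := by
  have := lsum_sum_second_diff (h := h) (fun i x => (g (x + stp i) - g x) / h ^ 2)
    (fun i x => (g (x - stp i) - g x) / h ^ 2) F
    (fun i x => by simp only [add_sub_cancel_right]; ring)
  convert this using 2
  · funext x
    simp only [llap]
    congr 1
    refine Finset.sum_congr rfl fun i _ => ?_
    ring
  · unfold ldiff
    congr 1
    funext i x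
    field_simp

/-- Integration by parts for the conformally changed operator. -/
lemma lsum_mul_conformal (hh : h ≠ 0) (F u z : Grid n N → ℝ) :
    lsum h (fun x => F x * (u x * llap h (fun y => z y * u y) x - z x * u x * llap h u x)) =
      - esum h (fun i x => u x * u (x + stp i) * (ldiff h i F x * ldiff h i z x)) := by
  have := lsum_sum_second_diff (h := h)
    (fun i x => u x * u (x + stp i) * (z (x + stp i) - z x) / h ^ 2)
    (fun i x => u x * u (x - stp i) * (z (x - stp i) - z x) / h ^ 2) F
    (fun i x => by simp only [add_sub_cancel_right]; ring)
  convert this using 2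
  · funext x
    simp only [llap, Finset.mul_sum, ← Finset.sum_sub_distrib]
    refine Finset.sum_congr rfl fun i _ => ?_
    ring
  · unfold ldiff
    congr 1
    funext i x
    field_simp

/-- The discrete Bochner-type identity for `|Du|²`. -/
lemma esum_avg_mul_sq (hh : h ≠ 0) (F u : Grid n N → ℝ) :
    esum h (fun i x => (F x + F (x + stp i)) / 2 * ldiff h i u x ^ 2) =
      - (1 / 2) * esum h (fun i x => ldiff h i F x * ldiff h i (fun y => u y ^ 2) x)
        - lsum h (fun x => F x * (u x * llap h u x)) := by
  have h1 := lsum_mul_llap hh (fun x => F x * u x) u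
  have h2 : lsum h (fun x => F x * (u x * llap h u x)) =
      lsum h (fun x => F x * u x * llap h u x) := by
    congr 1; funext x; ring
  rw [h2, h1, ← esum_const_mul, sub_neg_eq_add, ← esum_add]
  congr 1
  funext i x
  simp only [ldiff]
  ring

/-- Admissible weight functions. -/
structure IsWt (h Cη : ℝ) (η : Grid n N → ℝ) : Prop where
  hpos : 0 < h
  hle : h ≤ 1
  len : 1 ≤ (N : ℝ) * h
  pos : ∀ x, 0 < η x
  le_one : ∀ x, η x ≤ 1
  lip : ∀ i x, |η (x + stp i) - η x| ≤ h
  dbl : ∀ i x, η (x + stp i) ≤ 2 * η x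
  dbl' : ∀ i x, η x ≤ 2 * η (x + stp i)
  sum_le : lsum h η ≤ Cη

end Lattice

section EdgeScalar

variable {s q h η η' w w' : ℝ}

lemma rpow_dbl (hη : 0 < η) (hη' : 0 < η') (h2 : η' ≤ 2 * η) (hs : 0 ≤ s) :
    η' ^ s ≤ 2 ^ s * η ^ s := by
  rw [← Real.mul_rpow (by norm_num) hη.le]
  exact Real.rpow_le_rpow hη'.le h2 hs

lemma abs_wt_rpow_sub_le (hs : 1 ≤ s) (hη : 0 < η) (hη' : 0 < η') (hl : |η' - η| ≤ h)
    (h2 : η' ≤ 2 * η) : |η' ^ s - η ^ s| ≤ (1 + s) * 2 ^ s * (h * η ^ (s - 1)) := by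
  have h1 := abs_rpow_sub_rpow_le hη hη' (q := s) (by linarith)
  have hm : max η η' ≤ 2 * η := max_le (by linarith) h2
  have hm0 : 0 < max η η' := lt_max_of_lt_left hη
  have h3 : max η η' ^ (s - 1) ≤ 2 ^ s * η ^ (s - 1) := by
    calc max η η' ^ (s - 1) ≤ (2 * η) ^ (s - 1) := Real.rpow_le_rpow hm0.le hm (by linarith)
      _ = 2 ^ (s - 1) * η ^ (s - 1) := Real.mul_rpow (by norm_num) hη.le
      _ ≤ 2 ^ s * η ^ (s - 1) := by
        gcongr
        · norm_num
        · linarith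
  calc |η' ^ s - η ^ s| ≤ (1 + s) * max η η' ^ (s - 1) * |η' - η| := h1
    _ ≤ (1 + s) * (2 ^ s * η ^ (s - 1)) * h := by
      gcongr
    _ = _ := by ring

lemma jb_rpow_mul_le_max (hq : 0 ≤ q + 1) :
    |jb w' ^ q * w'| ≤ max (jb w) (jb w') ^ (q + 1) := by
  have hb := jb_pos w'
  rw [abs_mul, abs_of_pos (Real.rpow_pos_of_pos hb q)]
  calc jb w' ^ q * |w'| ≤ jb w' ^ q * jb w' := by
        gcongr
        exact abs_le_jb w'
    _ = jb w' ^ (q + 1) := (Real.rpow_add_one hb.ne' q).symm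
    _ ≤ _ := Real.rpow_le_rpow hb.le (le_max_right _ _) hq

lemma abs_edge_diff_signed_le (hs : 1 ≤ s) (hq : -(1 / 2) ≤ q) (hη : 0 < η) (hη' : 0 < η')
    (hl : |η' - η| ≤ h) (h2 : η' ≤ 2 * η) :
    |η' ^ s * (jb w' ^ q * w') - η ^ s * (jb w ^ q * w)| ≤ (3 + |q| + (1 + s) * 2 ^ s) *
      (η ^ s * max (jb w) (jb w') ^ q * |w' - w| +
        h * η ^ (s - 1) * max (jb w) (jb w') ^ (q + 1)) := by
  have hm : 0 < max (jb w) (jb w') := lt_max_of_lt_left (jb_pos w)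
  have h1 := abs_wt_rpow_sub_le hs hη hη' hl h2
  have h3 := abs_jb_rpow_mul_sub_le (w := w) (w' := w') hq
  have h4 := jb_rpow_mul_le_max (q := q) (w := w) (w' := w') (by linarith)
  have hh : 0 ≤ h := (abs_nonneg _).trans hl
  set m := max (jb w) (jb w')
  have e : η' ^ s * (jb w' ^ q * w') - η ^ s * (jb w ^ q * w) =
    η ^ s * (jb w' ^ q * w' - jb w ^ q * w) + (η' ^ s - η ^ s) * (jb w' ^ q * w') := by ring
  have hηs : 0 < η ^ s := Real.rpow_pos_of_pos hη s
  have n1 : 0 ≤ η ^ s * m ^ q * |w' - w| := by positivity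
  have n2 : 0 ≤ h * η ^ (s - 1) * m ^ (q + 1) := by positivity
  have n3 : 0 ≤ (1 + s) * 2 ^ s := by positivity
  calc _ ≤ η ^ s * |jb w' ^ q * w' - jb w ^ q * w| + |η' ^ s - η ^ s| * |jb w' ^ q * w'| := by
        rw [e]
        refine (abs_add_le _ _).trans ?_
        rw [abs_mul, abs_mul, abs_of_pos hηs]
    _ ≤ η ^ s * ((3 + |q|) * m ^ q * |w' - w|) +
        (1 + s) * 2 ^ s * (h * η ^ (s - 1)) * m ^ (q + 1) := by gcongr
    _ = (3 + |q|) * (η ^ s * m ^ q * |w' - w|) +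
        (1 + s) * 2 ^ s * (h * η ^ (s - 1) * m ^ (q + 1)) := by ring
    _ ≤ _ := by nlinarith [abs_nonneg q, mul_nonneg n3 n1, mul_nonneg (abs_nonneg q) n2]

lemma abs_edge_diff_le (hs : 1 ≤ s) (hq : 0 ≤ q) (hη : 0 < η) (hη' : 0 < η')
    (hl : |η' - η| ≤ h) (h2 : η' ≤ 2 * η) :
    |η' ^ s * jb w' ^ q - η ^ s * jb w ^ q| ≤ (1 + q + (1 + s) * 2 ^ s) *
      (η ^ s * max (jb w) (jb w') ^ (q - 1) * |w' - w| +
        h * η ^ (s - 1) * max (jb w) (jb w') ^ q) := by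
  have hm : 0 < max (jb w) (jb w') := lt_max_of_lt_left (jb_pos w)
  have h1 := abs_wt_rpow_sub_le hs hη hη' hl h2
  have h3 := abs_jb_rpow_sub_le (w := w) (w' := w') hq
  have h4 : jb w' ^ q ≤ max (jb w) (jb w') ^ q :=
    Real.rpow_le_rpow (jb_pos w').le (le_max_right _ _) hq
  have hh : 0 ≤ h := (abs_nonneg _).trans hl
  set m := max (jb w) (jb w')
  have e : η' ^ s * jb w' ^ q - η ^ s * jb w ^ q =
    η ^ s * (jb w' ^ q - jb w ^ q) + (η' ^ s - η ^ s) * jb w' ^ q := by ring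
  have hηs : 0 < η ^ s := Real.rpow_pos_of_pos hη s
  have n1 : 0 ≤ η ^ s * m ^ (q - 1) * |w' - w| := by positivity
  have n2 : 0 ≤ h * η ^ (s - 1) * m ^ q := by positivity
  have n3 : 0 ≤ (1 + s) * 2 ^ s := by positivity
  have hbq : 0 < jb w' ^ q := Real.rpow_pos_of_pos (jb_pos w') q
  calc _ ≤ η ^ s * |jb w' ^ q - jb w ^ q| + |η' ^ s - η ^ s| * jb w' ^ q := by
        rw [e]
        refine (abs_add_le _ _).trans ?_
        rw [abs_mul, abs_mul, abs_of_pos hηs, abs_of_pos hbq]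
    _ ≤ η ^ s * ((1 + q) * m ^ (q - 1) * |w' - w|) +
        (1 + s) * 2 ^ s * (h * η ^ (s - 1)) * m ^ q := by gcongr
    _ = (1 + q) * (η ^ s * m ^ (q - 1) * |w' - w|) +
        (1 + s) * 2 ^ s * (h * η ^ (s - 1) * m ^ q) := by ring
    _ ≤ _ := by nlinarith [mul_nonneg n3 n1, mul_nonneg hq n2]

lemma edge_coercive (hs : 2 ≤ s) (hq : -(1 / 2) ≤ q) (hη : 0 < η) (hη' : 0 < η')
    (hl : |η' - η| ≤ h) (h2 : η' ≤ 2 * η) :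
    (1 / 4) * (η ^ s * max (jb w) (jb w') ^ q * (w' - w) ^ 2) -
        ((1 + s) * 2 ^ s) ^ 2 * (h ^ 2 * (η ^ (s - 2) * max (jb w) (jb w') ^ (q + 2))) ≤
      (η' ^ s * (jb w' ^ q * w') - η ^ s * (jb w ^ q * w)) * (w' - w) := by
  have hm : 0 < max (jb w) (jb w') := lt_max_of_lt_left (jb_pos w)
  have h1 := abs_wt_rpow_sub_le (s := s) (by linarith) hη hη' hl h2
  have h3 := jb_rpow_mul_sub_ge (w := w) (w' := w') hq
  have h4 := jb_rpow_mul_le_max (q := q) (w := w) (w' := w') (by linarith)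
  have hh : 0 ≤ h := (abs_nonneg _).trans hl
  set m := max (jb w) (jb w')
  set K := (1 + s) * 2 ^ s with hK
  have hK0 : 0 ≤ K := by positivity
  have hηs : 0 < η ^ s := Real.rpow_pos_of_pos hη s
  have hmq : 0 < m ^ q := Real.rpow_pos_of_pos hm q
  have e : (η' ^ s * (jb w' ^ q * w') - η ^ s * (jb w ^ q * w)) * (w' - w) =
    η ^ s * ((jb w' ^ q * w' - jb w ^ q * w) * (w' - w)) +
      (η' ^ s - η ^ s) * (jb w' ^ q * w') * (w' - w) := by ring
  have t1 : η ^ s * ((1 / 2) * m ^ q * (w' - w) ^ 2) ≤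
      η ^ s * ((jb w' ^ q * w' - jb w ^ q * w) * (w' - w)) :=
    mul_le_mul_of_nonneg_left h3 hηs.le
  have e1 : m ^ (q + 1) = m ^ q * m := Real.rpow_add_one hm.ne' q
  have e2 : m ^ (q + 2) = m ^ q * m ^ 2 := by
    rw [Real.rpow_add hm]; norm_cast
  have e3 : η ^ (s - 1) = η ^ (s - 2) * η := by
    rw [← Real.rpow_add_one hη.ne']; ring_nf
  have e4 : η ^ s = η ^ (s - 2) * η ^ 2 := by
    rw [← Real.rpow_natCast η 2, ← Real.rpow_add hη]; norm_num
  have t2 : |(η' ^ s - η ^ s) * (jb w' ^ q * w') * (w' - w)| ≤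
      (1 / 4) * (η ^ s * m ^ q * (w' - w) ^ 2) + K ^ 2 * (h ^ 2 * (η ^ (s - 2) * m ^ (q + 2))) := by
    rw [abs_mul, abs_mul]
    have : |η' ^ s - η ^ s| * |jb w' ^ q * w'| * |w' - w| ≤
        (K * (h * η ^ (s - 1))) * m ^ (q + 1) * |w' - w| := by gcongr
    refine this.trans ?_
    rw [e1, e2, e3, e4, ← sq_abs (w' - w)]
    have hp : 0 < η ^ (s - 2) * m ^ q := mul_pos (Real.rpow_pos_of_pos hη _) hmq
    have := mul_nonneg hp.le (sq_nonneg ((1 / 2) * η * |w' - w| - K * h * m))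
    nlinarith
  have := neg_abs_le ((η' ^ s - η ^ s) * (jb w' ^ q * w') * (w' - w))
  rw [e]
  linarith

end EdgeScalar

section EdgeLattice

variable {n N : ℕ} [NeZero N] {h Cη : ℝ} {η : Grid n N → ℝ}

/-- The larger of the brackets at the two ends of an edge. -/
noncomputable def emax (W : Grid n N → ℝ) (i : Fin n) (x : Grid n N) : ℝ :=
  max (jb (W x)) (jb (W (x + stp i)))

lemma emax_pos (W : Grid n N → ℝ) (i : Fin n) (x : Grid n N) : 0 < emax W i x :=
  lt_max_of_lt_left (jb_pos _)

lemma one_le_emax (W : Grid n N → ℝ) (i : Fin n) (x : Grid n N) : 1 ≤ emax W i x :=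
  (one_le_jb _).trans (le_max_left _ _)

/-- The weighted Dirichlet energy of `⟨W⟩^{q/2} W`. -/
noncomputable def wdir (h : ℝ) (η : Grid n N → ℝ) (s q : ℝ) (W : Grid n N → ℝ) : ℝ :=
  esum h fun i x => η x ^ s * emax W i x ^ q * ldiff h i W x ^ 2

/-- The weighted moment `S(η^s ⟨W⟩^p)`. -/
noncomputable def wmom (h : ℝ) (η : Grid n N → ℝ) (s p : ℝ) (W : Grid n N → ℝ) : ℝ :=
  lsum h fun x => η x ^ s * jb (W x) ^ p

lemma wdir_nonneg (hη : IsWt h Cη η) (s q : ℝ) (W : Grid n N → ℝ) : 0 ≤ wdir h η s q W :=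
  esum_nonneg hη.hpos.le fun i x => by
    have := hη.pos x; have := emax_pos W i x; positivity

lemma wmom_nonneg (hη : IsWt h Cη η) (s q : ℝ) (W : Grid n N → ℝ) : 0 ≤ wmom h η s q W :=
  lsum_nonneg hη.hpos.le fun x => by
    have := hη.pos x; have := jb_pos (W x); positivity

lemma abs_ldiff_wt_signed_le (hη : IsWt h Cη η) {s q : ℝ} (hs : 1 ≤ s) (hq : -(1 / 2) ≤ q)
    (W : Grid n N → ℝ) (i : Fin n) (x : Grid n N) :
    |ldiff h i (fun y => η y ^ s * (jb (W y) ^ q * W y)) x| ≤ (3 + |q| + (1 + s) * 2 ^ s) *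
      (η x ^ s * emax W i x ^ q * |ldiff h i W x| + η x ^ (s - 1) * emax W i x ^ (q + 1)) := by
  have hh := hη.hpos
  have := abs_edge_diff_signed_le (w := W x) (w' := W (x + stp i)) hs hq (hη.pos x) (hη.pos _)
    (hη.lip i x) (hη.dbl i x)
  unfold ldiff emax
  rw [abs_div, abs_div, abs_of_pos hh, div_le_iff₀ hh]
  refine this.trans (le_of_eq ?_)
  field_simp

lemma abs_ldiff_wt_le (hη : IsWt h Cη η) {s q : ℝ} (hs : 1 ≤ s) (hq : 0 ≤ q)
    (W : Grid n N → ℝ) (i : Fin n) (x : Grid n N) :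
    |ldiff h i (fun y => η y ^ s * jb (W y) ^ q) x| ≤ (1 + q + (1 + s) * 2 ^ s) *
      (η x ^ s * emax W i x ^ (q - 1) * |ldiff h i W x| + η x ^ (s - 1) * emax W i x ^ q) := by
  have hh := hη.hpos
  have := abs_edge_diff_le (w := W x) (w' := W (x + stp i)) hs hq (hη.pos x) (hη.pos _)
    (hη.lip i x) (hη.dbl i x)
  unfold ldiff emax
  rw [abs_div, abs_div, abs_of_pos hh, div_le_iff₀ hh]
  refine this.trans (le_of_eq ?_)
  field_simp

/-- Replacing edge maxima by vertex values. -/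
lemma esum_emax_le (hη : IsWt h Cη η) {s q : ℝ} (hs : 0 ≤ s) (W : Grid n N → ℝ) :
    esum h (fun i x => η x ^ s * emax W i x ^ q) ≤ n * (1 + 2 ^ s) * wmom h η s q W := by
  have hh := hη.hpos
  have h1 : esum h (fun i x => η x ^ s * emax W i x ^ q) ≤
      esum h (fun i x => η x ^ s * jb (W x) ^ q +
        2 ^ s * (η (x + stp i) ^ s * jb (W (x + stp i)) ^ q)) := by
    refine esum_mono hh.le fun i x => ?_
    have p1 := Real.rpow_pos_of_pos (hη.pos x) s
    have p2 := Real.rpow_pos_of_pos (jb_pos (W x)) q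
    have p3 := Real.rpow_pos_of_pos (jb_pos (W (x + stp i))) q
    have d := rpow_dbl (s := s) (hη.pos (x + stp i)) (hη.pos x) (hη.dbl' i x) hs
    have : emax W i x ^ q ≤ jb (W x) ^ q + jb (W (x + stp i)) ^ q := by
      unfold emax
      rcases max_choice (jb (W x)) (jb (W (x + stp i))) with h | h <;> rw [h] <;> linarith
    calc η x ^ s * emax W i x ^ q ≤ η x ^ s * (jb (W x) ^ q + jb (W (x + stp i)) ^ q) := by gcongr
      _ ≤ _ := by nlinarith [mul_le_mul_of_nonneg_right d p3.le]
  refine h1.trans (le_of_eq ?_)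
  rw [esum_add, esum_const_mul, esum_const]
  have : esum h (fun i x => η (x + stp i) ^ s * jb (W (x + stp i)) ^ q) = n * wmom h η s q W := by
    simp only [esum, wmom]
    rw [Finset.sum_congr rfl fun i _ => lsum_add_right (stp i) (fun x => η x ^ s * jb (W x) ^ q)]
    simp
  rw [this, wmom]
  ring

/-- The coercivity of the weighted Dirichlet form with conductances. -/
lemma dirichlet_coercive (hη : IsWt h Cη η) {s q lo hi : ℝ} (hs : 2 ≤ s) (hq : -(1 / 2) ≤ q)
    (hlo : 0 ≤ lo) (κ : Fin n → Grid n N → ℝ) (hκ : ∀ i x, lo ≤ κ i x)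
    (hκ' : ∀ i x, κ i x ≤ hi) (W : Grid n N → ℝ) :
    lo / 4 * wdir h η s q W -
        hi * ((1 + s) * 2 ^ s) ^ 2 * (n * (1 + 2 ^ (s - 2))) * wmom h η (s - 2) (q + 2) W ≤
      esum h (fun i x => κ i x *
        (ldiff h i (fun y => η y ^ s * (jb (W y) ^ q * W y)) x * ldiff h i W x)) := by
  have hh := hη.hpos
  rcases isEmpty_or_nonempty (Fin n) with hE | hE
  · have : n = 0 := by
      rcases n with _ | m
      · rfl
      · exact (hE.false 0).elim
    subst this
    simp [wdir, esum]
  have hhi : 0 ≤ hi := by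
    obtain ⟨i⟩ := hE
    exact hlo.trans ((hκ i 0).trans (hκ' i 0))
  have h1 := esum_emax_le hη (s := s - 2) (q := q + 2) (by linarith) W
  have h2 : esum h (fun i x => lo / 4 * (η x ^ s * emax W i x ^ q * ldiff h i W x ^ 2) -
      hi * ((1 + s) * 2 ^ s) ^ 2 * (η x ^ (s - 2) * emax W i x ^ (q + 2))) ≤
      esum h (fun i x => κ i x *
        (ldiff h i (fun y => η y ^ s * (jb (W y) ^ q * W y)) x * ldiff h i W x)) := by
    refine esum_mono hh.le fun i x => ?_
    have c := edge_coercive (w := W x) (w' := W (x + stp i)) hs hq (hη.pos x) (hη.pos _)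
      (hη.lip i x) (hη.dbl i x)
    have p1 := Real.rpow_pos_of_pos (hη.pos x) s
    have p2 := Real.rpow_pos_of_pos (hη.pos x) (s - 2)
    have p3 := Real.rpow_pos_of_pos (emax_pos W i x) q
    have p4 := Real.rpow_pos_of_pos (emax_pos W i x) (q + 2)
    have c' : (1 / 4) * (η x ^ s * emax W i x ^ q * ldiff h i W x ^ 2) -
        ((1 + s) * 2 ^ s) ^ 2 * (η x ^ (s - 2) * emax W i x ^ (q + 2)) ≤
        ldiff h i (fun y => η y ^ s * (jb (W y) ^ q * W y)) x * ldiff h i W x := by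
      unfold ldiff
      rw [div_mul_div_comm, le_div_iff₀ (by positivity)]
      refine le_trans (le_of_eq ?_) c
      unfold emax
      field_simp
    set A := η x ^ s * emax W i x ^ q * ldiff h i W x ^ 2
    set B := ((1 + s) * 2 ^ s) ^ 2 * (η x ^ (s - 2) * emax W i x ^ (q + 2))
    have hA : 0 ≤ A := by positivity
    have hB : 0 ≤ B := by positivity
    have k0 := hlo.trans (hκ i x)
    have := mul_le_mul_of_nonneg_left c' k0
    have k1 := mul_le_mul_of_nonneg_right (hκ i x) hA
    have k2 := mul_le_mul_of_nonneg_right (hκ' i x) hB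
    have e : hi * ((1 + s) * 2 ^ s) ^ 2 * (η x ^ (s - 2) * emax W i x ^ (q + 2)) = hi * B := by
      simp only [B]; ring
    rw [e]
    nlinarith
  rw [esum_sub, esum_const_mul, esum_const_mul] at h2
  refine le_trans ?_ h2
  unfold wdir
  have : 0 ≤ hi * ((1 + s) * 2 ^ s) ^ 2 := by positivity
  nlinarith [mul_le_mul_of_nonneg_left h1 this]

/-- Lower moments with a worse weight are absorbed by the next moment. -/
lemma wmom_absorb (hη : IsWt h Cη η) {s b p ε : ℝ} (hp : 0 ≤ p) (hε : 0 < ε)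
    (hs : b * (p + 1) + 1 ≤ s) (W : Grid n N → ℝ) :
    wmom h η (s - b) p W ≤ ε * wmom h η s (p + 1) W + ε ^ (-p) * Cη := by
  have hh := hη.hpos
  have : wmom h η (s - b) p W ≤
      lsum h (fun x => ε * (η x ^ s * jb (W x) ^ (p + 1)) + ε ^ (-p) * η x) := by
    refine lsum_mono hh.le fun x => ?_
    have hx := hη.pos x
    have p1 := Real.rpow_pos_of_pos hx s
    have y := young_rpow hp hε (jb_pos (W x)).le (Real.rpow_pos_of_pos hx (-b)).le
    rw [← Real.rpow_mul hx.le] at y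
    have e1 : η x ^ (s - b) = η x ^ s * η x ^ (-b) := by
      rw [← Real.rpow_add hx]; ring_nf
    have e2 : η x ^ s * η x ^ (-b * (p + 1)) ≤ η x := by
      rw [← Real.rpow_add hx]
      calc η x ^ (s + -b * (p + 1)) ≤ η x ^ (1 : ℝ) :=
            Real.rpow_le_rpow_of_exponent_ge hx (hη.le_one x) (by linarith)
        _ = η x := Real.rpow_one _
    have e3 : 0 < ε ^ (-p) := Real.rpow_pos_of_pos hε _
    rw [e1]
    nlinarith [mul_le_mul_of_nonneg_left y p1.le, mul_le_mul_of_nonneg_left e2 e3.le]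
  refine this.trans ?_
  rw [lsum_add, lsum_const_mul, lsum_const_mul, wmom]
  have e3 : 0 < ε ^ (-p) := Real.rpow_pos_of_pos hε _
  have := mul_le_mul_of_nonneg_left hη.sum_le e3.le
  linarith

end EdgeLattice

section CubicBound

variable {n N : ℕ} [NeZero N] {h Cη : ℝ} {η : Grid n N → ℝ}

/-- The energy of `u` weighted by moments of `z`. -/
noncomputable def wgrad (h : ℝ) (η : Grid n N → ℝ) (s p : ℝ) (z u : Grid n N → ℝ) : ℝ :=
  esum h fun i x => η x ^ s * emax z i x ^ p * ldiff h i u x ^ 2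

/-- Edge sum of the moments with weight `η^{s-2}`. -/
noncomputable def wedge (h : ℝ) (η : Grid n N → ℝ) (s p : ℝ) (z : Grid n N → ℝ) : ℝ :=
  esum h fun i x => η x ^ (s - 2) * emax z i x ^ p

lemma wedge_nonneg (hη : IsWt h Cη η) (s p : ℝ) (z : Grid n N → ℝ) :
    0 ≤ wedge h η s p z :=
  esum_nonneg hη.hpos.le fun i x => by
    have := hη.pos x; have := emax_pos z i x; positivity

lemma wedge_le (hη : IsWt h Cη η) {s p ε : ℝ} (hp : 0 ≤ p) (hε : 0 < ε)
    (hs : 2 * (p + 1) + 1 ≤ s) (z : Grid n N → ℝ) :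
    wedge h η s p z ≤
      n * (1 + 2 ^ (s - 2)) * (ε * wmom h η s (p + 1) z + ε ^ (-p) * Cη) := by
  refine (esum_emax_le hη (by linarith) z).trans ?_
  have := wmom_absorb hη hp hε hs z
  gcongr

/-- Cross terms are controlled by the weighted energies. -/
lemma esum_cross_le (hη : IsWt h Cη η) {s p l : ℝ} (hl : 0 < l) (z u : Grid n N → ℝ) :
    esum h (fun i x => (η x ^ s * emax z i x ^ (p - 1) * |ldiff h i z x| +
        η x ^ (s - 1) * emax z i x ^ p) * |ldiff h i u x|) ≤
      2 * l * wgrad h η s p z u + l⁻¹ * (wdir h η s (p - 2) z + wedge h η s p z) := by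
  have hh := hη.hpos
  have : esum h (fun i x => (η x ^ s * emax z i x ^ (p - 1) * |ldiff h i z x| +
        η x ^ (s - 1) * emax z i x ^ p) * |ldiff h i u x|) ≤
      esum h (fun i x => 2 * l * (η x ^ s * emax z i x ^ p * ldiff h i u x ^ 2) +
        l⁻¹ * (η x ^ s * emax z i x ^ (p - 2) * ldiff h i z x ^ 2 +
          η x ^ (s - 2) * emax z i x ^ p)) := by
    refine esum_mono hh.le fun i x => ?_
    have hx := hη.pos x
    have hm := emax_pos z i x
    set m := emax z i x
    set e := η x
    have e1 : e ^ (s - 1) = e ^ (s - 2) * e := by rw [← Real.rpow_add_one hx.ne']; ring_nf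
    have e2 : e ^ s = e ^ (s - 2) * e ^ 2 := by
      rw [← Real.rpow_natCast e 2, ← Real.rpow_add hx]; norm_num
    have e3 : m ^ (p - 1) = m ^ (p - 2) * m := by rw [← Real.rpow_add_one hm.ne']; ring_nf
    have e4 : m ^ p = m ^ (p - 2) * m ^ 2 := by
      rw [← Real.rpow_natCast m 2, ← Real.rpow_add hm]; norm_num
    rw [e1, e2, e3, e4, ← sq_abs (ldiff h i u x), ← sq_abs (ldiff h i z x)]
    have c : 0 < e ^ (s - 2) * m ^ (p - 2) := by positivity
    set A := |ldiff h i u x|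
    set B := |ldiff h i z x|
    have k (X Y : ℝ) : X * Y ≤ l * X ^ 2 + l⁻¹ * Y ^ 2 := by
      have : l * X ^ 2 + l⁻¹ * Y ^ 2 - X * Y = l⁻¹ * ((l * X - Y / 2) ^ 2 + 3 / 4 * Y ^ 2) := by
        field_simp; ring
      have h2 : 0 ≤ l⁻¹ * ((l * X - Y / 2) ^ 2 + 3 / 4 * Y ^ 2) := by positivity
      linarith
    have k1 := mul_le_mul_of_nonneg_left (k (e * m * A) (e * B)) c.le
    have k2 := mul_le_mul_of_nonneg_left (k (e * m * A) m) c.le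
    nlinarith
  refine this.trans (le_of_eq ?_)
  rw [esum_add, esum_const_mul, esum_const_mul, esum_add, wgrad, wdir, wedge]

/-- The constant in the weighted product rule. -/
noncomputable def prodC (P s : ℝ) : ℝ := 4 + P + (1 + s) * 2 ^ s

variable {m M a₀ a₁ k₀ P p s CR : ℝ} {u a z R : Grid n N → ℝ}

lemma lsum_mul_young_le (hη : IsWt h Cη η) {ε : ℝ} (hp : 0 ≤ p) (hε : 0 < ε)
    (hCR : lsum h (fun x => η x ^ s * |R x| ^ (p + 1)) ≤ CR) :
    lsum h (fun x => η x ^ s * jb (z x) ^ p * |R x|) ≤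
      ε * wmom h η s (p + 1) z + ε ^ (-p) * CR := by
  have : lsum h (fun x => η x ^ s * jb (z x) ^ p * |R x|) ≤
      lsum h (fun x => ε * (η x ^ s * jb (z x) ^ (p + 1)) +
        ε ^ (-p) * (η x ^ s * |R x| ^ (p + 1))) := by
    refine lsum_mono hη.hpos.le fun x => ?_
    have p1 := Real.rpow_pos_of_pos (hη.pos x) s
    have := mul_le_mul_of_nonneg_left (young_rpow hp hε (jb_pos (z x)).le (abs_nonneg (R x))) p1.le
    nlinarith
  rw [lsum_add, lsum_const_mul, lsum_const_mul] at this
  refine this.trans ?_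
  rw [wmom]
  gcongr

lemma wmom_le_energy (hη : IsWt h Cη η) (hm : 0 < m) (ha₀ : 0 < a₀) (hk : 0 < k₀)
    (hu : ∀ x, m ≤ u x) (hu' : ∀ x, u x ≤ M) (ha : ∀ x, a₀ ≤ a x)
    (heq : ∀ x, a x * u x * z x = k₀ * (llap h u x - R x * u x))
    (hp : 3 / 2 ≤ p) (hpP : p ≤ P) (hs : 2 * (P + 1) + 1 ≤ s)
    (hCR : lsum h (fun x => η x ^ s * |R x| ^ (p + 1)) ≤ CR) {l : ℝ} (hl : 0 < l) :
    a₀ * m / k₀ / 2 * wmom h η s (p + 1) z ≤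
      prodC P s * (2 * l * wgrad h η s p z u + l⁻¹ * (wdir h η s (p - 2) z + wedge h η s p z)) +
        (a₀ * m / k₀ / (2 * (a₀ * m / k₀ + M))) ^ (-P) * (a₀ * m / k₀ * Cη + M * CR) := by
  have hh := hη.hpos
  have hM : 0 < M := hm.trans_le ((hu 0).trans (hu' 0))
  set c₁ := a₀ * m / k₀ with hc₁
  have hc : 0 < c₁ := by positivity
  set ε := c₁ / (2 * (c₁ + M)) with hε
  have hε0 : 0 < ε := by positivity
  have hε1 : ε ≤ 1 := by rw [hε, div_le_one (by positivity)]; linarith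
  have hεe : ε * (c₁ + M) = c₁ / 2 := by rw [hε]; field_simp
  have hCη : 0 ≤ Cη := (lsum_nonneg hh.le fun x => (hη.pos x).le).trans hη.sum_le
  have hCR0 : 0 ≤ CR := (lsum_nonneg hh.le fun x => by have := hη.pos x; positivity).trans hCR
  have hεp : ε ^ (-p) ≤ ε ^ (-P) := Real.rpow_le_rpow_of_exponent_ge hε0 hε1 (by linarith)
  set F : Grid n N → ℝ := fun y => η y ^ s * (jb (z y) ^ (p - 1) * z y) with hF
  have I1 := lsum_mul_llap hh.ne' F u
  have I2 : - esum h (fun i x => ldiff h i F x * ldiff h i u x) ≤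
      prodC P s * (2 * l * wgrad h η s p z u +
        l⁻¹ * (wdir h η s (p - 2) z + wedge h η s p z)) := by
    refine (neg_le_abs _).trans ((abs_esum_le hh.le _).trans ?_)
    have K0 : 0 < prodC P s := by
      have : (0 : ℝ) ≤ (1 + s) * 2 ^ s := mul_nonneg (by linarith) (by positivity)
      unfold prodC; linarith
    refine le_trans ?_ (mul_le_mul_of_nonneg_left (esum_cross_le hη hl z u) K0.le)
    rw [← esum_const_mul]
    refine esum_mono hh.le fun i x => ?_
    have := abs_ldiff_wt_signed_le hη (s := s) (q := p - 1) (by linarith) (by linarith) z i x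
    rw [abs_mul, ← mul_assoc]
    refine mul_le_mul_of_nonneg_right ?_ (abs_nonneg _)
    refine this.trans ?_
    rw [sub_add_cancel]
    have hx := hη.pos x
    have hmm := emax_pos z i x
    refine mul_le_mul_of_nonneg_right ?_ (by positivity)
    rw [abs_of_nonneg (by linarith)]
    unfold prodC
    linarith
  have I3 : c₁ * (wmom h η s (p + 1) z - wmom h η (s - 2) p z) ≤
      lsum h (fun x => F x * llap h u x) + M * lsum h (fun x => η x ^ s * jb (z x) ^ p * |R x|) := by
    rw [wmom, wmom, ← lsum_sub, ← lsum_const_mul, ← lsum_const_mul, ← lsum_add]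
    refine lsum_mono hh.le fun x => ?_
    have hx := hη.pos x
    have hg := jb_pos (z x)
    have hg1 := one_le_jb (z x)
    have hsq := jb_sq (z x)
    have hzg := abs_le_jb (z x)
    have hlap : llap h u x = a x * u x * z x / k₀ + R x * u x := by
      rw [heq x]; field_simp; ring
    have e1 : η x ^ s ≤ η x ^ (s - 2) :=
      Real.rpow_le_rpow_of_exponent_ge hx (hη.le_one x) (by linarith)
    have e4 : jb (z x) ^ (p + 1) = jb (z x) ^ (p - 1) * jb (z x) ^ 2 := by
      rw [← Real.rpow_natCast _ 2, ← Real.rpow_add hg]; congr 1; push_cast; ring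
    have e3 : jb (z x) ^ p = jb (z x) ^ (p - 1) * jb (z x) := by
      rw [← Real.rpow_add_one hg.ne']; ring_nf
    have pg : 0 < jb (z x) ^ (p - 1) := by positivity
    have pe : 0 < η x ^ s := by positivity
    simp only [hF]
    rw [hlap, e4, e3]
    set g := jb (z x)
    set G := g ^ (p - 1)
    set E := η x ^ s
    have key1 : c₁ * (E * G * z x ^ 2) ≤ E * G * z x ^ 2 * (a x * u x / k₀) := by
      have : c₁ ≤ a x * u x / k₀ := by
        rw [hc₁]
        gcongr
        · exact ha₀.le.trans (ha x)
        · exact ha x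
        · exact hu x
      nlinarith [mul_le_mul_of_nonneg_left this (show 0 ≤ E * G * z x ^ 2 by positivity)]
    have key2 : -(M * (E * G * g * |R x|)) ≤ E * G * z x * (R x * u x) := by
      have : |E * G * z x * (R x * u x)| ≤ M * (E * G * g * |R x|) := by
        rw [abs_mul, abs_mul (E * G), abs_mul (R x), abs_of_pos (mul_pos pe pg),
          abs_of_pos (hm.trans_le (hu x))]
        calc E * G * |z x| * (|R x| * u x) ≤ E * G * g * (|R x| * M) := by
              have := hu' x
              have := hm.trans_le (hu x)
              gcongr
          _ = _ := by ring
      exact (abs_le.1 this).1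
    have key3 : E * (G * g ^ 2) - η x ^ (s - 2) * (G * g) ≤ E * G * z x ^ 2 := by
      have : E * (G * 1) ≤ η x ^ (s - 2) * (G * g) := by gcongr
      rw [hsq]
      linarith
    have := mul_le_mul_of_nonneg_left key3 hc.le
    calc _ ≤ c₁ * (E * G * z x ^ 2) := this
      _ ≤ E * G * z x ^ 2 * (a x * u x / k₀) := key1
      _ ≤ E * G * z x ^ 2 * (a x * u x / k₀) + (E * G * z x * (R x * u x) +
          M * (E * G * g * |R x|)) := by linarith
      _ = _ := by ring
  have I4 := lsum_mul_young_le (z := z) hη (by linarith) hε0 hCR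
  have I5 := wmom_absorb hη (s := s) (b := 2) (by linarith) hε0 (by linarith) z (p := p)
  have I6 : M * lsum h (fun x => η x ^ s * jb (z x) ^ p * |R x|) ≤
      M * (ε * wmom h η s (p + 1) z + ε ^ (-P) * CR) := by
    refine mul_le_mul_of_nonneg_left (I4.trans ?_) hM.le
    gcongr
  have I7 : wmom h η (s - 2) p z ≤ ε * wmom h η s (p + 1) z + ε ^ (-P) * Cη := by
    refine I5.trans ?_
    gcongr
  have I8 := mul_le_mul_of_nonneg_left I7 hc.le
  have I9 : (ε * (c₁ + M)) * wmom h η s (p + 1) z = c₁ / 2 * wmom h η s (p + 1) z := by rw [hεe]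
  nlinarith

lemma wgrad_le_energy (hη : IsWt h Cη η) (hm : 0 < m) (ha₀ : 0 < a₀) (hk : 0 < k₀)
    (hu : ∀ x, m ≤ u x) (hu' : ∀ x, u x ≤ M) (ha : ∀ x, a₀ ≤ a x) (ha' : ∀ x, a x ≤ a₁)
    (heq : ∀ x, a x * u x * z x = k₀ * (llap h u x - R x * u x))
    (hp : 3 / 2 ≤ p) (hpP : p ≤ P) (hs : 2 * (P + 1) + 1 ≤ s)
    (hCR : lsum h (fun x => η x ^ s * |R x| ^ (p + 1)) ≤ CR) {l : ℝ} (hl : 0 < l) :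
    wgrad h η s p z u ≤ 2 ^ (s + 1) * (M * prodC P s * (2 * l * wgrad h η s p z u +
        l⁻¹ * (wdir h η s (p - 2) z + wedge h η s p z)) +
        M ^ 2 * ((a₁ / k₀ + 1) * wmom h η s (p + 1) z + CR)) := by
  have hh := hη.hpos
  have hM : 0 < M := hm.trans_le ((hu 0).trans (hu' 0))
  have K0 : 0 < prodC P s := by
    have : (0 : ℝ) ≤ (1 + s) * 2 ^ s := mul_nonneg (by linarith) (by positivity)
    unfold prodC; linarith
  set F : Grid n N → ℝ := fun y => η y ^ s * jb (z y) ^ p with hF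
  have I1 := esum_avg_mul_sq hh.ne' F u
  have I2 : -(1 / 2) * esum h (fun i x => ldiff h i F x * ldiff h i (fun y => u y ^ 2) x) ≤
      M * prodC P s * (2 * l * wgrad h η s p z u +
        l⁻¹ * (wdir h η s (p - 2) z + wedge h η s p z)) := by
    have J := abs_esum_le hh.le (fun i x => ldiff h i F x * ldiff h i (fun y => u y ^ 2) x)
    have J2 : esum h (fun i x => |ldiff h i F x * ldiff h i (fun y => u y ^ 2) x|) ≤
        2 * (M * prodC P s * (2 * l * wgrad h η s p z u +
        l⁻¹ * (wdir h η s (p - 2) z + wedge h η s p z))) := by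
      have MK : 0 < 2 * (M * prodC P s) := by positivity
      rw [← mul_assoc]
      refine le_trans ?_ (mul_le_mul_of_nonneg_left (esum_cross_le hη hl z u) MK.le)
      rw [← esum_const_mul]
      refine esum_mono hh.le fun i x => ?_
      have := abs_ldiff_wt_le hη (s := s) (q := p) (by linarith) (by linarith) z i x
      have hx := hη.pos x
      have hmm := emax_pos z i x
      have k1 : |ldiff h i F x| ≤ prodC P s * (η x ^ s * emax z i x ^ (p - 1) * |ldiff h i z x| +
          η x ^ (s - 1) * emax z i x ^ p) := by
        refine this.trans (mul_le_mul_of_nonneg_right ?_ (by positivity))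
        unfold prodC; linarith
      have k2 : |ldiff h i (fun y => u y ^ 2) x| ≤ 2 * M * |ldiff h i u x| := by
        have : ldiff h i (fun y => u y ^ 2) x = (u (x + stp i) + u x) * ldiff h i u x := by
          unfold ldiff; ring
        rw [this, abs_mul]
        refine mul_le_mul_of_nonneg_right ?_ (abs_nonneg _)
        rw [abs_le]
        have := hu x; have := hu' x; have := hu (x + stp i); have := hu' (x + stp i)
        constructor <;> linarith
      rw [abs_mul]
      calc _ ≤ _ := mul_le_mul k1 k2 (abs_nonneg _) ((abs_nonneg _).trans k1)
        _ = _ := by ring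
    have := (abs_le.1 (J.trans J2)).1
    linarith
  have I3 : - lsum h (fun x => F x * (u x * llap h u x)) ≤
      M ^ 2 * ((a₁ / k₀ + 1) * wmom h η s (p + 1) z + CR) := by
    have I4 := lsum_mul_young_le (z := z) hη (by linarith) one_pos hCR
    simp only [one_mul, Real.one_rpow] at I4
    have : - lsum h (fun x => F x * (u x * llap h u x)) ≤
        lsum h (fun x => M ^ 2 * (a₁ / k₀) * (η x ^ s * jb (z x) ^ (p + 1)) +
          M ^ 2 * (η x ^ s * jb (z x) ^ p * |R x|)) := by
      rw [← lsum_neg]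
      refine lsum_mono hh.le fun x => ?_
      have hx := hη.pos x
      have hg := jb_pos (z x)
      have hlap : llap h u x = a x * u x * z x / k₀ + R x * u x := by
        rw [heq x]; field_simp; ring
      have hux := hm.trans_le (hu x)
      have hu'x := hu' x
      have hax := ha₀.trans_le (ha x)
      have ha'x := ha' x
      have e4 : jb (z x) ^ (p + 1) = jb (z x) ^ p * jb (z x) := Real.rpow_add_one hg.ne' _
      have pg : 0 < jb (z x) ^ p := by positivity
      have pe : 0 < η x ^ s := by positivity
      refine (neg_le_abs _).trans ?_
      simp only [hF]
      rw [hlap, e4, abs_mul, abs_of_pos (mul_pos pe pg)]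
      have : |u x * (a x * u x * z x / k₀ + R x * u x)| ≤
          M ^ 2 * (a₁ / k₀) * jb (z x) + M ^ 2 * |R x| := by
        have e : u x * (a x * u x * z x / k₀ + R x * u x) =
          u x ^ 2 * (a x / k₀) * z x + u x ^ 2 * R x := by ring
        rw [e]
        refine (abs_add_le _ _).trans ?_
        rw [abs_mul (u x ^ 2 * (a x / k₀)),
          abs_of_nonneg (by positivity : 0 ≤ u x ^ 2 * (a x / k₀)), abs_mul (u x ^ 2),
          abs_of_nonneg (sq_nonneg (u x))]
        have := abs_le_jb (z x)
        have := hax.trans_le ha'x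
        gcongr
      calc _ ≤ _ := mul_le_mul_of_nonneg_left this (mul_pos pe pg).le
        _ = _ := by ring
    rw [lsum_add, lsum_const_mul, lsum_const_mul] at this
    rw [wmom] at I4 ⊢
    nlinarith [mul_le_mul_of_nonneg_left I4 (sq_nonneg M)]
  have I5 : wgrad h η s p z u ≤
      2 ^ (s + 1) * esum h (fun i x => (F x + F (x + stp i)) / 2 * ldiff h i u x ^ 2) := by
    rw [wgrad, ← esum_const_mul]
    refine esum_mono hh.le fun i x => ?_
    rw [← mul_assoc]
    refine mul_le_mul_of_nonneg_right ?_ (sq_nonneg _)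
    have hx := hη.pos x
    have hx' := hη.pos (x + stp i)
    have hg := jb_pos (z x)
    have hg' := jb_pos (z (x + stp i))
    have d := rpow_dbl (s := s) (hη.pos (x + stp i)) (hη.pos x) (hη.dbl' i x) (by linarith)
    have two : (1 : ℝ) ≤ 2 ^ s := Real.one_le_rpow (by norm_num) (by linarith)
    rw [Real.rpow_add_one two_ne_zero]
    simp only [hF, emax]
    have q1 : 0 < jb (z x) ^ p := by positivity
    have q2 : 0 < jb (z (x + stp i)) ^ p := by positivity
    have q3 : 0 < η x ^ s := by positivity
    have q4 : 0 < η (x + stp i) ^ s := by positivity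
    have r1 : 0 < η x ^ s * jb (z x) ^ p := by positivity
    have r2 : 0 < 2 ^ s * (η (x + stp i) ^ s * jb (z (x + stp i)) ^ p) := by positivity
    rcases max_choice (jb (z x)) (jb (z (x + stp i))) with h | h <;> rw [h]
    · nlinarith
    · nlinarith [mul_le_mul_of_nonneg_right d q2.le]
  have two : (0 : ℝ) < 2 ^ (s + 1) := by positivity
  refine I5.trans (mul_le_mul_of_nonneg_left ?_ two.le)
  rw [I1]
  linarith

end CubicBound

set_option maxHeartbeats 800000 in
/-- The cubic moment of `z` is controlled by its weighted Dirichlet energy, uniformly in the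
lattice. -/
lemma exists_wmom_le_wdir (n : ℕ) {m M a₀ a₁ k₀ P s Cη CR : ℝ} (hm : 0 < m) (hmM : m ≤ M)
    (ha₀ : 0 < a₀) (ha₁ : a₀ ≤ a₁) (hk : 0 < k₀) (hs : 2 * (P + 1) + 1 ≤ s) (hCη : 0 ≤ Cη)
    (hCR0 : 0 ≤ CR) (hP : 3 / 2 ≤ P) :
    ∃ C : ℝ, 0 ≤ C ∧ ∀ (N : ℕ) [NeZero N] (h : ℝ) (η u a z R : Grid n N → ℝ) (p : ℝ),
      IsWt h Cη η → (∀ x, m ≤ u x) → (∀ x, u x ≤ M) → (∀ x, a₀ ≤ a x) → (∀ x, a x ≤ a₁) →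
      (∀ x, a x * u x * z x = k₀ * (llap h u x - R x * u x)) → 3 / 2 ≤ p → p ≤ P →
      lsum h (fun x => η x ^ s * |R x| ^ (p + 1)) ≤ CR →
      wmom h η s (p + 1) z ≤ C * (wdir h η s (p - 2) z + 1) := by
  have hM : 0 < M := hm.trans_le hmM
  have hK : 0 < prodC P s := by
    have : (0 : ℝ) ≤ (1 + s) * 2 ^ s := mul_nonneg (by linarith) (by positivity)
    unfold prodC; linarith
  have hT : (0 : ℝ) < 2 ^ (s + 1) := by positivity
  have ha1 := ha₀.trans_le ha₁
  obtain ⟨c, hc, hcdef⟩ : ∃ c, 0 < c ∧ c = a₀ * m / k₀ := ⟨_, by positivity, rfl⟩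
  obtain ⟨l', hl', hl'def⟩ : ∃ l', 0 < l' ∧ 2 ^ (s + 1) * (M * prodC P s * (2 * l')) = 1 / 2 :=
    ⟨1 / (4 * (2 ^ (s + 1) * (M * prodC P s))), by positivity, by field_simp; norm_num⟩
  obtain ⟨b₁, hb₁, hb₁def⟩ : ∃ b, 0 < b ∧ b = 2 * (2 ^ (s + 1) * (M * prodC P s * l'⁻¹)) :=
    ⟨_, by positivity, rfl⟩
  obtain ⟨b₂, hb₂, hb₂def⟩ : ∃ b, 0 < b ∧ b = 2 * (2 ^ (s + 1) * (M ^ 2 * (a₁ / k₀ + 1))) :=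
    ⟨_, by positivity, rfl⟩
  obtain ⟨b₃, hb₃, hb₃def⟩ : ∃ b, 0 ≤ b ∧ b = 2 * (2 ^ (s + 1) * (M ^ 2 * CR)) :=
    ⟨_, by positivity, rfl⟩
  obtain ⟨l, hl, hldef⟩ : ∃ l, 0 < l ∧ prodC P s * (2 * l) * b₂ = c / 4 :=
    ⟨c / (8 * prodC P s * b₂), by positivity, by field_simp; norm_num⟩
  obtain ⟨e₁, he₁, he₁def⟩ : ∃ e, 0 < e ∧ e = prodC P s * (2 * l * b₁ + l⁻¹) :=
    ⟨_, by positivity, rfl⟩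
  obtain ⟨e₂, he₂, he₂def⟩ : ∃ e, 0 ≤ e ∧ e = prodC P s * (2 * l * b₃) +
      (c / (2 * (c + M))) ^ (-P) * (c * Cη + M * CR) := ⟨_, by positivity, rfl⟩
  have hQ : (0 : ℝ) < n * (1 + 2 ^ (s - 2)) + 1 := by positivity
  obtain ⟨ε, hε, hε1, hεdef⟩ : ∃ ε, 0 < ε ∧ ε ≤ 1 ∧
      e₁ * ((n * (1 + 2 ^ (s - 2)) + 1) * ε) ≤ c / 8 := by
    refine ⟨min 1 (c / (8 * e₁ * (n * (1 + 2 ^ (s - 2)) + 1))), by positivity, min_le_left _ _, ?_⟩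
    calc _ ≤ e₁ * ((n * (1 + 2 ^ (s - 2)) + 1) *
          (c / (8 * e₁ * (n * (1 + 2 ^ (s - 2)) + 1)))) := by
          gcongr; exact min_le_right _ _
      _ = c / 8 := by field_simp
  obtain ⟨e₃, he₃, he₃def⟩ : ∃ e, 0 ≤ e ∧ e = e₁ * ((n * (1 + 2 ^ (s - 2)) + 1) *
      (ε ^ (-P) * Cη)) + e₂ := ⟨_, by positivity, rfl⟩
  refine ⟨8 / c * (e₁ + e₃), by positivity, ?_⟩
  intro N _ h η u a z R p hη hu hu' ha ha' heq hp hpP hCR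
  have I1 := wmom_le_energy hη hm ha₀ hk hu hu' ha heq hp hpP hs hCR hl
  have I2 := wgrad_le_energy hη hm ha₀ hk hu hu' ha ha' heq hp hpP hs hCR hl'
  have I3 := wedge_le (s := s) (p := p) hη (by linarith) hε (by linarith) z
  have hA := wmom_nonneg hη s (p + 1) z
  have hD := wdir_nonneg hη s (p - 2) z
  have hE := wedge_nonneg hη s p z
  rw [← hcdef] at I1
  set A := wmom h η s (p + 1) z
  set D := wdir h η s (p - 2) z
  set B := wgrad h η s p z u
  set E := wedge h η s p z
  have J1 : B ≤ b₁ * (D + E) + b₂ * A + b₃ := by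
    have : 2 ^ (s + 1) * (M * prodC P s * (2 * l' * B + l'⁻¹ * (D + E)) +
        M ^ 2 * ((a₁ / k₀ + 1) * A + CR)) =
        2 ^ (s + 1) * (M * prodC P s * (2 * l')) * B + (b₁ * (D + E) + b₂ * A + b₃) / 2 := by
      rw [hb₁def, hb₂def, hb₃def]; ring
    rw [this, hl'def] at I2
    linarith
  have J2 : c / 4 * A ≤ e₁ * (D + E) + e₂ := by
    have k1 := mul_le_mul_of_nonneg_left J1 (show 0 ≤ prodC P s * (2 * l) by positivity)
    have k2 : prodC P s * (2 * l) * (b₁ * (D + E) + b₂ * A + b₃) =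
      prodC P s * (2 * l) * (b₁ * (D + E) + b₃) + prodC P s * (2 * l) * b₂ * A := by ring
    rw [k2, hldef] at k1
    rw [he₁def, he₂def]
    linarith
  have J3 : e₁ * E ≤ c / 8 * A + e₁ * ((n * (1 + 2 ^ (s - 2)) + 1) * (ε ^ (-P) * Cη)) := by
    have k1 : ε ^ (-p) ≤ ε ^ (-P) := Real.rpow_le_rpow_of_exponent_ge hε hε1 (by linarith)
    have k2 : E ≤ (n * (1 + 2 ^ (s - 2)) + 1) * (ε * A + ε ^ (-P) * Cη) := by
      refine I3.trans ?_
      gcongr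
      linarith
    have k3 := mul_le_mul_of_nonneg_left k2 he₁.le
    have k4 := mul_le_mul_of_nonneg_right hεdef hA
    linarith
  have J4 : c / 8 * A ≤ e₁ * D + e₃ := by rw [he₃def]; linarith
  have J5 : A = 8 / c * (c / 8 * A) := by field_simp
  rw [J5, mul_assoc]
  refine mul_le_mul_of_nonneg_left (J4.trans ?_) (by positivity)
  nlinarith [mul_nonneg he₃ hD, mul_nonneg he₁.le hD]

section Sobolev

open MeasureTheory in
/-- Discrete grid-lines inequality of Loomis–Whitney type. -/
lemma sum_prod_line_rpow_le {n N : ℕ} [NeZero N] (hn : 2 ≤ n) (f : Grid n N → ℝ)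
    (hf : ∀ x, 0 ≤ f x) :
    ∑ x, ∏ i, (∑ t, f (Function.update x i t)) ^ (1 / ((n : ℝ) - 1)) ≤
      (∑ x, f x) ^ ((n : ℝ) / ((n : ℝ) - 1)) := by
  let _ : MeasurableSpace (ZMod N) := ⊤
  have hn' : (2 : ℝ) ≤ n := by exact_mod_cast hn
  have hc : Real.HolderConjugate (Fintype.card (Fin n)) ((n : ℝ) / ((n : ℝ) - 1)) := by
    rw [Fintype.card_fin]
    exact Real.HolderConjugate.conjExponent (by linarith)
  have key := lintegral_prod_lintegral_pow_le (fun _ : Fin n => (Measure.count : Measure (ZMod N)))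
    hc (f := fun x => ENNReal.ofReal (f x)) (measurable_of_finite _)
  have conv (g : Grid n N → ENNReal) :
      ∫⁻ x, g x ∂Measure.pi (fun _ : Fin n => (Measure.count : Measure (ZMod N))) = ∑ x, g x := by
    rw [lintegral_fintype]
    simp [Measure.pi_singleton]
  rw [conv, conv] at key
  have e1 : ∑ x, ENNReal.ofReal (f x) = ENNReal.ofReal (∑ x, f x) :=
    (ENNReal.ofReal_sum_of_nonneg fun x _ => hf x).symm
  have hinner (x : Grid n N) (i : Fin n) :
      ∫⁻ t, ENNReal.ofReal (f (Function.update x i t)) ∂(Measure.count : Measure (ZMod N)) =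
        ENNReal.ofReal (∑ t, f (Function.update x i t)) := by
    rw [lintegral_fintype, ENNReal.ofReal_sum_of_nonneg fun t _ => hf _]
    simp
  have h0 : 0 ≤ (1 : ℝ) / ((n : ℝ) - 1) := by
    have : 0 < (n : ℝ) - 1 := by linarith
    positivity
  have hs (x : Grid n N) (i : Fin n) : 0 ≤ ∑ t, f (Function.update x i t) :=
    Finset.sum_nonneg fun t _ => hf _
  have e2 : ∑ x, ∏ i, (∫⁻ t, ENNReal.ofReal (f (Function.update x i t))
      ∂(Measure.count : Measure (ZMod N))) ^ ((1 : ℝ) / ((Fintype.card (Fin n) : ℝ) - 1)) =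
      ENNReal.ofReal (∑ x, ∏ i, (∑ t, f (Function.update x i t)) ^ (1 / ((n : ℝ) - 1))) := by
    rw [ENNReal.ofReal_sum_of_nonneg fun x _ => Finset.prod_nonneg fun i _ =>
      Real.rpow_nonneg (hs x i) _]
    refine Finset.sum_congr rfl fun x _ => ?_
    rw [ENNReal.ofReal_prod_of_nonneg fun i _ => Real.rpow_nonneg (hs x i) _]
    refine Finset.prod_congr rfl fun i _ => ?_
    rw [hinner, Fintype.card_fin, ENNReal.ofReal_rpow_of_nonneg (hs x i) h0]
  rw [e1] at key
  have hp : 0 ≤ (n : ℝ) / ((n : ℝ) - 1) := by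
    have : 0 < (n : ℝ) - 1 := by linarith
    positivity
  have hS : 0 ≤ ∑ x, f x := Finset.sum_nonneg fun x _ => hf x
  rw [ENNReal.ofReal_rpow_of_nonneg hS hp] at key
  have := e2.symm.trans_le key
  exact (ENNReal.ofReal_le_ofReal_iff (Real.rpow_nonneg hS _)).1 this

variable {n N : ℕ} [NeZero N] {h : ℝ}

lemma abs_sub_le_sum_cycle (F : ZMod N → ℝ) (s t : ZMod N) :
    |F t - F s| ≤ ∑ r, |F (r + 1) - F r| := by
  have step (k : ℕ) : |F (s + k) - F s| ≤
      ∑ j ∈ Finset.range k, |F (s + j + 1) - F (s + j)| := by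
    induction k with
    | zero => simp
    | succ k ih =>
      rw [Finset.sum_range_succ]
      have e : F (s + (k + 1 : ℕ)) - F s = (F (s + k) - F s) + (F (s + k + 1) - F (s + k)) := by
        push_cast; rw [← add_assoc]; ring
      rw [e]
      exact (abs_add_le _ _).trans (by linarith)
  have h1 := step (t - s).val
  rw [ZMod.natCast_zmod_val, add_sub_cancel] at h1
  refine h1.trans ?_
  have inj : Set.InjOn (fun j : ℕ => s + (j : ZMod N)) (Finset.range (t - s).val) := by
    intro a ha b hb hab
    simp only [Finset.coe_range, Set.mem_Iio] at ha hb
    have hN := ZMod.val_lt (t - s)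
    have : (a : ZMod N) = b := by simpa using hab
    have := congrArg ZMod.val this
    rwa [ZMod.val_natCast_of_lt (by omega), ZMod.val_natCast_of_lt (by omega)] at this
  rw [← Finset.sum_image (f := fun r => |F (r + 1) - F r|) inj]
  exact Finset.sum_le_sum_of_subset_of_nonneg (Finset.subset_univ _) fun _ _ _ => abs_nonneg _

lemma abs_le_line_sum (hh : 0 < h) (hN : 1 ≤ (N : ℝ) * h) (f : Grid n N → ℝ) (i : Fin n)
    (x : Grid n N) :
    |f x| ≤ h * ∑ t, (|f (Function.update x i t)| +
      |ldiff h i f (Function.update x i t)|) := by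
  set F : ZMod N → ℝ := fun t => f (Function.update x i t) with hF
  have hNpos : (0 : ℝ) < N := by
    have := Nat.pos_of_ne_zero (NeZero.ne N); exact_mod_cast this
  have hd (t : ZMod N) : |ldiff h i f (Function.update x i t)| = |F (t + 1) - F t| / h := by
    have : Function.update x i t + stp i = Function.update x i (t + 1) := by
      funext j
      by_cases hj : j = i
      · subst hj; simp [stp]
      · simp [stp, hj]
    rw [ldiff, this, abs_div, abs_of_pos hh]
  have h1 (s : ZMod N) : |F (x i)| ≤ |F s| + ∑ r, |F (r + 1) - F r| := by
    have := abs_sub_le_sum_cycle F s (x i)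
    have := abs_sub_abs_le_abs_sub (F (x i)) (F s)
    linarith
  have h2 : (N : ℝ) * |F (x i)| ≤ ∑ s, |F s| + N * ∑ r, |F (r + 1) - F r| := by
    have := Finset.sum_le_sum (s := Finset.univ) fun s _ => h1 s
    simpa [Finset.sum_add_distrib, ZMod.card] using this
  have e : F (x i) = f x := by simp [hF]
  simp only [hd]
  rw [Finset.sum_add_distrib, ← Finset.sum_div, mul_add, mul_div_cancel₀ _ hh.ne', ← e]
  have h3 : 0 ≤ ∑ s, |F s| := Finset.sum_nonneg fun _ _ => abs_nonneg _
  have h4 : |F (x i)| ≤ (∑ s, |F s|) / N + ∑ r, |F (r + 1) - F r| := by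
    rw [← sub_le_iff_le_add, le_div_iff₀ hNpos]; linarith
  have h5 : (∑ s, |F s|) / N ≤ h * ∑ s, |F s| := by
    rw [div_le_iff₀ hNpos]; nlinarith
  exact h4.trans (by linarith)

/-- Discrete Gagliardo–Nirenberg inequality at the `L¹` endpoint. -/
lemma lsum_rpow_le_lsum_ldiff (hn : 2 ≤ n) (hh : 0 < h) (hN : 1 ≤ (N : ℝ) * h)
    {Φ : Grid n N → ℝ} (hΦ : ∀ x, 0 ≤ Φ x) :
    lsum h (fun x => Φ x ^ ((n : ℝ) / ((n : ℝ) - 1))) ≤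
      lsum h (fun x => Φ x + ∑ i, |ldiff h i Φ x|) ^ ((n : ℝ) / ((n : ℝ) - 1)) := by
  have hn' : (2 : ℝ) ≤ n := by exact_mod_cast hn
  have hn1 : 0 < (n : ℝ) - 1 := by linarith
  set G : Grid n N → ℝ := fun x => Φ x + ∑ i, |ldiff h i Φ x| with hG
  have hG0 (x) : 0 ≤ G x := add_nonneg (hΦ x) (Finset.sum_nonneg fun _ _ => abs_nonneg _)
  have h1 (x : Grid n N) (i : Fin n) : Φ x ≤ h * ∑ t, G (Function.update x i t) := by
    refine (le_abs_self _).trans ((abs_le_line_sum hh hN Φ i x).trans ?_)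
    refine mul_le_mul_of_nonneg_left (Finset.sum_le_sum fun t _ => ?_) hh.le
    rw [abs_of_nonneg (hΦ _), hG]
    have := Finset.single_le_sum (f := fun j => |ldiff h j Φ (Function.update x i t)|)
      (fun j _ => abs_nonneg _) (Finset.mem_univ i)
    simp only at this ⊢
    linarith
  have hGs (x : Grid n N) (i : Fin n) : 0 ≤ ∑ t, G (Function.update x i t) :=
    Finset.sum_nonneg fun _ _ => hG0 _
  have h2 (x : Grid n N) : Φ x ^ ((n : ℝ) / ((n : ℝ) - 1)) ≤
      h ^ ((n : ℝ) / ((n : ℝ) - 1)) *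
        ∏ i, (∑ t, G (Function.update x i t)) ^ (1 / ((n : ℝ) - 1)) := by
    have e (y : ℝ) (hy : 0 ≤ y) :
        y ^ ((n : ℝ) / ((n : ℝ) - 1)) = ∏ _i : Fin n, y ^ (1 / ((n : ℝ) - 1)) := by
      rw [Finset.prod_const, Finset.card_univ, Fintype.card_fin, ← Real.rpow_mul_natCast hy]
      congr 1; field_simp
    rw [e _ (hΦ x), e _ hh.le, ← Finset.prod_mul_distrib]
    refine Finset.prod_le_prod (fun i _ => Real.rpow_nonneg (hΦ x) _) fun i _ => ?_
    rw [← Real.mul_rpow hh.le (hGs x i)]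
    exact Real.rpow_le_rpow (hΦ x) (h1 x i) (by positivity)
  have h3 : lsum h (fun x => Φ x ^ ((n : ℝ) / ((n : ℝ) - 1))) ≤
      h ^ n * (h ^ ((n : ℝ) / ((n : ℝ) - 1)) * (∑ x, G x) ^ ((n : ℝ) / ((n : ℝ) - 1))) := by
    refine mul_le_mul_of_nonneg_left ?_ (by positivity)
    refine (Finset.sum_le_sum fun x _ => h2 x).trans ?_
    rw [← Finset.mul_sum]
    exact mul_le_mul_of_nonneg_left (sum_prod_line_rpow_le hn G hG0) (by positivity)
  refine h3.trans (le_of_eq ?_)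
  rw [lsum, Real.mul_rpow (by positivity) (Finset.sum_nonneg fun _ _ => hG0 _), ← mul_assoc]
  congr 1
  rw [← Real.rpow_natCast h n, ← Real.rpow_add hh, ← Real.rpow_mul hh.le]
  congr 1
  field_simp
  ring

lemma lsum_mul_le_sqrt (hh : 0 ≤ h) (f g : Grid n N → ℝ) :
    lsum h (fun x => f x * g x) ≤
      √(lsum h fun x => f x ^ 2) * √(lsum h fun x => g x ^ 2) := by
  unfold lsum
  rw [Real.sqrt_mul (by positivity), Real.sqrt_mul (by positivity)]
  have := Real.sum_mul_le_sqrt_mul_sqrt Finset.univ f g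
  have h2 := Real.mul_self_sqrt (show 0 ≤ h ^ n by positivity)
  calc _ ≤ h ^ n * (√(∑ x, f x ^ 2) * √(∑ x, g x ^ 2)) := by gcongr
    _ = (√(h ^ n) * √(h ^ n)) * (√(∑ x, f x ^ 2) * √(∑ x, g x ^ 2)) := by rw [h2]
    _ = _ := by ring

end Sobolev

section WeightedSobolev

variable {n N : ℕ} [NeZero N] {h Cη : ℝ} {η : Grid n N → ℝ}

lemma lsum_rpow_max_le (hη : IsWt h Cη η) {f : Grid n N → ℝ} (hf : ∀ x, 0 < f x) (r : ℝ)
    (i : Fin n) :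
    lsum h (fun x => max (f x) (f (x + stp i)) ^ r) ≤ 2 * lsum h (fun x => f x ^ r) := by
  have : lsum h (fun x => max (f x) (f (x + stp i)) ^ r) ≤
      lsum h (fun x => f x ^ r + f (x + stp i) ^ r) := by
    refine lsum_mono hη.hpos.le fun x => ?_
    have p2 := Real.rpow_pos_of_pos (hf x) r
    have p3 := Real.rpow_pos_of_pos (hf (x + stp i)) r
    rcases max_choice (f x) (f (x + stp i)) with h | h <;> rw [h] <;> linarith
  rw [lsum_add, lsum_add_right (stp i) (fun x => f x ^ r)] at this
  linarith

/-- The Sobolev energy of a lattice function at level `p`. -/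
noncomputable def sobE (h : ℝ) (η : Grid n N → ℝ) (s p : ℝ) (W : Grid n N → ℝ) : ℝ :=
  wdir h η s (p - 2) W + wmom h η (s - 2) p W

lemma sobE_nonneg (hη : IsWt h Cη η) (s p : ℝ) (W : Grid n N → ℝ) : 0 ≤ sobE h η s p W :=
  add_nonneg (wdir_nonneg hη _ _ _) (wmom_nonneg hη _ _ _)

lemma wmom_le_sobE (hη : IsWt h Cη η) (s p : ℝ) (W : Grid n N → ℝ) :
    wmom h η s p W ≤ sobE h η s p W := by
  have h1 : wmom h η s p W ≤ wmom h η (s - 2) p W := by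
    refine lsum_mono hη.hpos.le fun x => ?_
    have := jb_pos (W x)
    have := Real.rpow_le_rpow_of_exponent_ge (hη.pos x) (hη.le_one x)
      (show s - 2 ≤ s by linarith)
    gcongr
  have := wdir_nonneg hη s (p - 2) W
  unfold sobE
  linarith

lemma lsum_ldiff_sq_le (hη : IsWt h Cη η) {s p : ℝ} (hs : 2 ≤ s) (hp : 0 ≤ p)
    (W : Grid n N → ℝ) (i : Fin n) :
    lsum h (fun x => ldiff h i (fun y => η y ^ (s / 2) * jb (W y) ^ (p / 2)) x ^ 2) ≤
      (1 + p + (1 + s) * 2 ^ s) ^ 2 * (2 * (1 + n * (1 + 2 ^ (s - 2)))) * sobE h η s p W := by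
  have hh := hη.hpos
  set K := 1 + p + (1 + s) * 2 ^ s with hK
  have hK0 : 0 < K := by have : (0 : ℝ) < (1 + s) * 2 ^ s := by positivity
                         linarith
  have h1 : lsum h (fun x => ldiff h i (fun y => η y ^ (s / 2) * jb (W y) ^ (p / 2)) x ^ 2) ≤
      lsum h (fun x => K ^ 2 * (2 * (η x ^ s * emax W i x ^ (p - 2) * ldiff h i W x ^ 2 +
        η x ^ (s - 2) * emax W i x ^ p))) := by
    refine lsum_mono hh.le fun x => ?_
    have k1 := abs_ldiff_wt_le hη (s := s / 2) (q := p / 2) (by linarith) (by linarith) W i x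
    have he := hη.pos x
    have hm := emax_pos W i x
    set e := η x
    set m := emax W i x
    have k2 : 1 + p / 2 + (1 + s / 2) * 2 ^ (s / 2) ≤ K := by
      have : (2 : ℝ) ^ (s / 2) ≤ 2 ^ s := Real.rpow_le_rpow_of_exponent_le (by norm_num) (by linarith)
      have : (1 + s / 2) * 2 ^ (s / 2) ≤ (1 + s) * 2 ^ s := by gcongr; linarith
      linarith
    have k3 : |ldiff h i (fun y => η y ^ (s / 2) * jb (W y) ^ (p / 2)) x| ≤
        K * (e ^ (s / 2) * m ^ (p / 2 - 1) * |ldiff h i W x| + e ^ (s / 2 - 1) * m ^ (p / 2)) :=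
      k1.trans (mul_le_mul_of_nonneg_right k2 (by positivity))
    rw [← sq_abs]
    have sqr (a r : ℝ) (ha : 0 < a) : (a ^ r) ^ 2 = a ^ (2 * r) := by
      rw [← Real.rpow_mul_natCast ha.le]; congr 1; push_cast; ring
    calc _ ≤ (K * (e ^ (s / 2) * m ^ (p / 2 - 1) * |ldiff h i W x| +
          e ^ (s / 2 - 1) * m ^ (p / 2))) ^ 2 := by gcongr
      _ ≤ K ^ 2 * (2 * ((e ^ (s / 2) * m ^ (p / 2 - 1) * |ldiff h i W x|) ^ 2 +
          (e ^ (s / 2 - 1) * m ^ (p / 2)) ^ 2)) := by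
        rw [mul_pow]
        refine mul_le_mul_of_nonneg_left ?_ (by positivity)
        exact add_sq_le
      _ = _ := by
        simp only [mul_pow, sq_abs]
        rw [sqr e _ he, sqr e _ he, sqr m _ hm, sqr m _ hm]
        ring_nf
  refine h1.trans ?_
  rw [lsum_const_mul, lsum_const_mul, lsum_add]
  have h2 : lsum h (fun x => η x ^ s * emax W i x ^ (p - 2) * ldiff h i W x ^ 2) ≤
      wdir h η s (p - 2) W := by
    unfold wdir esum
    refine Finset.single_le_sum (f := fun i => lsum h (fun x => η x ^ s * emax W i x ^ (p - 2) *
      ldiff h i W x ^ 2)) (fun j _ => lsum_nonneg hh.le fun x => ?_) (Finset.mem_univ i)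
    have := hη.pos x; have := emax_pos W j x; positivity
  have h3 : lsum h (fun x => η x ^ (s - 2) * emax W i x ^ p) ≤
      n * (1 + 2 ^ (s - 2)) * wmom h η (s - 2) p W := by
    refine le_trans ?_ (esum_emax_le hη (by linarith) W)
    unfold esum
    refine Finset.single_le_sum (f := fun i => lsum h (fun x => η x ^ (s - 2) * emax W i x ^ p))
      (fun j _ => lsum_nonneg hh.le fun x => ?_) (Finset.mem_univ i)
    have := hη.pos x; have := emax_pos W j x; positivity
  have hD := wdir_nonneg hη s (p - 2) W
  have hM := wmom_nonneg hη (s - 2) p W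
  have hq : (0 : ℝ) ≤ n * (1 + 2 ^ (s - 2)) := by positivity
  rw [mul_assoc]
  refine mul_le_mul_of_nonneg_left ?_ (by positivity)
  unfold sobE
  nlinarith [mul_nonneg hq hD]

/-- Weighted discrete Sobolev inequality. -/
lemma exists_sobolev {n : ℕ} (hn : 3 ≤ n) {s p Cη : ℝ} (hs : 2 ≤ s) (hp : 0 ≤ p) :
    ∃ C : ℝ, 0 < C ∧ ∀ (N : ℕ) [NeZero N] (h : ℝ) (η W : Grid n N → ℝ), IsWt h Cη η →
      lsum h (fun x => (η x ^ s * jb (W x) ^ p) ^ ((n : ℝ) / ((n : ℝ) - 2))) ≤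
        (C * sobE h η s p W) ^ ((n : ℝ) / ((n : ℝ) - 2)) := by
  have hn' : (3 : ℝ) ≤ n := by exact_mod_cast hn
  have hn2 : 0 < (n : ℝ) - 2 := by linarith
  have hn1 : 0 < (n : ℝ) - 1 := by linarith
  set γ : ℝ := 2 * ((n : ℝ) - 1) / ((n : ℝ) - 2) with hγ
  have hγ0 : 0 < γ := by positivity
  set K : ℝ := (1 + p + (1 + s) * 2 ^ s) ^ 2 * (2 * (1 + n * (1 + 2 ^ (s - 2)))) with hK
  have hK0 : 0 ≤ K := by have : (0 : ℝ) < 2 ^ (s - 2) := by positivity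
                         positivity
  set L : ℝ := 1 + n * ((1 + γ) * (√2 * √K)) with hL
  have hL0 : 0 < L := by positivity
  refine ⟨L ^ 2, by positivity, ?_⟩
  intro N _ h η W hη
  have hh := hη.hpos
  set X := sobE h η s p W with hX
  have hX0 : 0 ≤ X := sobE_nonneg hη s p W
  set f : Grid n N → ℝ := fun y => η y ^ (s / 2) * jb (W y) ^ (p / 2) with hf
  have hfpos (x) : 0 < f x := by
    have := hη.pos x; have := jb_pos (W x); simp only [hf]; positivity
  set r : ℝ := 2 * ((n : ℝ) / ((n : ℝ) - 2)) with hr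
  have hf2 (x) : f x ^ 2 = η x ^ s * jb (W x) ^ p := by
    have h1 := hη.pos x; have h2 := jb_pos (W x)
    simp only [hf, mul_pow]
    rw [← Real.rpow_mul_natCast h1.le, ← Real.rpow_mul_natCast h2.le]
    congr 2 <;> push_cast <;> ring
  set Q := lsum h (fun x => f x ^ r) with hQ
  have hQ0 : 0 ≤ Q := lsum_nonneg hh.le fun x => (Real.rpow_pos_of_pos (hfpos x) _).le
  have eQ : lsum h (fun x => (η x ^ s * jb (W x) ^ p) ^ ((n : ℝ) / ((n : ℝ) - 2))) = Q := by
    rw [hQ]; congr 1; funext x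
    rw [← hf2, ← Real.rpow_natCast_mul (hfpos x).le]
    norm_num [hr]
  rw [eQ]
  have hsq (a : ℝ) (ha : 0 < a) : (a ^ (γ - 1)) ^ 2 = a ^ r := by
    rw [← Real.rpow_mul_natCast ha.le]; congr 1; rw [hγ, hr]; push_cast; field_simp; ring
  have hS2 : lsum h (fun x => f x ^ 2) ≤ X := by
    simp only [hf2]; exact wmom_le_sobE hη s p W
  have hG : lsum h (fun x => f x ^ γ + ∑ i, |ldiff h i (fun y => f y ^ γ) x|) ≤
      L * (√Q * √X) := by
    have a1 : lsum h (fun x => f x ^ γ) ≤ √Q * √X := by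
      have e : (fun x => f x ^ γ) = fun x => f x ^ (γ - 1) * f x := by
        funext x; rw [← Real.rpow_add_one (hfpos x).ne']; congr 1; ring
      rw [e]
      refine (lsum_mul_le_sqrt hh.le _ _).trans ?_
      simp only [fun x => hsq _ (hfpos x)]
      gcongr
    have a2 (i : Fin n) : lsum h (fun x => |ldiff h i (fun y => f y ^ γ) x|) ≤
        (1 + γ) * (√2 * √K) * (√Q * √X) := by
      have b1 : lsum h (fun x => |ldiff h i (fun y => f y ^ γ) x|) ≤
          lsum h (fun x => (1 + γ) * (max (f x) (f (x + stp i)) ^ (γ - 1) * |ldiff h i f x|)) := by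
        refine lsum_mono hh.le fun x => ?_
        have := abs_rpow_sub_rpow_le (hfpos x) (hfpos (x + stp i)) hγ0.le
        unfold ldiff
        rw [abs_div, abs_div, abs_of_pos hh, div_le_iff₀ hh]
        refine this.trans (le_of_eq ?_)
        field_simp
      refine b1.trans ?_
      rw [lsum_const_mul, mul_assoc]
      refine mul_le_mul_of_nonneg_left ?_ (by positivity)
      refine (lsum_mul_le_sqrt hh.le _ _).trans ?_
      simp only [fun x => hsq _ (lt_max_of_lt_left (c := f (x + stp i)) (hfpos x)), sq_abs]
      have b2 := lsum_rpow_max_le hη hfpos r i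
      have b3 := lsum_ldiff_sq_le hη hs hp W i
      calc _ ≤ √(2 * Q) * √(K * X) := by
            gcongr
        _ = _ := by
            rw [Real.sqrt_mul (by norm_num), Real.sqrt_mul hK0]; ring
    rw [lsum_add, lsum_sum]
    have a3 := Finset.sum_le_sum (s := Finset.univ) fun i _ => a2 i
    rw [Finset.sum_const, Finset.card_univ, Fintype.card_fin, nsmul_eq_mul] at a3
    rw [hL]
    linarith
  have key := lsum_rpow_le_lsum_ldiff (by omega) hh hη.len (Φ := fun x => f x ^ γ)
    fun x => (Real.rpow_pos_of_pos (hfpos x) _).le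
  have e1 : lsum h (fun x => (f x ^ γ) ^ ((n : ℝ) / ((n : ℝ) - 1))) = Q := by
    rw [hQ]; congr 1; funext x
    rw [← Real.rpow_mul (hfpos x).le]; congr 1; rw [hγ, hr]; field_simp
  rw [e1] at key
  have hG0 : 0 ≤ lsum h (fun x => f x ^ γ + ∑ i, |ldiff h i (fun y => f y ^ γ) x|) :=
    lsum_nonneg hh.le fun x => add_nonneg (Real.rpow_pos_of_pos (hfpos x) _).le
      (Finset.sum_nonneg fun _ _ => abs_nonneg _)
  have key2 : Q ≤ (L * (√Q * √X)) ^ ((n : ℝ) / ((n : ℝ) - 1)) :=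
    key.trans (Real.rpow_le_rpow hG0 hG (by positivity))
  rcases hQ0.eq_or_lt with h0 | hQp
  · rw [← h0]; positivity
  have hLX : 0 ≤ L * √X := by positivity
  have e2 : (L * (√Q * √X)) ^ ((n : ℝ) / ((n : ℝ) - 1)) =
      (L * √X) ^ ((n : ℝ) / ((n : ℝ) - 1)) * Q ^ ((n : ℝ) / ((n : ℝ) - 1) / 2) := by
    rw [show L * (√Q * √X) = (L * √X) * √Q by ring, Real.mul_rpow hLX (by positivity)]
    congr 1
    rw [Real.sqrt_eq_rpow, ← Real.rpow_mul hQ0]; congr 1; ring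
  rw [e2] at key2
  have key3 : Q ^ (1 - (n : ℝ) / ((n : ℝ) - 1) / 2) ≤ (L * √X) ^ ((n : ℝ) / ((n : ℝ) - 1)) := by
    rw [Real.rpow_sub hQp, Real.rpow_one, div_le_iff₀ (by positivity)]; exact key2
  have key4 := Real.rpow_le_rpow (by positivity) key3 (show 0 ≤ γ by positivity)
  rw [← Real.rpow_mul hQ0, ← Real.rpow_mul hLX] at key4
  have e3 : (1 - (n : ℝ) / ((n : ℝ) - 1) / 2) * γ = 1 := by rw [hγ]; field_simp; ring
  have e4 : (n : ℝ) / ((n : ℝ) - 1) * γ = (2 : ℕ) * ((n : ℝ) / ((n : ℝ) - 2)) := by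
    rw [hγ]; push_cast; field_simp
  rw [e3, Real.rpow_one, e4, Real.rpow_natCast_mul hLX, mul_pow, Real.sq_sqrt hX0] at key4
  exact key4

end WeightedSobolev

section Interpolation

/-- Three-fold Hölder inequality with positive upper bounds on the integrals. -/
lemma lsum_rpow_mul_le {n N : ℕ} [NeZero N] {h θ β γ A B C : ℝ} {f g k : Grid n N → ℝ}
    (hh : 0 ≤ h) (hθ : 0 ≤ θ) (hβ : 0 ≤ β) (hγ : 0 ≤ γ) (hsum : θ + β + γ = 1)
    (hf : ∀ x, 0 ≤ f x) (hg : ∀ x, 0 ≤ g x) (hk : ∀ x, 0 ≤ k x)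
    (hA : 0 < A) (hB : 0 < B) (hC : 0 < C)
    (hfA : lsum h f ≤ A) (hgB : lsum h g ≤ B) (hkC : lsum h k ≤ C) :
    lsum h (fun x => f x ^ θ * g x ^ β * k x ^ γ) ≤ A ^ θ * B ^ β * C ^ γ := by
  have h1 : lsum h (fun x => f x ^ θ * g x ^ β * k x ^ γ) ≤
      lsum h (fun x => (A ^ θ * B ^ β * C ^ γ) *
        (θ / A * f x + (β / B * g x + γ / C * k x))) := by
    refine lsum_mono hh fun x => ?_
    have hA' := Real.rpow_pos_of_pos hA θ
    have hB' := Real.rpow_pos_of_pos hB β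
    have hC' := Real.rpow_pos_of_pos hC γ
    have := Real.geom_mean_le_arith_mean3_weighted hθ hβ hγ (div_nonneg (hf x) hA.le)
      (div_nonneg (hg x) hB.le) (div_nonneg (hk x) hC.le) hsum
    rw [Real.div_rpow (hf x) hA.le, Real.div_rpow (hg x) hB.le, Real.div_rpow (hk x) hC.le] at this
    calc _ = (A ^ θ * B ^ β * C ^ γ) *
          (f x ^ θ / A ^ θ * (g x ^ β / B ^ β) * (k x ^ γ / C ^ γ)) := by field_simp
      _ ≤ _ := by
        refine mul_le_mul_of_nonneg_left (this.trans (le_of_eq ?_)) (by positivity)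
        ring
  refine h1.trans ?_
  rw [lsum_const_mul, lsum_add, lsum_add, lsum_const_mul, lsum_const_mul, lsum_const_mul]
  have k1 : θ / A * lsum h f ≤ θ := by
    calc _ ≤ θ / A * A := by gcongr
      _ = θ := by field_simp
  have k2 : β / B * lsum h g ≤ β := by
    calc _ ≤ β / B * B := by gcongr
      _ = β := by field_simp
  have k3 : γ / C * lsum h k ≤ γ := by
    calc _ ≤ γ / C * C := by gcongr
      _ = γ := by field_simp
  have : 0 ≤ A ^ θ * B ^ β * C ^ γ := by positivity
  nlinarith

lemma mul_rpow_one_sub_le {K μ ε y : ℝ} (hK : 0 ≤ K) (hμ : 0 < μ) (hμ1 : μ ≤ 1) (hε : 0 < ε)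
    (hy : 0 < y) :
    K * y ^ (1 - μ) ≤ ε * y + K * ((K / ε) ^ μ⁻¹) ^ (1 - μ) := by
  have hKε : 0 ≤ K / ε := by positivity
  rcases le_total y ((K / ε) ^ μ⁻¹) with h | h
  · have : y ^ (1 - μ) ≤ ((K / ε) ^ μ⁻¹) ^ (1 - μ) := Real.rpow_le_rpow hy.le h (by linarith)
    have := mul_le_mul_of_nonneg_left this hK
    have := mul_pos hε hy
    linarith
  · have h1 := Real.rpow_le_rpow (by positivity) h hμ.le
    rw [← Real.rpow_mul hKε, inv_mul_cancel₀ hμ.ne', Real.rpow_one, div_le_iff₀ hε] at h1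
    have e : y ^ μ * y ^ (1 - μ) = y := by
      rw [← Real.rpow_add hy]; simp
    have p1 := Real.rpow_pos_of_pos hy (1 - μ)
    have : K * y ^ (1 - μ) ≤ ε * y := by
      calc _ ≤ (y ^ μ * ε) * y ^ (1 - μ) := by gcongr
        _ = ε * (y ^ μ * y ^ (1 - μ)) := by ring
        _ = _ := by rw [e]
    have : 0 ≤ K * ((K / ε) ^ μ⁻¹) ^ (1 - μ) := by positivity
    linarith

/-- Interpolation between the energy and a lower moment, with explicit constants. -/
lemma exists_interp_const {n : ℕ} (hn : 3 ≤ n) {s p Cη μ β γ b σ p₀ s₀ sF BF : ℝ} (hs : 2 ≤ s)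
    (hp : 0 ≤ p) (hμ1 : μ ≤ 1) (hβ : 0 ≤ β) (hγ : 0 < γ)
    (hsum : (1 - μ) * (((n : ℝ) - 2) / n) + β + γ = 1) (hσ : p₀ * β = σ + p * μ)
    (hexp : s * (1 - μ) + s₀ * β + sF * γ ≤ s - b) :
    ∃ C₁ : ℝ, 0 < C₁ ∧ ∀ (N : ℕ) [NeZero N] (h : ℝ) (η W F : Grid n N → ℝ) (B₀ : ℝ),
      IsWt h Cη η → (∀ x, 0 ≤ F x) → 0 < B₀ → wmom h η s₀ p₀ W ≤ B₀ →
      lsum h (fun x => η x ^ sF * F x ^ γ⁻¹) ≤ BF →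
      lsum h (fun x => η x ^ (s - b) * F x * jb (W x) ^ (p + σ)) ≤
        B₀ ^ β * (|BF| + 1) ^ γ * (C₁ * sobE h η s p W + 1) ^ (1 - μ) := by
  have hn' : (3 : ℝ) ≤ n := by exact_mod_cast hn
  have hn2 : 0 < (n : ℝ) - 2 := by linarith
  obtain ⟨C₁, hC₁, hsob⟩ := exists_sobolev hn (Cη := Cη) hs hp
  refine ⟨C₁, hC₁, ?_⟩
  intro N _ h η W F B₀ hη hF hB0 hB₀ hBF
  have hh := hη.hpos
  have hX := sobE_nonneg hη s p W
  have hQ := hsob N h η W hη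
  set X := sobE h η s p W
  have hκ : 0 ≤ (n : ℝ) / ((n : ℝ) - 2) := by positivity
  have hA : lsum h (fun x => (η x ^ s * jb (W x) ^ p) ^ ((n : ℝ) / ((n : ℝ) - 2))) ≤
      (C₁ * X + 1) ^ ((n : ℝ) / ((n : ℝ) - 2)) :=
    hQ.trans (Real.rpow_le_rpow (by positivity) (by linarith) hκ)
  have hpos : 0 < C₁ * X + 1 := by positivity
  have H := lsum_rpow_mul_le (θ := (1 - μ) * (((n : ℝ) - 2) / n)) (β := β) (γ := γ)
    (B := B₀) (C := |BF| + 1) hh.le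
    (mul_nonneg (by linarith) (by positivity)) hβ hγ.le hsum
    (fun x => Real.rpow_nonneg (mul_nonneg (Real.rpow_nonneg (hη.pos x).le _)
      (Real.rpow_nonneg (jb_pos (W x)).le _)) _)
    (fun x => mul_nonneg (Real.rpow_nonneg (hη.pos x).le _) (Real.rpow_nonneg (jb_pos (W x)).le _))
    (fun x => mul_nonneg (Real.rpow_nonneg (hη.pos x).le _) (Real.rpow_nonneg (hF x) _))
    (Real.rpow_pos_of_pos hpos _) hB0 (by positivity) hA hB₀
    (hBF.trans ((le_abs_self _).trans (by linarith)))
  have e1 : ((C₁ * X + 1) ^ ((n : ℝ) / ((n : ℝ) - 2))) ^ ((1 - μ) * (((n : ℝ) - 2) / n)) =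
      (C₁ * X + 1) ^ (1 - μ) := by
    rw [← Real.rpow_mul hpos.le]; congr 1; field_simp
  rw [e1] at H
  refine le_trans (lsum_mono hh.le fun x => ?_) (H.trans ?_)
  · have he := hη.pos x
    have hg := jb_pos (W x)
    have hFx := hF x
    have e2 : (F x ^ γ⁻¹) ^ γ = F x := by
      rw [← Real.rpow_mul hFx, inv_mul_cancel₀ hγ.ne', Real.rpow_one]
    rw [← Real.rpow_mul (by positivity), Real.mul_rpow (by positivity) (by positivity),
      Real.mul_rpow (by positivity) (by positivity), Real.mul_rpow (by positivity) (by positivity),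
      e2, ← Real.rpow_mul he.le, ← Real.rpow_mul hg.le, ← Real.rpow_mul he.le,
      ← Real.rpow_mul hg.le, ← Real.rpow_mul he.le]
    have e3 : (n : ℝ) / ((n : ℝ) - 2) * ((1 - μ) * (((n : ℝ) - 2) / n)) = 1 - μ := by field_simp
    have e4 : η x ^ (s - b) ≤ η x ^ (s * (1 - μ)) * η x ^ (s₀ * β) * η x ^ (sF * γ) := by
      rw [← Real.rpow_add he, ← Real.rpow_add he]
      exact Real.rpow_le_rpow_of_exponent_ge he (hη.le_one x) hexp
    have e5 : jb (W x) ^ (p + σ) = jb (W x) ^ (p * (1 - μ)) * jb (W x) ^ (p₀ * β) := by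
      rw [← Real.rpow_add hg, hσ]; congr 1; ring
    rw [e3, e5]
    calc _ ≤ (η x ^ (s * (1 - μ)) * η x ^ (s₀ * β) * η x ^ (sF * γ)) * F x *
          (jb (W x) ^ (p * (1 - μ)) * jb (W x) ^ (p₀ * β)) := by gcongr
      _ = _ := by ring
  · exact le_of_eq (by ring)

/-- Interpolation between the Sobolev energy and a lower moment, with an integrable coefficient. -/
lemma exists_interp {n : ℕ} (hn : 3 ≤ n) {s p Cη μ β γ b σ p₀ s₀ sF B₀ BF ε : ℝ} (hs : 2 ≤ s)
    (hp : 0 ≤ p) (hμ : 0 < μ) (hμ1 : μ ≤ 1) (hβ : 0 ≤ β) (hγ : 0 < γ)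
    (hsum : (1 - μ) * (((n : ℝ) - 2) / n) + β + γ = 1) (hσ : p₀ * β = σ + p * μ)
    (hexp : s * (1 - μ) + s₀ * β + sF * γ ≤ s - b) (hε : 0 < ε) :
    ∃ C : ℝ, 0 ≤ C ∧ ∀ (N : ℕ) [NeZero N] (h : ℝ) (η W F : Grid n N → ℝ), IsWt h Cη η →
      (∀ x, 0 ≤ F x) → wmom h η s₀ p₀ W ≤ B₀ →
      lsum h (fun x => η x ^ sF * F x ^ γ⁻¹) ≤ BF →
      lsum h (fun x => η x ^ (s - b) * F x * jb (W x) ^ (p + σ)) ≤ ε * sobE h η s p W + C := by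
  obtain ⟨C₁, hC₁, H⟩ := exists_interp_const (Cη := Cη) (BF := BF) hn hs hp hμ1 hβ hγ hsum hσ hexp
  set K : ℝ := (|B₀| + 1) ^ β * (|BF| + 1) ^ γ with hK
  have hK0 : 0 ≤ K := by positivity
  refine ⟨ε / C₁ + K * ((K / (ε / C₁)) ^ μ⁻¹) ^ (1 - μ), by positivity, ?_⟩
  intro N _ h η W F hη hF hB₀ hBF
  refine (H N h η W F (|B₀| + 1) hη hF (by positivity) (by linarith [le_abs_self B₀]) hBF).trans ?_
  have hX := sobE_nonneg hη s p W
  have hpos : 0 < C₁ * sobE h η s p W + 1 := by positivity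
  have := mul_rpow_one_sub_le hK0 hμ hμ1 (div_pos hε hC₁) hpos
  have e : ε / C₁ * (C₁ * sobE h η s p W + 1) = ε * sobE h η s p W + ε / C₁ := by field_simp
  rw [e] at this
  exact this.trans (by linarith)

end Interpolation

section Weights

/-- Mesh size. -/
noncomputable def gh (K : ℕ) : ℝ := 1 / ((K : ℝ) + 1)

lemma gh_pos (K : ℕ) : 0 < gh K := by unfold gh; positivity

lemma gh_le_one (K : ℕ) : gh K ≤ 1 := by
  unfold gh
  rw [div_le_one (by positivity)]
  have : (0 : ℝ) ≤ K := by positivity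
  linarith

/-- One-dimensional cutoff profile on `ℤ/(K+1)²`. -/
noncomputable def wt1 (r : ℝ) (K : ℕ) (t : ZMod ((K + 1) ^ 2)) : ℝ :=
  max (gh K) (1 - (t.valMinAbs.natAbs : ℝ) * gh K / r)

/-- Cutoff weight of radius `r`. -/
noncomputable def wt {n : ℕ} (r : ℝ) (K : ℕ) (x : Grid n ((K + 1) ^ 2)) : ℝ :=
  ∏ i, wt1 r K (x i)

variable {r : ℝ} {K : ℕ}

lemma gh_le_wt1 (t : ZMod ((K + 1) ^ 2)) : gh K ≤ wt1 r K t := le_max_left _ _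

lemma wt1_pos (t : ZMod ((K + 1) ^ 2)) : 0 < wt1 r K t := (gh_pos K).trans_le (gh_le_wt1 t)

lemma wt1_le_one (hr : 1 ≤ r) (t : ZMod ((K + 1) ^ 2)) : wt1 r K t ≤ 1 := by
  have := gh_pos K
  refine max_le (gh_le_one K) ?_
  have : 0 ≤ (t.valMinAbs.natAbs : ℝ) * gh K / r := by positivity
  linarith

lemma natAbs_valMinAbs_add_one_le (t : ZMod ((K + 1) ^ 2)) :
    (t + 1).valMinAbs.natAbs ≤ t.valMinAbs.natAbs + 1 := by
  refine (ZMod.natAbs_valMinAbs_add_le t 1).trans ?_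
  refine (Int.natAbs_add_le _ _).trans ?_
  have : (1 : ZMod ((K + 1) ^ 2)).valMinAbs.natAbs ≤ 1 := by
    have := ZMod.natAbs_min_of_le_div_two ((K + 1) ^ 2) (1 : ZMod ((K + 1) ^ 2)).valMinAbs 1
      (by simp) (ZMod.natAbs_valMinAbs_le _)
    simpa using this
  omega

lemma natAbs_valMinAbs_le_add_one (t : ZMod ((K + 1) ^ 2)) :
    t.valMinAbs.natAbs ≤ (t + 1).valMinAbs.natAbs + 1 := by
  have h := ZMod.natAbs_valMinAbs_add_le (t + 1) (-1)
  rw [add_neg_cancel_right] at h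
  refine h.trans ((Int.natAbs_add_le _ _).trans ?_)
  have : (-1 : ZMod ((K + 1) ^ 2)).valMinAbs.natAbs ≤ 1 := by
    rw [ZMod.natAbs_valMinAbs_neg]
    have := ZMod.natAbs_min_of_le_div_two ((K + 1) ^ 2) (1 : ZMod ((K + 1) ^ 2)).valMinAbs 1
      (by simp) (ZMod.natAbs_valMinAbs_le _)
    simpa using this
  omega

lemma abs_wt1_succ_sub_le (hr : 1 ≤ r) (t : ZMod ((K + 1) ^ 2)) :
    |wt1 r K (t + 1) - wt1 r K t| ≤ gh K := by
  have hh := gh_pos K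
  have h1 : ((t + 1).valMinAbs.natAbs : ℝ) ≤ t.valMinAbs.natAbs + 1 := by
    exact_mod_cast natAbs_valMinAbs_add_one_le t
  have h2 : (t.valMinAbs.natAbs : ℝ) ≤ (t + 1).valMinAbs.natAbs + 1 := by
    exact_mod_cast natAbs_valMinAbs_le_add_one t
  refine (abs_max_sub_max_le_max _ _ _ _).trans (max_le (by simpa using hh.le) ?_)
  have e : 1 - ((t + 1).valMinAbs.natAbs : ℝ) * gh K / r - (1 - (t.valMinAbs.natAbs : ℝ) * gh K / r)
      = ((t.valMinAbs.natAbs : ℝ) - (t + 1).valMinAbs.natAbs) * (gh K / r) := by ring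
  rw [e, abs_mul, abs_of_pos (by positivity : 0 < gh K / r)]
  have h3 : |(t.valMinAbs.natAbs : ℝ) - (t + 1).valMinAbs.natAbs| ≤ 1 :=
    abs_le.2 ⟨by linarith, by linarith⟩
  calc _ ≤ 1 * gh K := by
        gcongr
        exact div_le_self hh.le hr
    _ = gh K := one_mul _

lemma sum_wt1_le (hr : 1 ≤ r) : gh K * ∑ t, wt1 r K t ≤ 2 * r + 2 := by
  have hh := gh_pos K
  set S := Finset.univ.filter fun t : ZMod ((K + 1) ^ 2) => (t.valMinAbs.natAbs : ℝ) * gh K ≤ r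
  have h1 (t : ZMod ((K + 1) ^ 2)) :
      wt1 r K t ≤ gh K + if (t.valMinAbs.natAbs : ℝ) * gh K ≤ r then 1 else 0 := by
    have h0 : 0 ≤ (t.valMinAbs.natAbs : ℝ) * gh K / r := by positivity
    split_ifs with h
    · exact max_le (by linarith) (by linarith)
    · refine max_le (by linarith) ?_
      have : 1 ≤ (t.valMinAbs.natAbs : ℝ) * gh K / r := by
        rw [le_div_iff₀ (by linarith)]; linarith
      linarith
  have hcard : (S.card : ℝ) ≤ 2 * (r / gh K) + 1 := by
    have hm : S.card ≤ (Finset.Icc (-(⌊r / gh K⌋₊ : ℤ)) ⌊r / gh K⌋₊).card := by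
      refine Finset.card_le_card_of_injOn (fun t => t.valMinAbs) ?_ ?_
      · intro t ht
        have ht' := (Finset.mem_filter.1 ht).2
        rw [← le_div_iff₀ hh] at ht'
        have := Nat.le_floor ht'
        simp only [Finset.coe_Icc, Set.mem_Icc]
        omega
      · exact fun a _ b _ hab => ZMod.injective_valMinAbs hab
    rw [Int.card_Icc] at hm
    have h2 : S.card ≤ 2 * ⌊r / gh K⌋₊ + 1 := by omega
    have h3 : (S.card : ℝ) ≤ 2 * ⌊r / gh K⌋₊ + 1 := by exact_mod_cast h2
    have := Nat.floor_le (show 0 ≤ r / gh K by positivity)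
    linarith
  have h4 := Finset.sum_le_sum (s := Finset.univ) fun t _ => h1 t
  rw [Finset.sum_add_distrib, Finset.sum_const, Finset.card_univ, ZMod.card, nsmul_eq_mul,
    Finset.sum_boole] at h4
  have e : gh K * (((K + 1) ^ 2 : ℕ) * gh K) = 1 := by
    unfold gh; push_cast; field_simp
  calc _ ≤ gh K * (((K + 1) ^ 2 : ℕ) * gh K + S.card) := by gcongr
    _ ≤ gh K * (((K + 1) ^ 2 : ℕ) * gh K + (2 * (r / gh K) + 1)) := by gcongr
    _ = 1 + 2 * r + gh K := by rw [mul_add, e]; field_simp; ring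
    _ ≤ _ := by have := gh_le_one K; linarith

variable {n : ℕ}

lemma isWt_wt (hr : 1 ≤ r) (K : ℕ) :
    IsWt (gh K) ((2 * r + 2) ^ n) (wt r K : Grid n ((K + 1) ^ 2) → ℝ) := by
  have hh := gh_pos K
  have split (i : Fin n) (x : Grid n ((K + 1) ^ 2)) :
      wt r K x = wt1 r K (x i) * ∏ j ∈ Finset.univ.erase i, wt1 r K (x j) :=
    (Finset.mul_prod_erase _ _ (Finset.mem_univ i)).symm
  have split' (i : Fin n) (x : Grid n ((K + 1) ^ 2)) :
      wt r K (x + stp i) = wt1 r K (x i + 1) * ∏ j ∈ Finset.univ.erase i, wt1 r K (x j) := by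
    rw [split i]
    congr 1
    · simp [stp]
    · refine Finset.prod_congr rfl fun j hj => ?_
      simp [stp, Finset.ne_of_mem_erase hj]
  have rest0 (i : Fin n) (x : Grid n ((K + 1) ^ 2)) :
      0 ≤ ∏ j ∈ Finset.univ.erase i, wt1 r K (x j) :=
    Finset.prod_nonneg fun _ _ => (wt1_pos _).le
  have rest1 (i : Fin n) (x : Grid n ((K + 1) ^ 2)) :
      ∏ j ∈ Finset.univ.erase i, wt1 r K (x j) ≤ 1 :=
    Finset.prod_le_one (fun _ _ => (wt1_pos _).le) fun _ _ => wt1_le_one hr _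
  refine ⟨hh, gh_le_one K, ?_, fun x => Finset.prod_pos fun _ _ => wt1_pos _,
    fun x => Finset.prod_le_one (fun _ _ => (wt1_pos _).le) fun _ _ => wt1_le_one hr _, ?_, ?_, ?_, ?_⟩
  · unfold gh
    push_cast
    rw [mul_one_div, le_div_iff₀ (by positivity)]
    nlinarith [show (0 : ℝ) ≤ K by positivity]
  · intro i x
    rw [split' i, split i x, ← sub_mul, abs_mul, abs_of_nonneg (rest0 i x)]
    calc _ ≤ gh K * 1 := mul_le_mul (abs_wt1_succ_sub_le hr _) (rest1 i x) (rest0 i x) hh.le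
      _ = _ := mul_one _
  · intro i x
    rw [split' i, split i x, ← mul_assoc]
    refine mul_le_mul_of_nonneg_right ?_ (rest0 i x)
    have := (abs_le.1 (abs_wt1_succ_sub_le hr (x i))).2
    have := gh_le_wt1 (r := r) (x i)
    linarith
  · intro i x
    rw [split' i, split i x, ← mul_assoc]
    refine mul_le_mul_of_nonneg_right ?_ (rest0 i x)
    have := (abs_le.1 (abs_wt1_succ_sub_le hr (x i))).1
    have := gh_le_wt1 (r := r) (x i + 1)
    linarith
  · have e : lsum (gh K) (wt r K : Grid n ((K + 1) ^ 2) → ℝ) =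
        ∏ _i : Fin n, (gh K * ∑ t, wt1 r K t) := by
      unfold lsum wt
      rw [Finset.prod_mul_distrib, Finset.prod_const, Finset.card_univ, Fintype.card_fin,
        Finset.prod_univ_sum, Fintype.piFinset_univ]
    rw [e]
    calc _ ≤ ∏ _i : Fin n, (2 * r + 2) := Finset.prod_le_prod (fun _ _ =>
          mul_nonneg hh.le (Finset.sum_nonneg fun _ _ => (wt1_pos _).le)) fun _ _ => sum_wt1_le hr
      _ = _ := by simp

end Weights

/-- Time-dependent lattice functions, one for every mesh size. -/
abbrev LF (n : ℕ) := (K : ℕ) → ℝ → Grid n ((K + 1) ^ 2) → ℝ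

/-- Time interval on which the lattice functions live. -/
def tI (K : ℕ) : Set ℝ := Set.Icc 0 ((K : ℝ) + 1)

/-- Weighted `L^q` bound at radius `r` up to time `T`, uniform in the mesh. -/
def Bd {n : ℕ} (r T q : ℝ) (F : LF n) : Prop :=
  ∃ s C : ℝ, 0 ≤ s ∧ ∀ K, ∀ t ∈ tI K, t ≤ T →
    lsum (gh K) (fun x => wt r K x ^ s * |F K t x| ^ q) ≤ C

/-- Local `L^q` bounds for all finite `q`. -/
def PM {n : ℕ} (F : LF n) : Prop := ∀ r T q : ℝ, 1 ≤ r → 0 ≤ q → Bd r T q F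

/-- `F'` is the time derivative of `F`. -/
def IsTD {n : ℕ} (F F' : LF n) : Prop :=
  ∀ K, ∀ t ∈ tI K, ∀ x, HasDerivWithinAt (fun τ => F K τ x) (F' K t x) (tI K) t

/-- Freezing at the initial time. -/
def frz {n : ℕ} (F : LF n) : LF n := fun K _ x => F K 0 x

/-- Difference quotient of a family. -/
noncomputable def lD {n : ℕ} (i : Fin n) (F : LF n) : LF n := fun K t x => ldiff (gh K) i (F K t) x

/-- Translate of a family by one step. -/
def lS {n : ℕ} (i : Fin n) (F : LF n) : LF n := fun K t x => F K t (x + stp i)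

/-- Laplacian of a family. -/
noncomputable def lL {n : ℕ} (F : LF n) : LF n := fun K t x => llap (gh K) (F K t) x

section Classes

variable {n : ℕ} {r T q : ℝ} {F G : LF n}

lemma lsum_wt_mono_exp (hr : 1 ≤ r) {K : ℕ} {s s' : ℝ} (hs : s ≤ s')
    {f : Grid n ((K + 1) ^ 2) → ℝ} (hf : ∀ x, 0 ≤ f x) :
    lsum (gh K) (fun x => wt r K x ^ s' * f x) ≤ lsum (gh K) (fun x => wt r K x ^ s * f x) :=
  lsum_mono (gh_pos K).le fun x => mul_le_mul_of_nonneg_right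
    (Real.rpow_le_rpow_of_exponent_ge ((isWt_wt hr K).pos x) ((isWt_wt hr K).le_one x) hs) (hf x)

lemma lsum_wt_le (hr : 1 ≤ r) (K : ℕ) {s : ℝ} (hs : 1 ≤ s) :
    lsum (gh K) (fun x : Grid n ((K + 1) ^ 2) => wt r K x ^ s) ≤ (2 * r + 2) ^ n := by
  refine le_trans (lsum_mono (gh_pos K).le fun x => ?_) (isWt_wt hr K).sum_le
  calc _ ≤ wt r K x ^ (1 : ℝ) :=
        Real.rpow_le_rpow_of_exponent_ge ((isWt_wt hr K).pos x) ((isWt_wt hr K).le_one x) hs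
    _ = _ := Real.rpow_one _

/-- Bounds with a common, arbitrarily large weight exponent. -/
lemma Bd.exists_bound (h : Bd r T q F) (hr : 1 ≤ r) :
    ∃ s₀ C : ℝ, 0 ≤ s₀ ∧ 0 ≤ C ∧ ∀ s, s₀ ≤ s → ∀ K, ∀ t ∈ tI K, t ≤ T →
      lsum (gh K) (fun x => wt r K x ^ s * |F K t x| ^ q) ≤ C := by
  obtain ⟨s, C, hs, h⟩ := h
  refine ⟨s, |C|, hs, abs_nonneg C, fun s' hs' K t ht htT => ?_⟩
  exact (lsum_wt_mono_exp hr hs' fun x => by positivity).trans ((h K t ht htT).trans (le_abs_self C))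

lemma Bd.of_le (hr : 1 ≤ r) (hG : Bd r T q G) (c : ℝ)
    (hF : ∀ K, ∀ t ∈ tI K, t ≤ T → ∀ x, |F K t x| ^ q ≤ c * (1 + |G K t x| ^ q)) : Bd r T q F := by
  obtain ⟨s₀, C, hs₀, hC, h⟩ := hG.exists_bound hr
  refine ⟨s₀ + 1, |c| * ((2 * r + 2) ^ n + C), by linarith, fun K t ht htT => ?_⟩
  have h1 := h (s₀ + 1) (by linarith) K t ht htT
  have h2 := lsum_wt_le (n := n) hr K (show (1 : ℝ) ≤ s₀ + 1 by linarith)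
  refine (lsum_mono (g := fun x => |c| * (wt r K x ^ (s₀ + 1) +
    wt r K x ^ (s₀ + 1) * |G K t x| ^ q)) (gh_pos K).le fun x => ?_).trans ?_
  · have p1 := Real.rpow_pos_of_pos ((isWt_wt hr K).pos x) (s₀ + 1)
    have h3 := hF K t ht htT x
    have h4 : c * (1 + |G K t x| ^ q) ≤ |c| * (1 + |G K t x| ^ q) := by
      gcongr; exact le_abs_self c
    have := mul_le_mul_of_nonneg_left (h3.trans h4) p1.le
    linarith
  · rw [lsum_const_mul, lsum_add]
    gcongr

lemma Bd.of_exp_le {q' : ℝ} (hr : 1 ≤ r) (hq : 0 ≤ q') (hqq : q' ≤ q) (hF : Bd r T q F) :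
    Bd r T q' F := by
  obtain ⟨s₀, C, hs₀, hC, h⟩ := hF.exists_bound hr
  refine ⟨s₀ + 1, (2 * r + 2) ^ n + C, by linarith, fun K t ht htT => ?_⟩
  have h1 := h (s₀ + 1) (by linarith) K t ht htT
  have h2 := lsum_wt_le (n := n) hr K (show (1 : ℝ) ≤ s₀ + 1 by linarith)
  refine (lsum_mono (g := fun x => wt r K x ^ (s₀ + 1) +
    wt r K x ^ (s₀ + 1) * |F K t x| ^ q) (gh_pos K).le fun x => ?_).trans ?_
  · have p1 := Real.rpow_pos_of_pos ((isWt_wt hr K).pos x) (s₀ + 1)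
    have : |F K t x| ^ q' ≤ 1 + |F K t x| ^ q := by
      rcases le_total (|F K t x|) 1 with h | h
      · have := Real.rpow_le_one (abs_nonneg _) h hq
        have := Real.rpow_nonneg (abs_nonneg (F K t x)) q
        linarith
      · have := Real.rpow_le_rpow_of_exponent_le h hqq
        linarith
    nlinarith
  · rw [lsum_add]
    gcongr

lemma add_rpow_le_mul {a b q : ℝ} (ha : 0 ≤ a) (hb : 0 ≤ b) (hq : 0 ≤ q) :
    (a + b) ^ q ≤ 2 ^ q * (a ^ q + b ^ q) := by
  have h : (a + b) ^ q ≤ (2 * max a b) ^ q :=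
    Real.rpow_le_rpow (by positivity) (by linarith [le_max_left a b, le_max_right a b]) hq
  refine h.trans ?_
  rw [Real.mul_rpow (by norm_num) (le_max_of_le_left ha)]
  refine mul_le_mul_of_nonneg_left ?_ (by positivity)
  have := Real.rpow_nonneg ha q
  have := Real.rpow_nonneg hb q
  rcases max_choice a b with h | h <;> rw [h] <;> linarith

lemma Bd.add (hr : 1 ≤ r) (hq : 0 ≤ q) (hF : Bd r T q F) (hG : Bd r T q G) :
    Bd r T q (fun K t x => |F K t x| + |G K t x|) := by
  obtain ⟨s₀, C, hs₀, hC, h⟩ := hF.exists_bound hr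
  obtain ⟨s₁, C', hs₁, hC', h'⟩ := hG.exists_bound hr
  refine ⟨s₀ + s₁, 2 ^ q * (C + C'), by linarith, fun K t ht htT => ?_⟩
  have h1 := h (s₀ + s₁) (by linarith) K t ht htT
  have h2 := h' (s₀ + s₁) (by linarith) K t ht htT
  refine (lsum_mono (g := fun x => 2 ^ q * (wt r K x ^ (s₀ + s₁) * |F K t x| ^ q +
    wt r K x ^ (s₀ + s₁) * |G K t x| ^ q)) (gh_pos K).le fun x => ?_).trans ?_
  · have p1 := Real.rpow_pos_of_pos ((isWt_wt hr K).pos x) (s₀ + s₁)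
    rw [abs_of_nonneg (by positivity : 0 ≤ |F K t x| + |G K t x|)]
    have := mul_le_mul_of_nonneg_left
      (add_rpow_le_mul (abs_nonneg (F K t x)) (abs_nonneg (G K t x)) hq) p1.le
    linarith
  · rw [lsum_const_mul, lsum_add]
    gcongr

lemma PM.of_abs_le (hG : PM G) (c : ℝ) (hc : 0 ≤ c)
    (hF : ∀ K, ∀ t ∈ tI K, ∀ x, |F K t x| ≤ c * |G K t x|) : PM F := fun r T q hr hq => by
  refine Bd.of_le hr (hG r T q hr hq) (c ^ q) fun K t ht _ x => ?_
  have h1 := Real.rpow_le_rpow (abs_nonneg _) (hF K t ht x) hq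
  rw [Real.mul_rpow hc (abs_nonneg _)] at h1
  have := Real.rpow_nonneg hc q
  nlinarith

lemma PM.of_bounded (c : ℝ) (hF : ∀ K, ∀ t ∈ tI K, ∀ x, |F K t x| ≤ c) : PM F :=
  fun r T q hr hq => by
  refine ⟨1, (2 * r + 2) ^ n * |c| ^ q, zero_le_one, fun K t ht _ => ?_⟩
  have h2 := lsum_wt_le (n := n) hr K le_rfl
  refine (lsum_mono (g := fun x => |c| ^ q * wt r K x ^ (1 : ℝ)) (gh_pos K).le fun x => ?_).trans ?_
  · have p1 := Real.rpow_pos_of_pos ((isWt_wt hr K).pos x) 1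
    have := Real.rpow_le_rpow (abs_nonneg _) ((hF K t ht x).trans (le_abs_self c)) hq
    rw [mul_comm]
    gcongr
  · rw [lsum_const_mul, mul_comm]
    gcongr

lemma PM.const (c : ℝ) : PM (n := n) fun _ _ _ => c := PM.of_bounded |c| fun _ _ _ _ => le_rfl

lemma PM.add_abs (hF : PM F) (hG : PM G) : PM (fun K t x => |F K t x| + |G K t x|) :=
  fun r T q hr hq => (hF r T q hr hq).add hr hq (hG r T q hr hq)

lemma PM.add (hF : PM F) (hG : PM G) : PM (fun K t x => F K t x + G K t x) :=
  (hF.add_abs hG).of_abs_le 1 zero_le_one fun K t _ x => by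
    rw [one_mul, abs_of_nonneg (by positivity : 0 ≤ |F K t x| + |G K t x|)]
    exact abs_add_le _ _

lemma PM.mul (hF : PM F) (hG : PM G) : PM (fun K t x => F K t x * G K t x) :=
  fun r T q hr hq => by
  have h := (hF r T (2 * q) hr (by linarith)).add hr (by linarith) (hG r T (2 * q) hr (by linarith))
  obtain ⟨s, C, hs, h⟩ := h
  refine ⟨s, C, hs, fun K t ht htT => (lsum_mono (gh_pos K).le fun x => ?_).trans (h K t ht htT)⟩
  have p1 := Real.rpow_pos_of_pos ((isWt_wt hr K).pos x) s
  refine mul_le_mul_of_nonneg_left ?_ p1.le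
  rw [abs_of_nonneg (by positivity : 0 ≤ |F K t x| + |G K t x|), abs_mul, Real.rpow_mul (by positivity)]
  refine Real.rpow_le_rpow (by positivity) ?_ hq
  rw [Real.rpow_two]
  nlinarith [abs_nonneg (F K t x), abs_nonneg (G K t x)]

lemma PM.congr (hG : PM G) (h : ∀ K, ∀ t ∈ tI K, ∀ x, F K t x = G K t x) : PM F :=
  hG.of_abs_le 1 zero_le_one fun K t ht x => by rw [h K t ht x, one_mul]

lemma PM.const_mul (hF : PM F) (c : ℝ) : PM (fun K t x => c * F K t x) := (PM.const c).mul hF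

lemma PM.shift (hF : PM F) (i : Fin n) : PM (lS i F) := fun r T q hr hq => by
  obtain ⟨s, C, hs, h⟩ := hF r T q hr hq
  refine ⟨s, 2 ^ s * C, hs, fun K t ht htT => ?_⟩
  have hη := isWt_wt (n := n) hr K
  have e := lsum_add_right (h := gh K) (stp i) (fun x => wt r K x ^ s * |F K t x| ^ q)
  have h1 := h K t ht htT
  rw [← e] at h1
  refine (lsum_mono (g := fun x => 2 ^ s * (wt r K (x + stp i) ^ s * |F K t (x + stp i)| ^ q))
    (gh_pos K).le fun x => ?_).trans ?_
  · have := rpow_dbl (s := s) (hη.pos (x + stp i)) (hη.pos x) (hη.dbl' i x) hs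
    simp only [lS]
    rw [← mul_assoc]
    gcongr
  · rw [lsum_const_mul]
    gcongr

lemma PM.shift_neg (hF : PM F) (i : Fin n) : PM (fun K t x => F K t (x - stp i)) :=
  fun r T q hr hq => by
  obtain ⟨s, C, hs, h⟩ := hF r T q hr hq
  refine ⟨s, 2 ^ s * C, hs, fun K t ht htT => ?_⟩
  have hη := isWt_wt (n := n) hr K
  have e := lsum_sub_right (h := gh K) (stp i) (fun x => wt r K x ^ s * |F K t x| ^ q)
  have h1 := h K t ht htT
  rw [← e] at h1
  refine (lsum_mono (g := fun x => 2 ^ s * (wt r K (x - stp i) ^ s * |F K t (x - stp i)| ^ q))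
    (gh_pos K).le fun x => ?_).trans ?_
  · have hd := hη.dbl i (x - stp i)
    rw [sub_add_cancel] at hd
    have := rpow_dbl (s := s) (hη.pos (x - stp i)) (hη.pos x) hd hs
    rw [← mul_assoc]
    gcongr
  · rw [lsum_const_mul]
    gcongr

/-- The moments of `jb F`. -/
lemma Bd.wmom_le (hr : 1 ≤ r) (hq : 0 ≤ q) (hF : Bd r T q F) :
    ∃ s₀ C : ℝ, 0 ≤ s₀ ∧ 0 ≤ C ∧ ∀ s, s₀ ≤ s → ∀ K, ∀ t ∈ tI K, t ≤ T →
      wmom (gh K) (wt r K) s q (F K t) ≤ C := by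
  have h1 : Bd r T q (fun K t x => jb (F K t x)) := by
    refine Bd.of_le hr hF (2 ^ q) fun K t _ _ x => ?_
    rw [abs_of_pos (jb_pos _)]
    have := Real.rpow_le_rpow (jb_pos _).le (jb_le (F K t x)) hq
    refine this.trans ?_
    have := add_rpow_le_mul zero_le_one (abs_nonneg (F K t x)) hq
    rwa [Real.one_rpow] at this
  obtain ⟨s₀, C, hs₀, hC, h⟩ := h1.exists_bound hr
  refine ⟨s₀, C, hs₀, hC, fun s hs K t ht htT => ?_⟩
  have := h s hs K t ht htT
  simpa only [wmom, abs_of_pos (jb_pos _)] using this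

lemma Bd.of_wmom_le {s C : ℝ} (hr : 1 ≤ r) (hq : 0 ≤ q) (hs : 0 ≤ s)
    (h : ∀ K, ∀ t ∈ tI K, t ≤ T → wmom (gh K) (wt r K) s q (F K t) ≤ C) : Bd r T q F := by
  refine ⟨s, C, hs, fun K t ht htT => (lsum_mono (gh_pos K).le fun x => ?_).trans (h K t ht htT)⟩
  have p1 := (isWt_wt hr K).pos x
  have := abs_le_jb (F K t x)
  gcongr

lemma le_add_mul_of_deriv_le {Y Y' : ℝ → ℝ} {L T c : ℝ}
    (hY : ∀ t ∈ Set.Icc 0 L, HasDerivWithinAt Y (Y' t) (Set.Icc 0 L) t)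
    (hle : ∀ t ∈ Set.Icc 0 L, t ≤ T → Y' t ≤ c) :
    ∀ t ∈ Set.Icc 0 L, t ≤ T → Y t ≤ Y 0 + c * t := by
  intro t ht htT
  have key := image_le_of_deriv_right_le_deriv_boundary (f := Y) (f' := Y') (a := 0) (b := t)
    (B := fun τ => Y 0 + c * τ) (B' := fun _ => c)
    (fun τ hτ => ((hY τ ⟨hτ.1, hτ.2.trans ht.2⟩).continuousWithinAt).mono
      (Set.Icc_subset_Icc_right ht.2))
    (fun τ hτ => (hY τ ⟨hτ.1, hτ.2.le.trans ht.2⟩).mono_of_mem_nhdsWithin ?_) (by simp)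
    (by fun_prop) (fun τ _ => ?_) (fun τ hτ => hle τ ⟨hτ.1, hτ.2.le.trans ht.2⟩ (hτ.2.le.trans htT))
  · exact key ⟨ht.1, le_rfl⟩
  · refine Filter.mem_of_superset (Icc_mem_nhdsGE (hτ.2.trans_le ht.2)) ?_
    exact Set.Icc_subset_Icc_left hτ.1
  · exact (((hasDerivAt_id τ).const_mul c).const_add (Y 0)).hasDerivWithinAt.congr_deriv (by simp)

end Classes

section BaseEnergy

lemma jb_rpow_sub_two_mul_sq (p w : ℝ) : jb w ^ (p - 2) * w ^ 2 = jb w ^ p - jb w ^ (p - 2) := by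
  have h : jb w ^ p = jb w ^ (p - 2) * jb w ^ (2 : ℝ) := by
    rw [← Real.rpow_add (jb_pos w)]; ring_nf
  rw [h, Real.rpow_two, jb_sq]; ring

lemma jb_rpow_mono {p q : ℝ} (hpq : p ≤ q) (w : ℝ) : jb w ^ p ≤ jb w ^ q :=
  Real.rpow_le_rpow_of_exponent_le (one_le_jb w) hpq

lemma abs_jb_rpow_mul_le (p w : ℝ) : |jb w ^ p * w| ≤ jb w ^ (p + 1) := by
  rw [abs_mul, abs_of_pos (Real.rpow_pos_of_pos (jb_pos w) _), Real.rpow_add (jb_pos w),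
    Real.rpow_one]
  have := abs_le_jb w
  have := Real.rpow_pos_of_pos (jb_pos w) p
  gcongr

variable {n : ℕ} {α m M a₀ a₁ k₀ s Cη CR : ℝ}

set_option maxHeartbeats 1000000 in
/-- The time derivative of the critical energy is bounded for exponents slightly above `n / 2`. -/
lemma exists_base_energy (hn : 3 ≤ n) (hα : α * ((n : ℝ) - 2) = 4) (hm : 0 < m) (hmM : m ≤ M)
    (ha₀ : 0 < a₀) (ha₁ : a₀ ≤ a₁) (hk : 0 < k₀) (hs : 2 * ((n : ℝ) / 2 + 1 + 1) + 1 ≤ s)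
    (hCη : 0 ≤ Cη) (hCR0 : 0 ≤ CR) :
    ∃ δ C : ℝ, 0 < δ ∧ δ ≤ 1 ∧ 0 ≤ C ∧
      ∀ (N : ℕ) [NeZero N] (h : ℝ) (η u a z zt R : Grid n N → ℝ),
      IsWt h Cη η → (∀ x, m ≤ u x) → (∀ x, u x ≤ M) → (∀ x, a₀ ≤ a x) → (∀ x, a x ≤ a₁) →
      (∀ x, a x * u x * z x = k₀ * (llap h u x - R x * u x)) →
      (∀ x, a x * u x ^ 2 * (zt x + α * z x ^ 2) =
        k₀ * (u x * llap h (fun y => z y * u y) x - z x * u x * llap h u x)) →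
      lsum h (fun x => η x ^ s * (1 + |R x|) ^ ((n : ℝ) / 2 + 1 + 1)) ≤ CR →
      lsum h (fun x => η x ^ s * ((α + 2) * z x * (a x * u x ^ 2) * jb (z x) ^ ((n : ℝ) / 2 + δ) +
        a x * u x ^ 2 * (((n : ℝ) / 2 + δ) * (jb (z x) ^ ((n : ℝ) / 2 + δ - 2) * z x * zt x)))) ≤
        C := by
  have hn' : (3 : ℝ) ≤ n := by exact_mod_cast hn
  set P : ℝ := (n : ℝ) / 2 + 1 with hP
  have hα0 : 0 < α := by
    by_contra hc
    nlinarith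
  have hM : 0 < M := hm.trans_le hmM
  have ha1 : 0 < a₁ := ha₀.trans_le ha₁
  obtain ⟨C₀, hC₀, H⟩ := exists_wmom_le_wdir n hm hmM ha₀ ha₁ hk hs hCη hCR0
    (by rw [hP]; linarith : (3 / 2 : ℝ) ≤ P)
  set l : ℝ := k₀ * m ^ 2 / 4 with hl
  have hlpos : 0 < l := by positivity
  set A : ℝ := a₁ * M ^ 2 with hA
  have hApos : 0 < A := by positivity
  set c₁ : ℝ := M ^ 2 * ((1 + s) * 2 ^ s) ^ 2 * (n * (1 + 2 ^ (s - 2))) with hc₁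
  have hc₁0 : 0 ≤ c₁ := by positivity
  set B : ℝ := P * k₀ * c₁ + α * P * A with hB
  have hB0 : 0 ≤ B := by positivity
  set δ : ℝ := min 1 (l / (2 * (α * A * C₀ + 1))) with hδ
  have hden : 0 < α * A * C₀ + 1 := by positivity
  have hδ0 : 0 < δ := by rw [hδ]; positivity
  have hδ1 : δ ≤ 1 := min_le_left _ _
  have hδ2 : α * δ * A * C₀ ≤ l / 2 := by
    have : δ ≤ l / (2 * (α * A * C₀ + 1)) := min_le_right _ _
    rw [le_div_iff₀ (by positivity)] at this
    nlinarith
  set ε : ℝ := l / (2 * (B * C₀ + 1)) with hε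
  have hε0 : 0 < ε := by rw [hε]; positivity
  have hε2 : B * ε * C₀ ≤ l / 2 := by
    have : ε * (2 * (B * C₀ + 1)) = l := by rw [hε]; field_simp
    nlinarith
  set p : ℝ := (n : ℝ) / 2 + δ with hp
  have hp32 : 3 / 2 ≤ p := by rw [hp]; linarith
  have hpP : p ≤ P := by rw [hp, hP]; linarith
  have hp0 : 0 ≤ p := by linarith
  refine ⟨δ, l + B * (ε ^ (-p) * Cη), hδ0, hδ1, by positivity, ?_⟩
  intro N _ h η u a z zt R hη hmu huM hau hau' e1 e2 hR
  have hhp := hη.hpos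
  have hR' : lsum h (fun x => η x ^ s * |R x| ^ (p + 1)) ≤ CR := by
    refine (lsum_mono hhp.le fun x => ?_).trans hR
    have p1 := Real.rpow_pos_of_pos (hη.pos x) s
    refine mul_le_mul_of_nonneg_left ?_ p1.le
    refine (Real.rpow_le_rpow (abs_nonneg _) (by linarith : |R x| ≤ 1 + |R x|) (by linarith)).trans ?_
    exact Real.rpow_le_rpow_of_exponent_le (by linarith [abs_nonneg (R x)]) (by linarith)
  have hcub := H N h η u a z R p hη hmu huM hau hau' e1 hp32 hpP hR'
  set D := wdir h η s (p - 2) z with hD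
  have hD0 : 0 ≤ D := wdir_nonneg hη _ _ _
  set X := wmom h η s (p + 1) z with hX
  have hX0 : 0 ≤ X := wmom_nonneg hη _ _ _
  have habs : wmom h η (s - 2) p z ≤ ε * X + ε ^ (-p) * Cη :=
    wmom_absorb hη hp0 hε0 (by linarith) z
  have hco := dirichlet_coercive hη (s := s) (q := p - 2) (lo := m ^ 2) (hi := M ^ 2)
    (by linarith) (by linarith) (by positivity) (fun i x => u x * u (x + stp i))
    (fun i x => by nlinarith [hmu x, hmu (x + stp i)])
    (fun i x => by nlinarith [hmu x, hmu (x + stp i), huM x, huM (x + stp i)]) z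
  rw [show p - 2 + 2 = p by ring, ← hD] at hco
  have hconf := lsum_mul_conformal hhp.ne' (fun x => η x ^ s * (jb (z x) ^ (p - 2) * z x)) u z
  have hsplit : lsum h (fun x => η x ^ s * ((α + 2) * z x * (a x * u x ^ 2) * jb (z x) ^ p +
        a x * u x ^ 2 * (p * (jb (z x) ^ (p - 2) * z x * zt x)))) ≤
      (p * k₀) * lsum h (fun x => η x ^ s * (jb (z x) ^ (p - 2) * z x) *
        (u x * llap h (fun y => z y * u y) x - z x * u x * llap h u x)) +
      (α * δ * A) * X + (α * P * A) * wmom h η (s - 2) p z := by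
    rw [hX]
    unfold wmom
    rw [← lsum_const_mul, ← lsum_const_mul, ← lsum_const_mul, ← lsum_add, ← lsum_add]
    refine lsum_mono hhp.le fun x => ?_
    have p1 := Real.rpow_pos_of_pos (hη.pos x) s
    have hη2 : η x ^ s ≤ η x ^ (s - 2) :=
      Real.rpow_le_rpow_of_exponent_ge (hη.pos x) (hη.le_one x) (by linarith)
    have hA1 : a x * u x ^ 2 ≤ A := by
      have := hau' x; have := huM x; have := hmu x
      have : (0:ℝ) ≤ u x := by linarith
      have : 0 ≤ a x := by linarith [hau x]
      rw [hA]; gcongr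
    have hA0 : 0 ≤ a x * u x ^ 2 := by
      have : 0 ≤ a x := by linarith [hau x]
      positivity
    have hsq := jb_rpow_sub_two_mul_sq p (z x)
    have hz : |jb (z x) ^ p * z x| ≤ jb (z x) ^ (p + 1) := abs_jb_rpow_mul_le _ _
    have hz2 : |jb (z x) ^ (p - 2) * z x| ≤ jb (z x) ^ p :=
      (abs_jb_rpow_mul_le _ _).trans (jb_rpow_mono (by linarith) _)
    have hcoef : α + 2 - α * p = -(α * δ) := by rw [hp]; linarith
    have hp1 := Real.rpow_pos_of_pos (jb_pos (z x)) p
    have hq1 := Real.rpow_pos_of_pos (jb_pos (z x)) (p + 1)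
    have key : η x ^ s * ((α + 2) * z x * (a x * u x ^ 2) * jb (z x) ^ p +
        a x * u x ^ 2 * (p * (jb (z x) ^ (p - 2) * z x * zt x))) =
      p * k₀ * (η x ^ s * (jb (z x) ^ (p - 2) * z x) *
        (u x * llap h (fun y => z y * u y) x - z x * u x * llap h u x)) +
      η x ^ s * ((a x * u x ^ 2) * (-(α * δ) * (jb (z x) ^ p * z x) +
        α * p * (jb (z x) ^ (p - 2) * z x))) := by
      have e2x := e2 x
      rw [← hcoef]
      linear_combination (p * η x ^ s * (jb (z x) ^ (p - 2) * z x)) * e2x -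
        (η x ^ s * a x * u x ^ 2 * α * p * z x) * hsq
    rw [key, add_assoc]
    refine add_le_add le_rfl ?_
    have b1 : -(α * δ) * (jb (z x) ^ p * z x) ≤ α * δ * jb (z x) ^ (p + 1) := by
      have := mul_le_mul_of_nonneg_left (neg_le_of_abs_le hz) (by positivity : 0 ≤ α * δ)
      linarith only [this]
    have b2 : α * p * (jb (z x) ^ (p - 2) * z x) ≤ α * P * jb (z x) ^ p := by
      have h1 := le_of_abs_le hz2
      calc _ ≤ α * p * jb (z x) ^ p := by gcongr
        _ ≤ _ := by gcongr
    calc _ ≤ η x ^ s * (A * (α * δ * jb (z x) ^ (p + 1) + α * P * jb (z x) ^ p)) := by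
          refine mul_le_mul_of_nonneg_left ?_ p1.le
          refine (mul_le_mul_of_nonneg_left (add_le_add b1 b2) hA0).trans ?_
          gcongr
      _ = α * δ * A * (η x ^ s * jb (z x) ^ (p + 1)) + α * P * A * (η x ^ s * jb (z x) ^ p) := by
          ring
      _ ≤ _ := by gcongr
  rw [hconf] at hsplit
  have hpk : 0 ≤ p * k₀ := by positivity
  have h1 := mul_le_mul_of_nonneg_left hco hpk
  have hw0 := wmom_nonneg hη (s - 2) p z
  have h2 : p * k₀ * c₁ ≤ P * k₀ * c₁ := by gcongr
  have h3 : l * D ≤ p * k₀ * (m ^ 2 / 4 * D) := by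
    rw [hl]
    have : (1 : ℝ) * (k₀ * (m ^ 2 / 4 * D)) ≤ p * (k₀ * (m ^ 2 / 4 * D)) :=
      mul_le_mul_of_nonneg_right (by linarith) (by positivity)
    linarith
  have h4 := mul_le_mul_of_nonneg_left habs hB0
  have h5 := mul_le_mul_of_nonneg_left hcub (by positivity : 0 ≤ α * δ * A + B * ε)
  have h6 := mul_le_mul_of_nonneg_right h2 hw0
  have h7 : (α * δ * A * C₀ + B * ε * C₀) * (D + 1) ≤ l * (D + 1) :=
    mul_le_mul_of_nonneg_right (by linarith) (by linarith)
  have h8 : B * wmom h η (s - 2) p z =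
      P * k₀ * c₁ * wmom h η (s - 2) p z + α * P * A * wmom h η (s - 2) p z := by rw [hB]; ring
  linarith only [hsplit, h1, h3, h4, h5, h6, h7, h8]

end BaseEnergy

section TimeDerivatives

lemma hasDerivAt_jb_rpow (p w : ℝ) :
    HasDerivAt (fun w => jb w ^ p) (p * (jb w ^ (p - 2) * w)) w := by
  have h1 : HasDerivAt (fun w : ℝ => 1 + w ^ 2) (2 * w) w := by
    simpa using ((hasDerivAt_id w).pow 2).const_add 1
  have h2 := (h1.sqrt (by positivity)).rpow_const (p := p) (Or.inl (jb_pos w).ne')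
  refine h2.congr_deriv ?_
  change 2 * w / (2 * jb w) * p * jb w ^ (p - 1) = _
  have : jb w ^ (p - 1) = jb w ^ (p - 2) * jb w := by
    nth_rewrite 3 [← Real.rpow_one (jb w)]
    rw [← Real.rpow_add (jb_pos w)]; ring_nf
  have := jb_pos w
  rw [‹jb w ^ (p - 1) = _›]
  field_simp

lemma HasDerivWithinAt.lsum {n N : ℕ} [NeZero N] {h : ℝ} {f : ℝ → Grid n N → ℝ}
    {f' : Grid n N → ℝ} {S : Set ℝ} {t : ℝ}
    (hf : ∀ x, HasDerivWithinAt (fun τ => f τ x) (f' x) S t) :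
    HasDerivWithinAt (fun τ => lsum h (f τ)) (lsum h f') S t := by
  unfold Yamabe.lsum
  exact (HasDerivWithinAt.fun_sum fun x _ => hf x).const_mul _

variable {n : ℕ} {F G F' G' : LF n}

lemma IsTD.mul (hF : IsTD F F') (hG : IsTD G G') :
    IsTD (fun K t x => F K t x * G K t x) (fun K t x => F' K t x * G K t x + F K t x * G' K t x) :=
  fun K t ht x => (hF K t ht x).mul (hG K t ht x)

lemma IsTD.jb_rpow (hF : IsTD F F') (p : ℝ) :
    IsTD (fun K t x => jb (F K t x) ^ p)
      (fun K t x => p * (jb (F K t x) ^ (p - 2) * F K t x * F' K t x)) :=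
  fun K t ht x => by
    have := (hasDerivAt_jb_rpow p (F K t x)).comp_hasDerivWithinAt t (hF K t ht x)
    refine this.congr_deriv ?_
    ring

lemma zero_mem_tI (K : ℕ) : (0 : ℝ) ∈ tI K := ⟨le_rfl, by positivity⟩

/-- Energy inequality in time: a bound of the derivative of a weighted energy bounds the energy. -/
lemma bd_of_deriv_energy_le {W W' A A' : LF n} {r T p s C₀ a₀ a₁ c : ℝ} (hr : 1 ≤ r)
    (hp : 0 ≤ p) (hs0 : 0 ≤ s) (ha₀ : 0 < a₀) (hA : IsTD A A') (hW : IsTD W W')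
    (hA0 : ∀ K, ∀ t ∈ tI K, ∀ x, a₀ ≤ A K t x) (hA1 : ∀ K, ∀ t ∈ tI K, ∀ x, A K t x ≤ a₁)
    (hW0 : ∀ K, ∀ t ∈ tI K, t ≤ T → wmom (gh K) (wt r K) s p (frz W K t) ≤ C₀)
    (hc : ∀ K, ∀ t ∈ tI K, t ≤ T → lsum (gh K) (fun x => wt r K x ^ s *
      (A' K t x * jb (W K t x) ^ p +
        A K t x * (p * (jb (W K t x) ^ (p - 2) * W K t x * W' K t x)))) ≤ c) :
    Bd r T p W := by
  refine Bd.of_wmom_le (s := s) (C := (|a₁| * C₀ + |c| * |T|) / a₀) hr hp hs0 fun K t ht htT => ?_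
  have hη := isWt_wt (n := n) hr K
  set Y : ℝ → ℝ := fun τ => lsum (gh K) (fun x => wt r K x ^ s *
    (A K τ x * jb (W K τ x) ^ p)) with hY
  have hYd : ∀ τ ∈ tI K, HasDerivWithinAt Y _ (tI K) τ := fun τ hτ =>
    HasDerivWithinAt.lsum (h := gh K) fun x =>
      ((hA.mul (hW.jb_rpow p)) K τ hτ x).const_mul (wt r K x ^ s)
  have hYle := le_add_mul_of_deriv_le hYd (hc K) t ht htT
  have hlow : a₀ * wmom (gh K) (wt r K) s p (W K t) ≤ Y t := by
    rw [wmom, ← lsum_const_mul]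
    refine lsum_mono (gh_pos K).le fun x => ?_
    have p1 := Real.rpow_pos_of_pos (hη.pos x) s
    have p2 := Real.rpow_pos_of_pos (jb_pos (W K t x)) p
    have := mul_le_mul_of_nonneg_right (hA0 K t ht x) (mul_pos p1 p2).le
    linarith
  have hup : Y 0 ≤ |a₁| * wmom (gh K) (wt r K) s p (W K 0) := by
    rw [wmom, ← lsum_const_mul]
    refine lsum_mono (gh_pos K).le fun x => ?_
    have p1 := Real.rpow_pos_of_pos (hη.pos x) s
    have p2 := Real.rpow_pos_of_pos (jb_pos (W K 0 x)) p
    have := mul_le_mul_of_nonneg_right ((hA1 K 0 (zero_mem_tI K) x).trans (le_abs_self a₁))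
      (mul_pos p1 p2).le
    linarith
  have h00 : wmom (gh K) (wt r K) s p (W K 0) ≤ C₀ := hW0 K t ht htT
  have h1 : c * t ≤ |c| * |T| :=
    (mul_le_mul_of_nonneg_right (le_abs_self c) ht.1).trans
      (mul_le_mul_of_nonneg_left (htT.trans (le_abs_self T)) (abs_nonneg c))
  rw [le_div_iff₀ ha₀]
  have := mul_le_mul_of_nonneg_left h00 (abs_nonneg a₁)
  linarith

end TimeDerivatives

section BaseIntegrability

variable {n : ℕ} {α m M a₀ a₁ k₀ : ℝ} {u a z zt R : LF n}

/-- Supercritical integrability of the velocity. -/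
lemma exists_bd_velocity (hn : 3 ≤ n) (hα : α * ((n : ℝ) - 2) = 4) (hm : 0 < m) (hmM : m ≤ M)
    (ha₀ : 0 < a₀) (ha₁ : a₀ ≤ a₁) (hk : 0 < k₀)
    (hu0 : ∀ K, ∀ t ∈ tI K, ∀ x, m ≤ u K t x) (hu1 : ∀ K, ∀ t ∈ tI K, ∀ x, u K t x ≤ M)
    (hau0 : ∀ K, ∀ t ∈ tI K, ∀ x, a₀ ≤ a K t x) (hau1 : ∀ K, ∀ t ∈ tI K, ∀ x, a K t x ≤ a₁)
    (e1 : ∀ K, ∀ t ∈ tI K, ∀ x, a K t x * u K t x * z K t x =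
      k₀ * (llap (gh K) (u K t) x - R K t x * u K t x))
    (e2 : ∀ K, ∀ t ∈ tI K, ∀ x, a K t x * u K t x ^ 2 * (zt K t x + α * z K t x ^ 2) =
      k₀ * (u K t x * llap (gh K) (fun y => z K t y * u K t y) x -
        z K t x * u K t x * llap (gh K) (u K t) x))
    (hau : IsTD (fun K t x => a K t x * u K t x ^ 2)
      (fun K t x => (α + 2) * z K t x * (a K t x * u K t x ^ 2)))
    (hz : IsTD z zt) (hR : PM R) (hz0 : PM (frz z)) {r : ℝ} (hr : 1 ≤ r) (T : ℝ) :
    ∃ q, (n : ℝ) / 2 < q ∧ Bd r T q z := by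
  have hR' : PM (fun K t x => 1 + |R K t x|) := by
    simpa using (PM.const 1).add_abs hR
  have hn' : (3 : ℝ) ≤ n := by exact_mod_cast hn
  obtain ⟨s₀, C₀, hs₀, hC₀, hRb⟩ :=
    (hR' r T ((n : ℝ) / 2 + 1 + 1) hr (by positivity)).exists_bound hr
  obtain ⟨s₁, C₁, hs₁, hC₁, hzb⟩ := (hz0 r T ((n : ℝ) / 2 + 1) hr (by positivity)).wmom_le hr
    (by positivity)
  set s : ℝ := s₀ + s₁ + (2 * ((n : ℝ) / 2 + 1 + 1) + 1) with hs
  obtain ⟨δ, C, hδ, hδ1, hC, H⟩ := exists_base_energy (s := s) (Cη := (2 * r + 2) ^ n) (CR := C₀)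
    hn hα hm hmM ha₀ ha₁ hk (by linarith) (by positivity) hC₀
  refine ⟨(n : ℝ) / 2 + δ, by linarith, ?_⟩
  have hM : 0 < M := hm.trans_le hmM
  refine bd_of_deriv_energy_le (s := s) (C₀ := C₁) (c := C) (a₀ := a₀ * m ^ 2) (a₁ := a₁ * M ^ 2)
    hr (by positivity) (by rw [hs]; positivity) (by positivity) hau hz ?_ ?_ ?_ ?_
  · intro K t ht x
    have := hau0 K t ht x
    have := hu0 K t ht x
    gcongr
    exact ha₀.le.trans (hau0 K t ht x)
  · intro K t ht x
    have := hau0 K t ht x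
    have := hau1 K t ht x
    have := hu0 K t ht x
    have := hu1 K t ht x
    have : 0 ≤ u K t x := by linarith
    have : 0 < a₁ := by linarith
    gcongr
  · intro K t ht htT
    refine le_trans (lsum_mono (gh_pos K).le fun x => ?_) (hzb s (by rw [hs]; linarith) K t ht htT)
    have p1 := Real.rpow_pos_of_pos ((isWt_wt (n := n) hr K).pos x) s
    exact mul_le_mul_of_nonneg_left (jb_rpow_mono (by linarith) _) p1.le
  · intro K t ht htT
    refine H _ (gh K) (wt r K) (u K t) (a K t) (z K t) (zt K t) (R K t) (isWt_wt hr K) (hu0 K t ht)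
      (hu1 K t ht) (hau0 K t ht) (hau1 K t ht) (e1 K t ht) (e2 K t ht) ?_
    have := hRb s (by rw [hs]; linarith) K t ht htT
    have e : ∀ y : ℝ, |(1 + |y|)| = 1 + |y| := fun y => abs_of_nonneg (by positivity)
    simpa only [e] using this

end BaseIntegrability

section ParabolicStep

variable {n : ℕ} {r T : ℝ}

lemma wmom_mono_exp {N : ℕ} [NeZero N] {h Cη : ℝ} {η : Grid n N → ℝ} (hη : IsWt h Cη η)
    {s s' p : ℝ} (hs : s ≤ s') (W : Grid n N → ℝ) : wmom h η s' p W ≤ wmom h η s p W :=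
  lsum_mono hη.hpos.le fun x => mul_le_mul_of_nonneg_right
    (Real.rpow_le_rpow_of_exponent_ge (hη.pos x) (hη.le_one x) hs)
    (Real.rpow_nonneg (jb_pos _).le _)

/-- A supercritical coefficient is absorbed by the energy. -/
lemma exists_coeff_absorb (hn : 3 ≤ n) (hr : 1 ≤ r) {W F : LF n} {p p₀ q₀ : ℝ} (hp : 0 < p)
    (hp₀ : 0 < p₀) (hq₀ : (n : ℝ) / 2 < q₀) (hW : Bd r T p₀ W) (hF : Bd r T q₀ F) :
    ∃ s₁ : ℝ, ∀ s, s₁ ≤ s → ∀ ε, 0 < ε → ∃ C, 0 ≤ C ∧ ∀ K, ∀ t ∈ tI K, t ≤ T →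
      lsum (gh K) (fun x => wt r K x ^ (s - 2) * |F K t x| * jb (W K t x) ^ p) ≤
        ε * sobE (gh K) (wt r K) s p (W K t) + C := by
  have hn' : (3 : ℝ) ≤ n := by exact_mod_cast hn
  have hq0 : 0 < q₀ := by linarith
  have hgap : 0 < 2 / (n : ℝ) - 1 / q₀ := by
    rw [sub_pos, div_lt_div_iff₀ hq0 (by linarith)]; linarith
  set μ : ℝ := min 1 (p₀ / p * (2 / (n : ℝ) - 1 / q₀)) with hμ
  have hμ0 : 0 < μ := by rw [hμ]; positivity
  have hμ1 : μ ≤ 1 := min_le_left _ _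
  set β : ℝ := p * μ / p₀ with hβ
  have hβ0 : 0 ≤ β := by positivity
  have hβ1 : β ≤ 2 / (n : ℝ) - 1 / q₀ := by
    rw [hβ, div_le_iff₀ hp₀]
    have : μ ≤ p₀ / p * (2 / (n : ℝ) - 1 / q₀) := min_le_right _ _
    calc p * μ ≤ p * (p₀ / p * (2 / (n : ℝ) - 1 / q₀)) := by gcongr
      _ = _ := by field_simp
  set γ : ℝ := 1 - β - (1 - μ) * (((n : ℝ) - 2) / n) with hγ
  have hfrac : ((n : ℝ) - 2) / n = 1 - 2 / n := by field_simp
  have hγ1 : 1 / q₀ ≤ γ := by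
    have : 0 ≤ ((n : ℝ) - 2) / n := div_nonneg (by linarith) (by linarith)
    rw [hγ]
    nlinarith
  have hγ0 : 0 < γ := lt_of_lt_of_le (by positivity) hγ1
  have hγq : γ⁻¹ ≤ q₀ := by
    rw [inv_le_comm₀ hγ0 hq0]
    simpa using hγ1
  obtain ⟨s₀, B₀, hs₀, hB₀, hWb⟩ := hW.wmom_le hr hp₀.le
  obtain ⟨sF, BF, hsF, hBF, hFb⟩ := (hF.of_exp_le hr (inv_nonneg.2 hγ0.le) hγq).exists_bound hr
  refine ⟨max 2 ((s₀ * β + sF * γ + 2) / μ), fun s hs ε hε => ?_⟩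
  have hs2 : 2 ≤ s := (le_max_left _ _).trans hs
  have hs3 : s₀ * β + sF * γ + 2 ≤ s * μ := by
    rw [← div_le_iff₀ hμ0]; exact (le_max_right _ _).trans hs
  obtain ⟨C, hC, H⟩ := exists_interp (Cη := (2 * r + 2) ^ n) (B₀ := B₀) (BF := BF) (σ := 0) (b := 2)
    hn hs2 hp.le hμ0 hμ1 hβ0 hγ0 (by rw [hγ]; ring)
    (by rw [hβ]; field_simp; ring) (s₀ := s₀) (sF := sF) (p₀ := p₀) (by linarith) hε
  refine ⟨C, hC, fun K t ht htT => ?_⟩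
  have := H _ (gh K) (wt r K) (W K t) (fun x => |F K t x|) (isWt_wt hr K) (fun x => abs_nonneg _)
    (hWb s₀ le_rfl K t ht htT) (hFb sF le_rfl K t ht htT)
  simpa only [add_zero] using this

/-- Energy dissipation for a linear parabolic equation. -/
lemma deriv_energy_le {N : ℕ} [NeZero N] {h Cη : ℝ} {η : Grid n N → ℝ} (hη : IsWt h Cη η)
    {s p k₀ : ℝ} (hs : 2 ≤ s) (hp : 3 / 2 ≤ p) (hk : 0 < k₀) {A A' W W' E₁ E₀ F : Grid n N → ℝ}
    (e : ∀ x, A x * W' x = k₀ * llap h W x + E₁ x * W x + E₀ x) (hF : ∀ x, 1 ≤ F x)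
    (hA' : ∀ x, |A' x| ≤ F x) (hE₁ : ∀ x, |E₁ x| ≤ F x) (hE₀ : ∀ x, |E₀ x| ≤ F x) :
    lsum h (fun x => η x ^ s * (A' x * jb (W x) ^ p +
        A x * (p * (jb (W x) ^ (p - 2) * W x * W' x)))) ≤
      -(p * k₀ / 4) * wdir h η s (p - 2) W +
        (p * k₀ * (((1 + s) * 2 ^ s) ^ 2 * (n * (1 + 2 ^ (s - 2)))) + 1 + 2 * p) *
          lsum h (fun x => η x ^ (s - 2) * F x * jb (W x) ^ p) := by
  have hh := hη.hpos
  have hp0 : 0 ≤ p := by linarith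
  set c₁ : ℝ := ((1 + s) * 2 ^ s) ^ 2 * (n * (1 + 2 ^ (s - 2))) with hc₁
  have hc₁0 : 0 ≤ c₁ := by positivity
  have hco := dirichlet_coercive hη (s := s) (q := p - 2) (lo := 1) (hi := 1) hs (by linarith)
    zero_le_one (fun _ _ => 1) (fun _ _ => le_rfl) (fun _ _ => le_rfl) W
  rw [show p - 2 + 2 = p by ring] at hco
  simp only [one_mul] at hco
  have hib := lsum_mul_llap hh.ne' (fun x => η x ^ s * (jb (W x) ^ (p - 2) * W x)) W
  set Z := lsum h (fun x => η x ^ (s - 2) * F x * jb (W x) ^ p) with hZ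
  have hwZ : wmom h η (s - 2) p W ≤ Z := by
    refine lsum_mono hh.le fun x => ?_
    have p1 := Real.rpow_pos_of_pos (hη.pos x) (s - 2)
    have p2 := Real.rpow_pos_of_pos (jb_pos (W x)) p
    have := mul_le_mul_of_nonneg_left (hF x) (mul_pos p1 p2).le
    linarith
  have hsplit : lsum h (fun x => η x ^ s * (A' x * jb (W x) ^ p +
        A x * (p * (jb (W x) ^ (p - 2) * W x * W' x)))) ≤
      (p * k₀) * lsum h (fun x => η x ^ s * (jb (W x) ^ (p - 2) * W x) * llap h W x) +
        (1 + 2 * p) * Z := by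
    rw [hZ, ← lsum_const_mul, ← lsum_const_mul, ← lsum_add]
    refine lsum_mono hh.le fun x => ?_
    have p1 := Real.rpow_pos_of_pos (hη.pos x) s
    have p2 := Real.rpow_pos_of_pos (jb_pos (W x)) p
    have p3 := Real.rpow_pos_of_pos (jb_pos (W x)) (p - 2)
    have hη2 : η x ^ s ≤ η x ^ (s - 2) :=
      Real.rpow_le_rpow_of_exponent_ge (hη.pos x) (hη.le_one x) (by linarith)
    have hF0 : 0 ≤ F x := by linarith [hF x]
    have key : η x ^ s * (A' x * jb (W x) ^ p + A x * (p * (jb (W x) ^ (p - 2) * W x * W' x))) =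
        p * k₀ * (η x ^ s * (jb (W x) ^ (p - 2) * W x) * llap h W x) +
        η x ^ s * (A' x * jb (W x) ^ p + p * (E₁ x * (jb (W x) ^ (p - 2) * W x ^ 2)) +
          p * (E₀ x * (jb (W x) ^ (p - 2) * W x))) := by
      linear_combination (p * η x ^ s * (jb (W x) ^ (p - 2) * W x)) * e x
    rw [key]
    refine add_le_add le_rfl ?_
    have b1 : A' x * jb (W x) ^ p ≤ F x * jb (W x) ^ p :=
      mul_le_mul_of_nonneg_right (le_of_abs_le (hA' x)) p2.le
    have b2 : E₁ x * (jb (W x) ^ (p - 2) * W x ^ 2) ≤ F x * jb (W x) ^ p := by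
      have h1 : jb (W x) ^ (p - 2) * W x ^ 2 ≤ jb (W x) ^ p := by
        rw [jb_rpow_sub_two_mul_sq]; linarith
      exact (mul_le_mul_of_nonneg_right (le_of_abs_le (hE₁ x)) (by positivity)).trans
        (mul_le_mul_of_nonneg_left h1 hF0)
    have b3 : E₀ x * (jb (W x) ^ (p - 2) * W x) ≤ F x * jb (W x) ^ p := by
      refine (le_abs_self _).trans ?_
      rw [abs_mul]
      exact mul_le_mul (hE₀ x) ((abs_jb_rpow_mul_le _ _).trans (jb_rpow_mono (by linarith) _))
        (abs_nonneg _) hF0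
    calc _ ≤ η x ^ s * (F x * jb (W x) ^ p + p * (F x * jb (W x) ^ p) +
          p * (F x * jb (W x) ^ p)) := by gcongr
      _ ≤ η x ^ (s - 2) * (F x * jb (W x) ^ p + p * (F x * jb (W x) ^ p) +
          p * (F x * jb (W x) ^ p)) := by gcongr
      _ = _ := by ring
  rw [hib] at hsplit
  have hpk : 0 ≤ p * k₀ := by positivity
  have h1 := mul_le_mul_of_nonneg_left hco hpk
  have h2 := mul_le_mul_of_nonneg_left hwZ (mul_nonneg hpk hc₁0)
  linarith only [hsplit, h1, h2]

variable {A A' W W' E₁ E₀ : LF n} {a₀ a₁ k₀ : ℝ}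

/-- Gain of integrability for a linear parabolic equation with supercritical coefficients. -/
lemma bd_of_parabolic (hn : 3 ≤ n) (hr : 1 ≤ r) (hk : 0 < k₀) (ha₀ : 0 < a₀) (hA : IsTD A A')
    (hW : IsTD W W') (hA0 : ∀ K, ∀ t ∈ tI K, ∀ x, a₀ ≤ A K t x)
    (hA1 : ∀ K, ∀ t ∈ tI K, ∀ x, A K t x ≤ a₁)
    (e : ∀ K, ∀ t ∈ tI K, ∀ x, A K t x * W' K t x =
      k₀ * llap (gh K) (W K t) x + E₁ K t x * W K t x + E₀ K t x)
    {p p₀ q₀ : ℝ} (hp : 3 / 2 ≤ p) (hp₀ : 0 < p₀) (hq₀ : (n : ℝ) / 2 < q₀) (hWb : Bd r T p₀ W)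
    (hA'b : Bd r T q₀ A') (hE₁b : Bd r T q₀ E₁) (hE₀b : Bd r T q₀ E₀) (hW0 : Bd r T p (frz W)) :
    Bd r T p W := by
  have hn' : (3 : ℝ) ≤ n := by exact_mod_cast hn
  have hq0 : 0 ≤ q₀ := by linarith
  set F : LF n := fun K t x => 1 + (|A' K t x| + (|E₁ K t x| + |E₀ K t x|)) with hF
  have hFb : Bd r T q₀ F := by
    have h1 := (PM.const (n := n) 1 r T q₀ hr hq0).add hr hq0
      (hA'b.add hr hq0 (hE₁b.add hr hq0 hE₀b))
    have e1 : (fun K t x => |(1 : ℝ)| + |(|A' K t x| + |(|E₁ K t x| + |E₀ K t x|)|)|) = F := by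
      funext K t x
      rw [hF, abs_one, abs_of_nonneg (by positivity : 0 ≤ |E₁ K t x| + |E₀ K t x|),
        abs_of_nonneg (by positivity : 0 ≤ |A' K t x| + (|E₁ K t x| + |E₀ K t x|))]
    rwa [e1] at h1
  have hF1 : ∀ K t x, 1 ≤ F K t x := fun K t x => by
    have : 0 ≤ |A' K t x| + (|E₁ K t x| + |E₀ K t x|) := by positivity
    simp only [hF]; linarith
  obtain ⟨s₀, C₀, hs₀, hC₀, h0⟩ := hW0.wmom_le hr (by linarith)
  obtain ⟨s₁, H⟩ := exists_coeff_absorb hn hr (p := p) (by linarith) hp₀ hq₀ hWb hFb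
  set s := max (max s₀ 2) s₁ with hs
  have hss₀ : s₀ ≤ s := (le_max_left _ _).trans (le_max_left _ _)
  have hs2 : 2 ≤ s := (le_max_right _ _).trans (le_max_left _ _)
  set c₂ : ℝ := p * k₀ * (((1 + s) * 2 ^ s) ^ 2 * (n * (1 + 2 ^ (s - 2)))) + 1 + 2 * p with hc₂
  have hp0 : 0 < p := by linarith
  have hc₂0 : 0 < c₂ := by positivity
  set ε : ℝ := min (1 / 2) (p * k₀ / (8 * c₂)) with hε
  have hε0 : 0 < ε := by rw [hε]; positivity
  have hε1 : ε ≤ 1 / 2 := min_le_left _ _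
  have hε2 : 2 * c₂ * ε ≤ p * k₀ / 4 := by
    have : ε ≤ p * k₀ / (8 * c₂) := min_le_right _ _
    rw [le_div_iff₀ (by positivity)] at this
    linarith
  obtain ⟨C, hC, HC⟩ := H s (le_max_right _ _) ε hε0
  refine bd_of_deriv_energy_le (s := s) (C₀ := C₀) (c := 2 * c₂ * C) hr hp0.le (by linarith) ha₀ hA
    hW hA0 hA1 (h0 s hss₀) fun K t ht htT => ?_
  have hη := isWt_wt (n := n) hr K
  have h1 := deriv_energy_le hη hs2 hp hk (e K t ht) (hF1 K t)
    (fun x => (by simp only [hF]; linarith [abs_nonneg (E₁ K t x), abs_nonneg (E₀ K t x)] :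
      |A' K t x| ≤ F K t x))
    (fun x => by simp only [hF]; linarith [abs_nonneg (A' K t x), abs_nonneg (E₀ K t x)])
    (fun x => by simp only [hF]; linarith [abs_nonneg (A' K t x), abs_nonneg (E₁ K t x)])
  have h2 := HC K t ht htT
  have e2 : ∀ x, |F K t x| = F K t x := fun x => abs_of_pos (by linarith [hF1 K t x])
  simp only [e2] at h2
  set Z := lsum (gh K) (fun x => wt r K x ^ (s - 2) * F K t x * jb (W K t x) ^ p) with hZ
  have hwZ : wmom (gh K) (wt r K) (s - 2) p (W K t) ≤ Z := by
    refine lsum_mono (gh_pos K).le fun x => ?_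
    have p1 := Real.rpow_pos_of_pos (hη.pos x) (s - 2)
    have p2 := Real.rpow_pos_of_pos (jb_pos (W K t x)) p
    have := mul_le_mul_of_nonneg_left (hF1 K t x) (mul_pos p1 p2).le
    linarith
  have hD := wdir_nonneg hη s (p - 2) (W K t)
  have hZ0 : 0 ≤ Z := (wmom_nonneg hη _ _ _).trans hwZ
  unfold sobE at h2
  have h3 : Z ≤ 2 * ε * wdir (gh K) (wt r K) s (p - 2) (W K t) + 2 * C := by
    have := mul_le_mul_of_nonneg_left hwZ hε0.le
    have := mul_le_mul_of_nonneg_right hε1 hZ0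
    linarith
  have h4 := mul_le_mul_of_nonneg_left h3 hc₂0.le
  have h5 := mul_le_mul_of_nonneg_right hε2 hD
  linarith only [h1, h4, h5]

end ParabolicStep

section Elliptic

variable {n N : ℕ} [NeZero N] {h Cη : ℝ} {η : Grid n N → ℝ}

lemma wdir_zero_le (hη : IsWt h Cη η) {s : ℝ} (hs : 2 ≤ s) (V : Grid n N → ℝ) :
    wdir h η s 0 V ≤ 4 * (((1 + s) * 2 ^ s) ^ 2 * (n * (1 + 2 ^ (s - 2))) * wmom h η (s - 2) 2 V -
      lsum h (fun x => η x ^ s * V x * llap h V x)) := by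
  have hco := dirichlet_coercive hη (s := s) (q := 0) (lo := 1) (hi := 1) hs (by norm_num)
    zero_le_one (fun _ _ => 1) (fun _ _ => le_rfl) (fun _ _ => le_rfl) V
  have hib := lsum_mul_llap hη.hpos.ne' (fun x => η x ^ s * V x) V
  simp only [one_mul, Real.rpow_zero, zero_add] at hco
  linarith

lemma wdir_zero (s : ℝ) (V : Grid n N → ℝ) :
    wdir h η s 0 V = esum h (fun i x => η x ^ s * ldiff h i V x ^ 2) := by
  simp only [wdir, Real.rpow_zero, mul_one]

lemma lsum_ldiff_sq_le_wdir (hη : IsWt h Cη η) (s : ℝ) (V : Grid n N → ℝ) (i : Fin n) :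
    lsum h (fun x => η x ^ s * ldiff h i V x ^ 2) ≤ wdir h η s 0 V := by
  rw [wdir_zero]
  exact Finset.single_le_sum (f := fun i => lsum h (fun x => η x ^ s * ldiff h i V x ^ 2))
    (fun j _ => lsum_nonneg hη.hpos.le fun x =>
      mul_nonneg (Real.rpow_nonneg (hη.pos x).le _) (sq_nonneg _)) (Finset.mem_univ i)

lemma llap_ldiff (i : Fin n) (V : Grid n N → ℝ) (x : Grid n N) :
    llap h (ldiff h i V) x = ldiff h i (llap h V) x := by
  simp only [llap, ldiff]
  rw [← Finset.sum_sub_distrib, Finset.sum_div]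
  refine Finset.sum_congr rfl fun j _ => ?_
  rw [add_right_comm x (stp j) (stp i), sub_add_eq_add_sub x (stp j) (stp i)]
  ring

lemma lsum_mul_ldiff (i : Fin n) (F G : Grid n N → ℝ) :
    lsum h (fun x => F x * ldiff h i G x) = - lsum h (fun x => ldiff h i F x * G (x + stp i)) := by
  have := lsum_add_right (h := h) (stp i) (fun x => F x * G x / h)
  have e1 : (fun x => F x * ldiff h i G x) =
      fun x => F x * G (x + stp i) / h - F x * G x / h := by
    funext x; simp only [ldiff]; ring
  have e2 : (fun x => ldiff h i F x * G (x + stp i)) =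
      fun x => F (x + stp i) * G (x + stp i) / h - F x * G (x + stp i) / h := by
    funext x; simp only [ldiff]; ring
  rw [e1, e2, lsum_sub, lsum_sub, this]
  ring

/-- Energy inequality for a difference quotient. -/
lemma wdir_ldiff_le (hη : IsWt h Cη η) {s p : ℝ} (hs : 2 ≤ s) (hp : 2 ≤ p) {V F : Grid n N → ℝ}
    (i : Fin n) (hF1 : ∀ x, 1 + llap h V x ^ 2 ≤ F x)
    (hF2 : ∀ x, 1 + llap h V (x + stp i) ^ 2 ≤ F x) :
    wdir h η s (p - 2) (ldiff h i V) ≤ 8 * (((1 + s) * 2 ^ s) ^ 2 * (n * (1 + 2 ^ (s - 2))) +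
      (2 * (3 + |p - 2| + (1 + s) * 2 ^ s) ^ 2 + (3 + |p - 2| + (1 + s) * 2 ^ s)) *
        (1 + 2 ^ (s - 2))) * lsum h (fun x => η x ^ (s - 2) * F x * jb (ldiff h i V x) ^ p) := by
  have hh := hη.hpos
  set W := ldiff h i V with hW
  set G := llap h V with hG
  set κ : ℝ := 3 + |p - 2| + (1 + s) * 2 ^ s with hκ
  have hκ0 : 0 < κ := by
    have := abs_nonneg (p - 2)
    have : (0 : ℝ) ≤ (1 + s) * 2 ^ s := by positivity
    linarith
  set c₁ : ℝ := ((1 + s) * 2 ^ s) ^ 2 * (n * (1 + 2 ^ (s - 2))) with hc₁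
  have hc₁0 : 0 ≤ c₁ := by positivity
  have hco := dirichlet_coercive hη (s := s) (q := p - 2) (lo := 1) (hi := 1) hs (by linarith)
    zero_le_one (fun _ _ => 1) (fun _ _ => le_rfl) (fun _ _ => le_rfl) W
  rw [show p - 2 + 2 = p by ring] at hco
  simp only [one_mul] at hco
  have hib := lsum_mul_llap hh.ne' (fun x => η x ^ s * (jb (W x) ^ (p - 2) * W x)) W
  have hib2 := lsum_mul_ldiff (h := h) i (fun x => η x ^ s * (jb (W x) ^ (p - 2) * W x)) G
  have e : llap h W = ldiff h i G := funext fun x => llap_ldiff i V x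
  rw [e, hib2, neg_inj] at hib
  set Z := lsum h (fun x => η x ^ (s - 2) * F x * jb (W x) ^ p) with hZ
  have hwZ : wmom h η (s - 2) p W ≤ Z := by
    refine lsum_mono hh.le fun x => ?_
    have p1 := Real.rpow_pos_of_pos (hη.pos x) (s - 2)
    have p2 := Real.rpow_pos_of_pos (jb_pos (W x)) p
    have hF : 1 ≤ F x := by have := hF1 x; linarith [sq_nonneg (G x)]
    have := mul_le_mul_of_nonneg_left hF (mul_pos p1 p2).le
    linarith
  have hmix : lsum h (fun x => η x ^ (s - 2) * (emax W i x ^ p * (1 + G (x + stp i) ^ 2))) ≤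
      (1 + 2 ^ (s - 2)) * Z := by
    have h1 : lsum h (fun x => η x ^ (s - 2) * (emax W i x ^ p * (1 + G (x + stp i) ^ 2))) ≤
        lsum h (fun x => η x ^ (s - 2) * F x * jb (W x) ^ p + 2 ^ (s - 2) *
          (η (x + stp i) ^ (s - 2) * F (x + stp i) * jb (W (x + stp i)) ^ p)) := by
      refine lsum_mono hh.le fun x => ?_
      have p1 := Real.rpow_pos_of_pos (hη.pos x) (s - 2)
      have p2 := Real.rpow_pos_of_pos (jb_pos (W x)) p
      have p3 := Real.rpow_pos_of_pos (jb_pos (W (x + stp i))) p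
      have d := rpow_dbl (s := s - 2) (hη.pos (x + stp i)) (hη.pos x) (hη.dbl' i x) (by linarith)
      have hm : emax W i x ^ p ≤ jb (W x) ^ p + jb (W (x + stp i)) ^ p := by
        unfold emax
        rcases max_cases (jb (W x)) (jb (W (x + stp i))) with ⟨h, _⟩ | ⟨h, _⟩ <;> rw [h] <;> linarith
      have g0 : 0 ≤ 1 + G (x + stp i) ^ 2 := by positivity
      have f0 : 0 ≤ F (x + stp i) := by have := hF1 (x + stp i); linarith [sq_nonneg (G (x + stp i))]
      calc _ ≤ η x ^ (s - 2) * ((jb (W x) ^ p + jb (W (x + stp i)) ^ p) *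
              (1 + G (x + stp i) ^ 2)) := by gcongr
        _ = η x ^ (s - 2) * (1 + G (x + stp i) ^ 2) * jb (W x) ^ p +
            η x ^ (s - 2) * ((1 + G (x + stp i) ^ 2) * jb (W (x + stp i)) ^ p) := by ring
        _ ≤ η x ^ (s - 2) * F x * jb (W x) ^ p + 2 ^ (s - 2) * η (x + stp i) ^ (s - 2) *
            (F (x + stp i) * jb (W (x + stp i)) ^ p) := by
          have q1 := Real.rpow_nonneg (hη.pos (x + stp i)).le (s - 2)
          have q2 := hF1 (x + stp i)
          have q3 := hF2 x
          gcongr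
        _ = _ := by ring
    rw [lsum_add, lsum_const_mul, lsum_add_right (stp i)
      (fun x => η x ^ (s - 2) * F x * jb (W x) ^ p)] at h1
    linarith
  have hcross : lsum h (fun x => ldiff h i (fun y => η y ^ s * (jb (W y) ^ (p - 2) * W y)) x *
      G (x + stp i)) ≤ 1 / 8 * wdir h η s (p - 2) W + (2 * κ ^ 2 + κ) * ((1 + 2 ^ (s - 2)) * Z) := by
    refine le_trans ?_ (add_le_add le_rfl (mul_le_mul_of_nonneg_left hmix (by positivity)))
    have hsing : lsum h (fun x => η x ^ s * emax W i x ^ (p - 2) * ldiff h i W x ^ 2) ≤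
        wdir h η s (p - 2) W :=
      Finset.single_le_sum (f := fun i => lsum h (fun x => η x ^ s * emax W i x ^ (p - 2) *
        ldiff h i W x ^ 2)) (fun j _ => lsum_nonneg hh.le fun x =>
        mul_nonneg (mul_nonneg (Real.rpow_nonneg (hη.pos x).le _)
          (Real.rpow_nonneg (emax_pos W j x).le _)) (sq_nonneg _)) (Finset.mem_univ i)
    refine le_trans ?_ (add_le_add (mul_le_mul_of_nonneg_left hsing (by norm_num)) le_rfl)
    rw [← lsum_const_mul, ← lsum_const_mul, ← lsum_add]
    refine lsum_mono hh.le fun x => ?_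
    have k := abs_ldiff_wt_signed_le hη (s := s) (q := p - 2) (by linarith) (by linarith) W i x
    rw [← hκ, show p - 2 + 1 = p - 1 by ring] at k
    set g := G (x + stp i)
    set y := ldiff h i W x
    have a1 := Real.rpow_pos_of_pos (hη.pos x) s
    have a2 := Real.rpow_pos_of_pos (emax_pos W i x) (p - 2)
    have a3 := Real.rpow_pos_of_pos (emax_pos W i x) p
    have a4 := Real.rpow_pos_of_pos (hη.pos x) (s - 2)
    have b1 : η x ^ s ≤ η x ^ (s - 2) :=
      Real.rpow_le_rpow_of_exponent_ge (hη.pos x) (hη.le_one x) (by linarith)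
    have b2 : η x ^ (s - 1) ≤ η x ^ (s - 2) :=
      Real.rpow_le_rpow_of_exponent_ge (hη.pos x) (hη.le_one x) (by linarith)
    have b3 : emax W i x ^ (p - 2) ≤ emax W i x ^ p :=
      Real.rpow_le_rpow_of_exponent_le (one_le_emax W i x) (by linarith)
    have b4 : emax W i x ^ (p - 1) ≤ emax W i x ^ p :=
      Real.rpow_le_rpow_of_exponent_le (one_le_emax W i x) (by linarith)
    have hg : |g| ≤ 1 + g ^ 2 := by
      rw [← sq_abs]; linarith only [sq_nonneg (|g| - 1), sq_nonneg (|g|)]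
    have hy : κ * (|y| * |g|) ≤ 1 / 8 * y ^ 2 + 2 * κ ^ 2 * g ^ 2 := by
      rw [← sq_abs y, ← sq_abs g]
      linarith only [sq_nonneg (|y| - 4 * κ * |g|)]
    have hd : η x ^ s * emax W i x ^ (p - 2) * g ^ 2 ≤
        η x ^ (s - 2) * (emax W i x ^ p * (1 + g ^ 2)) := by
      calc _ = η x ^ s * (emax W i x ^ (p - 2) * g ^ 2) := by ring
        _ ≤ _ := by gcongr; linarith
    have hd2 : η x ^ (s - 1) * emax W i x ^ (p - 1) * |g| ≤
        η x ^ (s - 2) * (emax W i x ^ p * (1 + g ^ 2)) := by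
      calc _ = η x ^ (s - 1) * (emax W i x ^ (p - 1) * |g|) := by ring
        _ ≤ _ := by
          have := Real.rpow_nonneg (emax_pos W i x).le (p - 1)
          gcongr
    calc _ ≤ |ldiff h i (fun y => η y ^ s * (jb (W y) ^ (p - 2) * W y)) x| * |g| := by
          rw [← abs_mul]; exact le_abs_self _
      _ ≤ κ * (η x ^ s * emax W i x ^ (p - 2) * |y| + η x ^ (s - 1) * emax W i x ^ (p - 1)) * |g| :=
          mul_le_mul_of_nonneg_right k (abs_nonneg _)
      _ = η x ^ s * emax W i x ^ (p - 2) * (κ * (|y| * |g|)) +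
          κ * (η x ^ (s - 1) * emax W i x ^ (p - 1) * |g|) := by ring
      _ ≤ η x ^ s * emax W i x ^ (p - 2) * (1 / 8 * y ^ 2 + 2 * κ ^ 2 * g ^ 2) +
          κ * (η x ^ (s - 2) * (emax W i x ^ p * (1 + g ^ 2))) := by gcongr
      _ = 1 / 8 * (η x ^ s * emax W i x ^ (p - 2) * y ^ 2) +
          2 * κ ^ 2 * (η x ^ s * emax W i x ^ (p - 2) * g ^ 2) +
          κ * (η x ^ (s - 2) * (emax W i x ^ p * (1 + g ^ 2))) := by ring
      _ ≤ 1 / 8 * (η x ^ s * emax W i x ^ (p - 2) * y ^ 2) +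
          2 * κ ^ 2 * (η x ^ (s - 2) * (emax W i x ^ p * (1 + g ^ 2))) +
          κ * (η x ^ (s - 2) * (emax W i x ^ p * (1 + g ^ 2))) := by gcongr
      _ = _ := by ring
  rw [hib] at hcross
  have h1 := mul_le_mul_of_nonneg_left hwZ hc₁0
  linarith only [hcross, hco, h1]

end Elliptic

section EllipticClass

variable {n : ℕ} {r T : ℝ} {V : LF n}

lemma bd_two_ldiff (hr : 1 ≤ r) (hV : PM V) (hL : PM (lL V)) (i : Fin n) :
    Bd r T 2 (lD i V) := by
  obtain ⟨s₀, C₀, hs₀, hC₀, h0⟩ := (hV r T 2 hr (by norm_num)).wmom_le hr (by norm_num)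
  obtain ⟨s₁, C₁, hs₁, hC₁, h1⟩ := ((hV.mul hL) r T 1 hr zero_le_one).exists_bound hr
  set s := s₀ + s₁ + 2 with hs
  refine ⟨s, 4 * (((1 + s) * 2 ^ s) ^ 2 * (n * (1 + 2 ^ (s - 2))) * C₀ + C₁), by linarith,
    fun K t ht htT => ?_⟩
  have hη := isWt_wt (n := n) hr K
  have a1 := wdir_zero_le hη (s := s) (by linarith) (V K t)
  have a2 := lsum_ldiff_sq_le_wdir hη s (V K t) i
  have a3 := h0 (s - 2) (by linarith) K t ht htT
  have a4 := h1 s (by linarith) K t ht htT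
  have a5 : - lsum (gh K) (fun x => wt r K x ^ s * V K t x * llap (gh K) (V K t) x) ≤
      lsum (gh K) (fun x => wt r K x ^ s * |V K t x * lL V K t x| ^ (1 : ℝ)) := by
    refine (neg_le_abs _).trans ((abs_lsum_le (gh_pos K).le _).trans (le_of_eq ?_))
    congr 1; funext x
    rw [Real.rpow_one, abs_mul, abs_mul, abs_mul, abs_of_pos (Real.rpow_pos_of_pos (hη.pos x) s),
      mul_assoc]
    rfl
  have a6 : lsum (gh K) (fun x => wt r K x ^ s * |lD i V K t x| ^ (2 : ℝ)) =
      lsum (gh K) (fun x => wt r K x ^ s * ldiff (gh K) i (V K t) x ^ 2) := by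
    congr 1; funext x
    rw [Real.rpow_two, sq_abs]; rfl
  rw [a6]
  have a7 := mul_le_mul_of_nonneg_left a3
    (by positivity : 0 ≤ ((1 + s) * 2 ^ s) ^ 2 * ((n : ℝ) * (1 + 2 ^ (s - 2))))
  linarith only [a1, a2, a4, a5, a7]

/-- Interior elliptic estimate: difference quotients are controlled by the Laplacian. -/
lemma PM.ldiff (hn : 3 ≤ n) (hV : PM V) (hL : PM (lL V)) (i : Fin n) : PM (lD i V) := by
  suffices H : ∀ r T p : ℝ, 1 ≤ r → 2 ≤ p → Bd r T p (lD i V) from fun r T q hr hq =>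
    (H r T (q + 2) hr (by linarith)).of_exp_le hr hq (by linarith)
  intro r T p hr hp
  set F : LF n := fun K t x => 1 + (lL V K t x ^ 2 + lL V K t (x + stp i) ^ 2) with hF
  have hFP : PM F := by
    have h2 := (hL.mul hL).add ((hL.mul hL).shift i)
    refine ((PM.const 1).add h2).congr fun K t _ x => ?_
    simp only [hF, lS]; ring
  have hF1 : ∀ K t x, 1 ≤ F K t x := fun K t x => by
    have : 0 ≤ lL V K t x ^ 2 + lL V K t (x + stp i) ^ 2 := by positivity
    simp only [hF]; linarith
  obtain ⟨s₁, H⟩ := exists_coeff_absorb (T := T) hn hr (p := p) (by linarith) zero_lt_two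
    (q₀ := n) (by have : (0 : ℝ) < n := by exact_mod_cast (by omega : 0 < n)
                  linarith)
    (bd_two_ldiff hr hV hL i) (hFP r T n hr (by positivity))
  set s := max 2 s₁ with hs
  have hs2 : 2 ≤ s := le_max_left _ _
  set c₂ : ℝ := 8 * (((1 + s) * 2 ^ s) ^ 2 * (n * (1 + 2 ^ (s - 2))) +
      (2 * (3 + |p - 2| + (1 + s) * 2 ^ s) ^ 2 + (3 + |p - 2| + (1 + s) * 2 ^ s)) *
        (1 + 2 ^ (s - 2))) with hc₂
  have hc₂0 : 0 ≤ c₂ := by positivity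
  obtain ⟨C, hC, HC⟩ := H s (le_max_right _ _) (1 / (2 * (c₂ + 1))) (by positivity)
  refine Bd.of_wmom_le (s := s - 2) (C := 2 * C) hr (by linarith) (by linarith) fun K t ht htT => ?_
  have hη := isWt_wt (n := n) hr K
  have h1 := wdir_ldiff_le hη hs2 hp (V := V K t) (F := F K t) i
    (fun x => by simp only [hF, lL]; linarith [sq_nonneg (llap (gh K) (V K t) (x + stp i))])
    (fun x => by simp only [hF, lL]; linarith [sq_nonneg (llap (gh K) (V K t) x)])
  have h2 := HC K t ht htT
  have e2 : ∀ x, |F K t x| = F K t x := fun x => abs_of_pos (by linarith [hF1 K t x])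
  simp only [e2] at h2
  change wdir (gh K) (wt r K) s (p - 2) (lD i V K t) ≤ c₂ * lsum (gh K)
    (fun x => wt r K x ^ (s - 2) * F K t x * jb (lD i V K t x) ^ p) at h1
  set Z := lsum (gh K) (fun x => wt r K x ^ (s - 2) * F K t x * jb (lD i V K t x) ^ p) with hZ
  have hwZ : wmom (gh K) (wt r K) (s - 2) p (lD i V K t) ≤ Z := by
    refine lsum_mono (gh_pos K).le fun x => ?_
    have p1 := Real.rpow_pos_of_pos (hη.pos x) (s - 2)
    have p2 := Real.rpow_pos_of_pos (jb_pos (lD i V K t x)) p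
    have := mul_le_mul_of_nonneg_left (hF1 K t x) (mul_pos p1 p2).le
    linarith
  unfold sobE at h2
  have h3 : 1 / (2 * (c₂ + 1)) * (wdir (gh K) (wt r K) s (p - 2) (lD i V K t) +
      wmom (gh K) (wt r K) (s - 2) p (lD i V K t)) ≤ 1 / (2 * (c₂ + 1)) * (c₂ * Z + Z) := by gcongr
  have h4 : 1 / (2 * (c₂ + 1)) * (c₂ * Z + Z) = Z / 2 := by field_simp
  linarith only [h2, h3, h4, hwZ]

end EllipticClass

section Static

variable {n N : ℕ} [NeZero N] {h Cη : ℝ} {η : Grid n N → ℝ}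

lemma mul_le_mul_sq_add {a b τ : ℝ} (hτ : 0 < τ) : a * b ≤ τ * a ^ 2 + 1 / τ * b ^ 2 := by
  have : τ * a ^ 2 + 1 / τ * b ^ 2 - a * b = (τ * a - b / 2) ^ 2 / τ + 3 / 4 * (b ^ 2 / τ) := by
    field_simp; ring
  have h2 : 0 ≤ (τ * a - b / 2) ^ 2 / τ + 3 / 4 * (b ^ 2 / τ) := by positivity
  linarith

lemma lsum_wt_sq_le_wmom (hη : IsWt h Cη η) {s s' : ℝ} (hs : s ≤ s') (V : Grid n N → ℝ) :
    lsum h (fun x => η x ^ s' * V x ^ 2) ≤ wmom h η s 2 V := by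
  refine lsum_mono hη.hpos.le fun x => ?_
  have b1 : η x ^ s' ≤ η x ^ s :=
    Real.rpow_le_rpow_of_exponent_ge (hη.pos x) (hη.le_one x) hs
  have := Real.rpow_nonneg (hη.pos x).le s
  rw [Real.rpow_two, jb_sq]
  gcongr
  linarith

lemma wmom_two_eq (s : ℝ) (W : Grid n N → ℝ) :
    wmom h η s 2 W = lsum h (fun x => η x ^ s) + lsum h (fun x => η x ^ s * W x ^ 2) := by
  rw [← lsum_add]
  simp only [wmom, Real.rpow_two, jb_sq, mul_add, mul_one]

/-- Static estimate for the right-hand side of an elliptic equation, tested against itself. -/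
lemma wmom_two_testing (hη : IsWt h Cη η) {s a₀ k₀ τ δ : ℝ} (hs : 8 ≤ s) (ha₀ : 0 < a₀)
    (hk : 0 < k₀) (hτ : 0 < τ) (hδ : 0 < δ) {A W V H : Grid n N → ℝ} (hA : ∀ x, a₀ ≤ A x)
    (e : ∀ x, A x * W x = k₀ * llap h V x + H x) :
    a₀ * lsum h (fun x => η x ^ (3 * s / 4) * W x ^ 2) ≤
      a₀ / 4 * lsum h (fun x => η x ^ (3 * s / 4) * W x ^ 2) +
      4 / a₀ * wmom h η (s / 4) 2 H +
      k₀ * (3 + (1 + 3 * s / 4) * 2 ^ (3 * s / 4)) * (τ * wdir h η s 0 W +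
        (1 / τ + 1 / δ) * wdir h η (s / 2) 0 V +
        δ * (n * (1 + 2 ^ (3 * s / 4)) * wmom h η (3 * s / 4) 2 W)) := by
  have hh := hη.hpos
  set s' := 3 * s / 4 with hs'
  set κ : ℝ := 3 + (1 + s') * 2 ^ s' with hκ
  have hκ0 : 0 < κ := by positivity
  have h1 : a₀ * lsum h (fun x => η x ^ s' * W x ^ 2) ≤
      k₀ * lsum h (fun x => η x ^ s' * W x * llap h V x) +
      (a₀ / 4 * lsum h (fun x => η x ^ s' * W x ^ 2) +
        4 / a₀ * lsum h (fun x => η x ^ s' * H x ^ 2)) := by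
    rw [← lsum_const_mul, ← lsum_const_mul, ← lsum_const_mul, ← lsum_const_mul, ← lsum_add,
      ← lsum_add]
    refine lsum_mono hh.le fun x => ?_
    have p1 := Real.rpow_pos_of_pos (hη.pos x) s'
    have y1 : W x * H x ≤ a₀ / 4 * W x ^ 2 + 4 / a₀ * H x ^ 2 := by
      have := mul_le_mul_sq_add (a := W x) (b := H x) (τ := a₀ / 4) (by positivity)
      rwa [one_div_div] at this
    have y2 : a₀ * W x ^ 2 ≤ W x * (k₀ * llap h V x + H x) := by
      rw [← e]
      have := mul_le_mul_of_nonneg_right (hA x) (sq_nonneg (W x))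
      linarith
    have y3 := mul_le_mul_of_nonneg_left (y2.trans (by
      linarith : _ ≤ k₀ * (W x * llap h V x) + (a₀ / 4 * W x ^ 2 + 4 / a₀ * H x ^ 2))) p1.le
    linarith only [y3]
  have h2 := lsum_wt_sq_le_wmom hη (show s / 4 ≤ s' by linarith) H
  have h3 : lsum h (fun x => η x ^ s' * W x * llap h V x) ≤
      κ * (τ * wdir h η s 0 W + (1 / τ + 1 / δ) * wdir h η (s / 2) 0 V +
        δ * (n * (1 + 2 ^ s') * wmom h η s' 2 W)) := by
    have hem := esum_emax_le hη (s := s') (q := 2) (by linarith) W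
    refine le_trans ?_ (mul_le_mul_of_nonneg_left (add_le_add le_rfl
      (mul_le_mul_of_nonneg_left hem hδ.le)) hκ0.le)
    rw [lsum_mul_llap hh.ne', wdir_zero, wdir_zero, ← esum_const_mul, ← esum_const_mul,
      ← esum_const_mul, ← esum_add, ← esum_add, ← esum_const_mul]
    refine (neg_le_abs _).trans ((abs_esum_le hh.le _).trans (esum_mono hh.le fun i x => ?_))
    have k := abs_ldiff_wt_signed_le hη (s := s') (q := 0) (by linarith) (by norm_num) W i x
    simp only [Real.rpow_zero, one_mul, mul_one, abs_zero, add_zero, zero_add, Real.rpow_one] at k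
    rw [← hκ] at k
    set y := ldiff h i W x
    set g := ldiff h i V x
    have q1 : η x ^ s' * |y| * |g| ≤ τ * (η x ^ s * y ^ 2) + 1 / τ * (η x ^ (s / 2) * g ^ 2) := by
      have := mul_le_mul_sq_add (a := η x ^ (s / 2) * |y|) (b := η x ^ (s / 4) * |g|) hτ
      have e1 : η x ^ s' = η x ^ (s / 2) * η x ^ (s / 4) := by
        rw [← Real.rpow_add (hη.pos x)]; congr 1; rw [hs']; ring
      have e2 : η x ^ s = (η x ^ (s / 2)) ^ 2 := by
        rw [← Real.rpow_natCast, ← Real.rpow_mul (hη.pos x).le]; congr 1; push_cast; ring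
      have e3 : η x ^ (s / 2) = (η x ^ (s / 4)) ^ 2 := by
        rw [← Real.rpow_natCast, ← Real.rpow_mul (hη.pos x).le]; congr 1; push_cast; ring
      rw [mul_pow, mul_pow, sq_abs, sq_abs, ← e2, ← e3] at this
      rw [e1]; linarith only [this]
    have q2 : η x ^ (s' - 1) * emax W i x * |g| ≤
        δ * (η x ^ s' * emax W i x ^ (2 : ℝ)) + 1 / δ * (η x ^ (s / 2) * g ^ 2) := by
      have := mul_le_mul_sq_add (a := η x ^ (s' / 2) * emax W i x)
        (b := η x ^ (s' / 2 - 1) * |g|) hδ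
      have e1 : η x ^ (s' - 1) = η x ^ (s' / 2) * η x ^ (s' / 2 - 1) := by
        rw [← Real.rpow_add (hη.pos x)]; congr 1; ring
      have e2 : η x ^ s' = (η x ^ (s' / 2)) ^ 2 := by
        rw [← Real.rpow_natCast, ← Real.rpow_mul (hη.pos x).le]; congr 1; push_cast; ring
      have e3 : (η x ^ (s' / 2 - 1)) ^ 2 ≤ η x ^ (s / 2) := by
        rw [← Real.rpow_natCast, ← Real.rpow_mul (hη.pos x).le]
        refine Real.rpow_le_rpow_of_exponent_ge (hη.pos x) (hη.le_one x) ?_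
        push_cast; linarith
      have e4 := mul_le_mul_of_nonneg_left (mul_le_mul_of_nonneg_right e3 (sq_nonneg g))
        (by positivity : 0 ≤ 1 / δ)
      rw [mul_pow, mul_pow, sq_abs, ← e2] at this
      rw [e1, Real.rpow_two]; linarith only [this, e4]
    rw [abs_mul]
    refine (mul_le_mul_of_nonneg_right k (abs_nonneg g)).trans ?_
    have := mul_le_mul_of_nonneg_left (add_le_add q1 q2) hκ0.le
    linarith only [this]
  have h4 := mul_le_mul_of_nonneg_left h3 hk.le
  have h5 := mul_le_mul_of_nonneg_left h2 (by positivity : 0 ≤ 4 / a₀)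
  linarith only [h1, h4, h5]

/-- Dirichlet energy of the solution of an elliptic equation. -/
lemma wdir_zero_le_of_elliptic (hη : IsWt h Cη η) {s a₁ k₀ ω : ℝ} (hs : 8 ≤ s)
    (hk : 0 < k₀) (hω : 0 < ω) {A W V H : Grid n N → ℝ} (hA : ∀ x, |A x| ≤ a₁)
    (e : ∀ x, A x * W x = k₀ * llap h V x + H x) :
    wdir h η (s / 2) 0 V ≤
      4 * (((1 + s / 2) * 2 ^ (s / 2)) ^ 2 * (n * (1 + 2 ^ (s / 2 - 2))) * wmom h η (s / 4) 2 V +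
      1 / k₀ * (wmom h η (s / 4) 2 V + wmom h η (s / 4) 2 H + a₁ * (ω * lsum h
        (fun x => η x ^ (3 * s / 4) * W x ^ 2) + 1 / ω * wmom h η (s / 4) 2 V))) := by
  have hh := hη.hpos
  have h1 := wdir_zero_le hη (s := s / 2) (by linarith) V
  have h2 := wmom_mono_exp hη (p := 2) (show s / 4 ≤ s / 2 - 2 by linarith) V
  have h3 : -lsum h (fun x => η x ^ (s / 2) * V x * llap h V x) ≤
      1 / k₀ * (wmom h η (s / 4) 2 V + wmom h η (s / 4) 2 H + a₁ * (ω * lsum h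
        (fun x => η x ^ (3 * s / 4) * W x ^ 2) + 1 / ω * wmom h η (s / 4) 2 V)) := by
    have j1 := lsum_wt_sq_le_wmom hη (show s / 4 ≤ s / 2 by linarith) V
    have j2 := lsum_wt_sq_le_wmom hη (show s / 4 ≤ s / 2 by linarith) H
    have j3 := lsum_wt_sq_le_wmom hη (le_refl (s / 4)) V
    have ha₁ : 0 ≤ a₁ := (abs_nonneg _).trans (hA 0)
    have j4 : -lsum h (fun x => η x ^ (s / 2) * V x * llap h V x) ≤
        1 / k₀ * (lsum h (fun x => η x ^ (s / 2) * V x ^ 2) +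
          lsum h (fun x => η x ^ (s / 2) * H x ^ 2) + a₁ * (ω * lsum h
        (fun x => η x ^ (3 * s / 4) * W x ^ 2) +
          1 / ω * lsum h (fun x => η x ^ (s / 4) * V x ^ 2))) := by
      rw [← lsum_neg, ← lsum_const_mul, ← lsum_const_mul, ← lsum_add, ← lsum_add,
        ← lsum_const_mul, ← lsum_add, ← lsum_const_mul]
      refine lsum_mono hh.le fun x => ?_
      have p1 := Real.rpow_pos_of_pos (hη.pos x) (s / 2)
      rw [one_div_mul_eq_div, le_div_iff₀ hk]
      have q1 : η x ^ (s / 2) * (|W x| * |V x|) ≤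
          ω * (η x ^ (3 * s / 4) * W x ^ 2) + 1 / ω * (η x ^ (s / 4) * V x ^ 2) := by
        have := mul_le_mul_sq_add (a := η x ^ (3 * s / 8) * |W x|) (b := η x ^ (s / 8) * |V x|) hω
        have e1 : η x ^ (s / 2) = η x ^ (3 * s / 8) * η x ^ (s / 8) := by
          rw [← Real.rpow_add (hη.pos x)]; congr 1; ring
        have e2 : η x ^ (3 * s / 4) = (η x ^ (3 * s / 8)) ^ 2 := by
          rw [← Real.rpow_natCast, ← Real.rpow_mul (hη.pos x).le]; congr 1; push_cast; ring
        have e3 : η x ^ (s / 4) = (η x ^ (s / 8)) ^ 2 := by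
          rw [← Real.rpow_natCast, ← Real.rpow_mul (hη.pos x).le]; congr 1; push_cast; ring
        rw [mul_pow, mul_pow, sq_abs, sq_abs, ← e2, ← e3] at this
        rw [e1]; linarith only [this]
      have q2 : V x * H x ≤ V x ^ 2 + H x ^ 2 := by
        linarith only [sq_nonneg (V x - H x), sq_nonneg (V x), sq_nonneg (H x)]
      have q3 : -(V x * (A x * W x)) ≤ a₁ * (|W x| * |V x|) := by
        refine (neg_le_abs _).trans ?_
        rw [abs_mul, abs_mul]
        have := mul_le_mul_of_nonneg_right (hA x) (by positivity : 0 ≤ |W x| * |V x|)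
        linarith only [this]
      have q4 := mul_le_mul_of_nonneg_left q1 ha₁
      have q5 := mul_le_mul_of_nonneg_left (add_le_add q2 q3) p1.le
      have q6 : -(η x ^ (s / 2) * V x * llap h V x) * k₀ =
          η x ^ (s / 2) * (V x * H x + -(V x * (A x * W x))) := by rw [e]; ring
      rw [q6]
      linarith only [q4, q5]
    refine j4.trans ?_
    gcongr
  have h4 := mul_le_mul_of_nonneg_left h2
    (by positivity : 0 ≤ ((1 + s / 2) * 2 ^ (s / 2)) ^ 2 * ((n : ℝ) * (1 + 2 ^ (s / 2 - 2))))
  linarith only [h1, h3, h4]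

end Static

lemma exists_wmom_two_le {n : ℕ} (hn : 0 < n) {s a₀ a₁ k₀ ε : ℝ} (hs : 8 ≤ s) (ha₀ : 0 < a₀)
    (ha₁ : a₀ ≤ a₁) (hk : 0 < k₀) (hε : 0 < ε) :
    ∃ c : ℝ, 0 ≤ c ∧ ∀ {N : ℕ} [NeZero N] {h Cη : ℝ} {η : Grid n N → ℝ} (_ : IsWt h Cη η)
      (A W V H : Grid n N → ℝ), (∀ x, a₀ ≤ A x) → (∀ x, A x ≤ a₁) →
      (∀ x, A x * W x = k₀ * llap h V x + H x) →
      wmom h η (3 * s / 4) 2 W ≤ ε * wdir h η s 0 W +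
        c * (wmom h η (s / 4) 2 V + wmom h η (s / 4) 2 H) := by
  set Λ : ℝ := k₀ * (3 + (1 + 3 * s / 4) * 2 ^ (3 * s / 4)) with hΛ
  set ν : ℝ := n * (1 + 2 ^ (3 * s / 4)) with hν
  have hn' : (0 : ℝ) < n := by exact_mod_cast hn
  have hΛ0 : 0 < Λ := by positivity
  have hν0 : 0 < ν := by positivity
  have ha1 : 0 < a₁ := ha₀.trans_le ha₁
  set δ : ℝ := a₀ / (4 * Λ * ν) with hδ
  have hδ0 : 0 < δ := by positivity
  set τ : ℝ := ε * a₀ / (4 * Λ) with hτ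
  have hτ0 : 0 < τ := by positivity
  set B : ℝ := Λ * (1 / τ + 1 / δ) with hB
  have hB0 : 0 < B := by positivity
  set ω : ℝ := a₀ * k₀ / (16 * B * a₁) with hω
  have hω0 : 0 < ω := by positivity
  set c₁ : ℝ := ((1 + s / 2) * 2 ^ (s / 2)) ^ 2 * (n * (1 + 2 ^ (s / 2 - 2))) with hc₁
  have hc₁0 : 0 ≤ c₁ := by positivity
  refine ⟨2 + 4 / a₀ * (4 / a₀ + 4 * B * (c₁ + 1 / k₀ + a₁ / k₀ / ω)), by positivity, ?_⟩
  intro N _ h Cη η hη A W V H hA0 hA1 e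
  have h1 := wmom_two_testing hη hs ha₀ hk hτ0 hδ0 hA0 e
  have h2 := wdir_zero_le_of_elliptic hη hs hk hω0 (a₁ := a₁)
    (fun x => abs_le.2 ⟨by linarith [hA0 x], hA1 x⟩) e
  have h3 := wmom_two_eq (h := h) (η := η) (3 * s / 4) W
  have h4 := wmom_two_eq (h := h) (η := η) (3 * s / 4) V
  have h5 : 0 ≤ lsum h (fun x => η x ^ (3 * s / 4) * V x ^ 2) := lsum_nonneg hη.hpos.le fun x =>
    mul_nonneg (Real.rpow_nonneg (hη.pos x).le _) (sq_nonneg _)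
  have h6 := wmom_mono_exp hη (p := 2) (show s / 4 ≤ 3 * s / 4 by linarith) V
  have hP := wmom_nonneg hη (s / 4) 2 V
  have hQ := wmom_nonneg hη (s / 4) 2 H
  rw [← hΛ, ← hν] at h1
  rw [← hc₁] at h2
  set P := wmom h η (s / 4) 2 V
  set Q := wmom h η (s / 4) 2 H
  set M := lsum h (fun x => η x ^ (3 * s / 4) * W x ^ 2)
  set G := wdir h η (s / 2) 0 V
  set D := wdir h η s 0 W
  set M0 := lsum h (fun x => η x ^ (3 * s / 4))
  have e1 : Λ * (τ * D + (1 / τ + 1 / δ) * G + δ * (ν * wmom h η (3 * s / 4) 2 W)) =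
      ε * a₀ / 4 * D + B * G + a₀ / 4 * (M0 + M) := by
    rw [h3, hB]
    have i1 : Λ * τ = ε * a₀ / 4 := by rw [hτ]; field_simp
    have i2 : Λ * δ * ν = a₀ / 4 := by rw [hδ]; field_simp
    linear_combination D * i1 + (M0 + M) * i2
  have e2 : B * (4 * (c₁ * P + 1 / k₀ * (P + Q + a₁ * (ω * M + 1 / ω * P)))) =
      4 * B * (c₁ * P + 1 / k₀ * (P + Q) + a₁ / k₀ / ω * P) + a₀ / 4 * M := by
    have i1 : B * 4 / k₀ * a₁ * ω = a₀ / 4 := by rw [hω]; field_simp; ring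
    linear_combination M * i1
  have h7 := mul_le_mul_of_nonneg_left h2 hB0.le
  rw [e1] at h1
  rw [e2] at h7
  have h8 : M0 ≤ P := by linarith
  have h9 : a₀ / 4 * M ≤ a₀ / 4 * (ε * D + P) + (4 / a₀ * (P + Q) +
      4 * B * (c₁ + 1 / k₀ + a₁ / k₀ / ω) * (P + Q)) := by
    have j1 : 0 ≤ 4 / a₀ * P := by positivity
    have j2 : 0 ≤ 4 * B * ((c₁ + a₁ / k₀ / ω) * Q) := by positivity
    have j3 := mul_le_mul_of_nonneg_left h8 (by positivity : 0 ≤ a₀ / 4)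
    linarith only [j1, j2, j3, h1, h7]
  have h10 : M ≤ ε * D + P + 4 / a₀ * (4 / a₀ * (P + Q) +
      4 * B * (c₁ + 1 / k₀ + a₁ / k₀ / ω) * (P + Q)) := by
    have := mul_le_mul_of_nonneg_left h9 (by positivity : 0 ≤ 4 / a₀)
    have i1 : 4 / a₀ * (a₀ / 4 * M) = M := by field_simp
    have i2 : 4 / a₀ * (a₀ / 4 * (ε * D + P)) = ε * D + P := by field_simp
    rw [mul_add, i1, i2] at this
    exact this
  rw [h3]
  linarith only [h8, h10, hQ]

section ParabolicClass

variable {n : ℕ} {r T k₀ a₀ a₁ : ℝ} {A A' W W' V H E₁ E₀ : LF n}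

lemma bd_two_of_parabolic (hn : 3 ≤ n) (hr : 1 ≤ r) (hk : 0 < k₀) (ha₀ : 0 < a₀) (ha₁ : a₀ ≤ a₁)
    (hA : IsTD A A') (hW : IsTD W W') (hA0 : ∀ K, ∀ t ∈ tI K, ∀ x, a₀ ≤ A K t x)
    (hA1 : ∀ K, ∀ t ∈ tI K, ∀ x, A K t x ≤ a₁)
    (e0 : ∀ K, ∀ t ∈ tI K, ∀ x, A K t x * W K t x = k₀ * llap (gh K) (V K t) x + H K t x)
    (e : ∀ K, ∀ t ∈ tI K, ∀ x, A K t x * W' K t x =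
      k₀ * llap (gh K) (W K t) x + E₁ K t x * W K t x + E₀ K t x)
    (hV : PM V) (hH : PM H) (hA' : PM A') (hE₁ : PM E₁) (hE₀ : PM E₀) (hW0 : PM (frz W)) :
    Bd r T 2 W := by
  have hn' : (3 : ℝ) ≤ n := by exact_mod_cast hn
  set F : LF n := fun K t x => 1 + (|A' K t x| + |(|E₁ K t x| + |E₀ K t x|)|) with hF
  have hFP : PM F := by
    refine ((PM.const 1).add_abs (hA'.add_abs (hE₁.add_abs hE₀))).congr fun K t _ x => ?_
    simp only [hF]
    rw [abs_one, abs_of_nonneg (by positivity :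
      0 ≤ |A' K t x| + |(|E₁ K t x| + |E₀ K t x|)|)]
  have hF1 : ∀ K t x, 1 ≤ F K t x := fun K t x => by
    have : 0 ≤ |A' K t x| + |(|E₁ K t x| + |E₀ K t x|)| := by positivity
    simp only [hF]; linarith
  have hFE : ∀ K t x, F K t x = 1 + (|A' K t x| + (|E₁ K t x| + |E₀ K t x|)) := fun K t x => by
    simp only [hF]; rw [abs_of_nonneg (by positivity : 0 ≤ |E₁ K t x| + |E₀ K t x|)]
  obtain ⟨s₀, C₀, hs₀, hC₀, h0⟩ := (hW0 r T 2 hr zero_le_two).wmom_le hr zero_le_two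
  obtain ⟨sV, CV, hsV, hCV, hVb⟩ := (hV r T 2 hr zero_le_two).wmom_le hr zero_le_two
  obtain ⟨sH, CH, hsH, hCH, hHb⟩ := (hH r T 2 hr zero_le_two).wmom_le hr zero_le_two
  obtain ⟨sF, BF, hsF, hBF, hFb⟩ := (hFP r T n hr (by linarith)).exists_bound hr
  set s := s₀ + 4 * sV + 4 * sH + 8 * sF + 16 with hs
  have hs8 : 8 ≤ s := by linarith
  set c₂ : ℝ := 2 * k₀ * (((1 + s) * 2 ^ s) ^ 2 * (n * (1 + 2 ^ (s - 2)))) + 1 + 2 * 2 with hc₂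
  have hc₂0 : 0 < c₂ := by positivity
  obtain ⟨C₁, hC₁, hI⟩ := exists_interp_const (n := n) (s := s) (p := 2) (Cη := (2 * r + 2) ^ n)
    (μ := 1 / 2) (β := 1 / 2) (γ := 1 / n) (b := 2) (σ := 0) (p₀ := 2) (s₀ := 3 * s / 4) (sF := sF)
    (BF := BF) hn (by linarith) (by norm_num) (by norm_num) (by norm_num) (by positivity)
    (by field_simp; ring) (by norm_num) (by
      have : sF * (1 / (n : ℝ)) ≤ sF := by
        rw [mul_one_div, div_le_iff₀ (by linarith)]
        have := mul_le_mul_of_nonneg_left hn' hsF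
        linarith
      linarith)
  set κ : ℝ := (|BF| + 1) ^ (1 / (n : ℝ)) with hκ
  have hκ0 : 0 < κ := by positivity
  set lam : ℝ := k₀ / (8 * c₂ * κ * C₁) with hlam
  have hlam0 : 0 < lam := by positivity
  set ε : ℝ := min 1 (lam * k₀ / (4 * c₂ * κ)) with hε
  have hε0 : 0 < ε := by rw [hε]; positivity
  have hε1 : ε ≤ 1 := min_le_left _ _
  have hε2 : c₂ * κ * (1 / lam * ε) ≤ k₀ / 4 := by
    have : ε ≤ lam * k₀ / (4 * c₂ * κ) := min_le_right _ _
    calc c₂ * κ * (1 / lam * ε) ≤ c₂ * κ * (1 / lam * (lam * k₀ / (4 * c₂ * κ))) := by gcongr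
      _ = k₀ / 4 := by field_simp
  have hlam2 : c₂ * κ * (lam * (C₁ * 2)) = k₀ / 4 := by rw [hlam]; field_simp; ring
  obtain ⟨c, hc, hst⟩ := exists_wmom_two_le (n := n) (by omega) hs8 ha₀ ha₁ hk hε0
  set C₂ := c * (CV + CH) + 1 with hC₂
  have hC₂0 : 0 < C₂ := by positivity
  refine bd_of_deriv_energy_le (s := s) (C₀ := C₀)
    (c := c₂ * κ * (1 / lam * C₂ + lam * (C₁ * C₂ + 1))) hr (by norm_num) (by linarith) ha₀ hA
    hW hA0 hA1 (h0 s (by linarith)) fun K t ht htT => ?_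
  have hη := isWt_wt (n := n) hr K
  have h1 := deriv_energy_le hη (s := s) (p := 2) (by linarith) (by norm_num) hk (e K t ht)
    (hF1 K t)
    (fun x => (by rw [hFE]; linarith [abs_nonneg (E₁ K t x), abs_nonneg (E₀ K t x)] :
      |A' K t x| ≤ F K t x))
    (fun x => by rw [hFE]; linarith [abs_nonneg (A' K t x), abs_nonneg (E₀ K t x)])
    (fun x => by rw [hFE]; linarith [abs_nonneg (A' K t x), abs_nonneg (E₁ K t x)])
  have h2 := hst hη (A K t) (W K t) (V K t) (H K t) (hA0 K t ht) (hA1 K t ht) (e0 K t ht)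
  have h3 := hVb (s / 4) (by linarith) K t ht htT
  have h4 := hHb (s / 4) (by linarith) K t ht htT
  have h5 := mul_le_mul_of_nonneg_left (add_le_add h3 h4) hc
  have hD := wdir_nonneg hη s 0 (W K t)
  have h8 := wmom_mono_exp hη (p := 2) (show 3 * s / 4 ≤ s - 2 by linarith) (W K t)
  rw [show (2 : ℝ) - 2 = 0 by norm_num] at h1
  have h7 := hFb sF le_rfl K t ht htT
  set D := wdir (gh K) (wt r K) s 0 (W K t) with hDdef
  set B₀ := ε * D + C₂ with hB₀
  have hB0 : 0 < B₀ := by positivity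
  have h6 := hI ((K + 1) ^ 2) (gh K) (wt r K) (W K t) (F K t) B₀ hη
    (fun x => by linarith [hF1 K t x]) hB0 (by linarith) (by
      rw [one_div, inv_inv]
      refine le_trans (le_of_eq ?_) h7
      congr 1; funext x; rw [abs_of_pos (by linarith [hF1 K t x])])
  rw [add_zero] at h6
  have hX0 := sobE_nonneg hη s 2 (W K t)
  have hX : sobE (gh K) (wt r K) s 2 (W K t) ≤ 2 * D + C₂ := by
    unfold sobE
    rw [show (2 : ℝ) - 2 = 0 by norm_num, ← hDdef]
    have := mul_le_mul_of_nonneg_right hε1 hD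
    linarith
  set X := sobE (gh K) (wt r K) s 2 (W K t)
  have hCX : 0 ≤ C₁ * X + 1 := by positivity
  have h9 : B₀ ^ (1 / 2 : ℝ) * κ * (C₁ * X + 1) ^ (1 - 1 / 2 : ℝ) ≤
      κ * (1 / lam * B₀ + lam * (C₁ * X + 1)) := by
    rw [show (1 : ℝ) - 1 / 2 = 1 / 2 by norm_num, ← Real.sqrt_eq_rpow, ← Real.sqrt_eq_rpow]
    have := mul_le_mul_sq_add (a := Real.sqrt (C₁ * X + 1)) (b := Real.sqrt B₀) hlam0
    rw [Real.sq_sqrt hCX, Real.sq_sqrt hB0.le] at this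
    have := mul_le_mul_of_nonneg_left this hκ0.le
    linarith only [this]
  have h10 : κ * (1 / lam * B₀ + lam * (C₁ * X + 1)) ≤
      κ * (1 / lam * (ε * D + C₂) + lam * (C₁ * (2 * D + C₂) + 1)) := by gcongr
  have h11 := mul_le_mul_of_nonneg_left (h6.trans (h9.trans h10)) hc₂0.le
  have h12 := mul_le_mul_of_nonneg_right hε2 hD
  have h13 : c₂ * (κ * (1 / lam * (ε * D + C₂) + lam * (C₁ * (2 * D + C₂) + 1))) ≤
      k₀ / 2 * D + c₂ * κ * (1 / lam * C₂ + lam * (C₁ * C₂ + 1)) := by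
    linear_combination h12 + D * hlam2
  linarith only [h1, h11, h13]

/-- Propagation of local integrability by a parabolic equation. -/
lemma PM.of_parabolic (hn : 3 ≤ n) (hk : 0 < k₀) (ha₀ : 0 < a₀) (ha₁ : a₀ ≤ a₁)
    (hA : IsTD A A') (hW : IsTD W W') (hA0 : ∀ K, ∀ t ∈ tI K, ∀ x, a₀ ≤ A K t x)
    (hA1 : ∀ K, ∀ t ∈ tI K, ∀ x, A K t x ≤ a₁)
    (e0 : ∀ K, ∀ t ∈ tI K, ∀ x, A K t x * W K t x = k₀ * llap (gh K) (V K t) x + H K t x)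
    (e : ∀ K, ∀ t ∈ tI K, ∀ x, A K t x * W' K t x =
      k₀ * llap (gh K) (W K t) x + E₁ K t x * W K t x + E₀ K t x)
    (hV : PM V) (hH : PM H) (hA' : PM A') (hE₁ : PM E₁) (hE₀ : PM E₀) (hW0 : PM (frz W)) :
    PM W := by
  intro r T q hr hq
  have hn' : (3 : ℝ) ≤ n := by exact_mod_cast hn
  have h2 : Bd r T 2 W := bd_two_of_parabolic hn hr hk ha₀ ha₁ hA hW hA0 hA1 e0 e hV hH hA' hE₁
    hE₀ hW0
  exact (bd_of_parabolic hn hr hk ha₀ hA hW hA0 hA1 e (p := q + 2) (p₀ := 2) (q₀ := n)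
    (by linarith) zero_lt_two (by linarith) h2 (hA' r T n hr (by linarith))
    (hE₁ r T n hr (by linarith)) (hE₀ r T n hr (by linarith))
    (hW0 r T (q + 2) hr (by linarith))).of_exp_le hr hq (by linarith)

end ParabolicClass

/-- Iterated difference quotients of a family. -/
noncomputable def LD {n : ℕ} : List (Fin n) → LF n → LF n
  | [], F => F
  | i :: l, F => LD l (lD i F)

/-- Families whose difference quotients up to order `k` are locally integrable to all powers. -/
def CS {n : ℕ} (k : ℕ) (F : LF n) : Prop := ∀ l : List (Fin n), l.length ≤ k → PM (LD l F)

section Regularity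

variable {n : ℕ} {k : ℕ} {F G : LF n}

lemma CS.pm (hF : CS k F) : PM F := hF [] (Nat.zero_le k)

lemma cs_zero_iff : CS 0 F ↔ PM F :=
  ⟨fun h => h.pm, fun h l hl => by
    obtain rfl := List.eq_nil_of_length_eq_zero (Nat.le_zero.1 hl)
    exact h⟩

lemma cs_succ_iff : CS (k + 1) F ↔ PM F ∧ ∀ i, CS k (lD i F) := by
  refine ⟨fun h => ⟨h.pm, fun i l hl => h (i :: l) (by simpa using hl)⟩, fun h l hl => ?_⟩
  cases l with
  | nil => exact h.1
  | cons i l => exact h.2 i l (by simpa using hl)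

lemma CS.mono {k' : ℕ} (hF : CS k' F) (hk : k ≤ k') : CS k F := fun l hl => hF l (hl.trans hk)

lemma CS.lD (hF : CS (k + 1) F) (i : Fin n) : CS k (lD i F) := (cs_succ_iff.1 hF).2 i

lemma CS.congr (hG : CS k G) (h : ∀ K, ∀ t ∈ tI K, ∀ x, F K t x = G K t x) : CS k F := by
  induction k generalizing F G with
  | zero => exact cs_zero_iff.2 (hG.pm.congr h)
  | succ k ih =>
    refine cs_succ_iff.2 ⟨hG.pm.congr h, fun i => ih (hG.lD i) fun K t ht x => ?_⟩
    simp only [Yamabe.lD, ldiff, h K t ht]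

lemma CS.const (c : ℝ) : CS (n := n) k fun _ _ _ => c := by
  induction k generalizing c with
  | zero => exact cs_zero_iff.2 (PM.const c)
  | succ k ih =>
    refine cs_succ_iff.2 ⟨PM.const c, fun i => (ih 0).congr fun K t _ x => ?_⟩
    simp [Yamabe.lD, ldiff]

lemma CS.add (hF : CS k F) (hG : CS k G) : CS k (fun K t x => F K t x + G K t x) := by
  induction k generalizing F G with
  | zero => exact cs_zero_iff.2 (hF.pm.add hG.pm)
  | succ k ih =>
    refine cs_succ_iff.2 ⟨hF.pm.add hG.pm, fun i => (ih (hF.lD i) (hG.lD i)).congr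
      fun K t _ x => ?_⟩
    simp only [Yamabe.lD, ldiff]; ring

lemma CS.shift (hF : CS k F) (i : Fin n) : CS k (lS i F) := by
  induction k generalizing F with
  | zero => exact cs_zero_iff.2 (hF.pm.shift i)
  | succ k ih =>
    refine cs_succ_iff.2 ⟨hF.pm.shift i, fun j => (ih (hF.lD j)).congr fun K t _ x => ?_⟩
    simp only [Yamabe.lD, ldiff, lS, add_right_comm]

lemma CS.shift_neg (hF : CS k F) (i : Fin n) : CS k (fun K t x => F K t (x - stp i)) := by
  induction k generalizing F with
  | zero => exact cs_zero_iff.2 (hF.pm.shift_neg i)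
  | succ k ih =>
    refine cs_succ_iff.2 ⟨hF.pm.shift_neg i, fun j => (ih (hF.lD j)).congr fun K t _ x => ?_⟩
    simp only [Yamabe.lD, ldiff, sub_add_eq_add_sub]

lemma CS.mul (hF : CS k F) (hG : CS k G) : CS k (fun K t x => F K t x * G K t x) := by
  induction k generalizing F G with
  | zero => exact cs_zero_iff.2 (hF.pm.mul hG.pm)
  | succ k ih =>
    refine cs_succ_iff.2 ⟨hF.pm.mul hG.pm, fun i => ((ih ((hF.mono k.le_succ).shift i)
      (hG.lD i)).add (ih (hF.lD i) (hG.mono k.le_succ))).congr fun K t _ x => ?_⟩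
    simp only [Yamabe.lD, ldiff, lS]; ring

lemma CS.const_mul (hF : CS k F) (c : ℝ) : CS k (fun K t x => c * F K t x) := (CS.const c).mul hF

lemma CS.sum {ι : Type*} (S : Finset ι) {Fs : ι → LF n} (h : ∀ j ∈ S, CS k (Fs j)) :
    CS k (fun K t x => ∑ j ∈ S, Fs j K t x) := by
  classical
  induction S using Finset.induction_on with
  | empty => simpa using CS.const 0
  | insert a S ha ih =>
    simp only [Finset.sum_insert ha]
    exact (h a (Finset.mem_insert_self _ _)).add
      (ih fun j hj => h j (Finset.mem_insert_of_mem hj))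

lemma CS.pow (hF : CS k F) (m : ℕ) : CS k (fun K t x => F K t x ^ m) := by
  induction m with
  | zero => simpa using CS.const 1
  | succ m ih => simpa only [pow_succ] using ih.mul hF

lemma CS.inv {c : ℝ} (hc : 0 < c) (h : ∀ K, ∀ t ∈ tI K, ∀ x, c ≤ F K t x) (hF : CS k F) :
    CS k (fun K t x => (F K t x)⁻¹) := by
  have h0 : PM (fun K t x => (F K t x)⁻¹) := PM.of_bounded c⁻¹ fun K t ht x => by
    rw [abs_of_pos (inv_pos.2 (hc.trans_le (h K t ht x)))]
    exact inv_anti₀ hc (h K t ht x)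
  induction k with
  | zero => exact cs_zero_iff.2 h0
  | succ k ih =>
    have hI := ih (hF.mono k.le_succ)
    refine cs_succ_iff.2 ⟨h0, fun i => (((hI.shift i).mul hI).mul
      ((hF.lD i).const_mul (-1))).congr fun K t ht x => ?_⟩
    have e1 := (hc.trans_le (h K t ht x)).ne'
    have e2 := (hc.trans_le (h K t ht (x + stp i))).ne'
    simp only [Yamabe.lD, ldiff, lS]
    have := (gh_pos K).ne'
    field_simp
    ring

lemma CS.root {c : ℝ} {d : ℕ} (hd : 0 < d) (hc : 0 < c) {B : ℝ}
    (h : ∀ K, ∀ t ∈ tI K, ∀ x, c ≤ F K t x) (hB : ∀ K, ∀ t ∈ tI K, ∀ x, F K t x ≤ B)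
    (hF : CS k (fun K t x => F K t x ^ d)) : CS k F := by
  have h0 : PM F := PM.of_bounded B fun K t ht x => by
    rw [abs_of_pos (hc.trans_le (h K t ht x))]; exact hB K t ht x
  induction k with
  | zero => exact cs_zero_iff.2 h0
  | succ k ih =>
    have hI := ih (hF.mono k.le_succ)
    refine cs_succ_iff.2 ⟨h0, fun i => ?_⟩
    have hQ : CS k (fun K t x => ∑ j ∈ Finset.range d,
        F K t (x + stp i) ^ j * F K t x ^ (d - 1 - j)) :=
      CS.sum _ fun j _ => ((hI.shift i).pow j).mul (hI.pow _)
    have hpos : ∀ K, ∀ t ∈ tI K, ∀ x, c ^ (d - 1) ≤ ∑ j ∈ Finset.range d,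
        F K t (x + stp i) ^ j * F K t x ^ (d - 1 - j) := fun K t ht x => by
      have hs := fun y => (hc.trans_le (h K t ht y)).le
      refine le_trans ?_ (Finset.single_le_sum
        (f := fun j => F K t (x + stp i) ^ j * F K t x ^ (d - 1 - j))
        (fun j _ => mul_nonneg (pow_nonneg (hs _) _) (pow_nonneg (hs _) _))
        (Finset.mem_range.2 hd))
      simpa using pow_le_pow_left₀ hc.le (h K t ht x) (d - 1)
    have hcd := pow_pos hc (d - 1)
    refine ((hF.lD i).mul (hQ.inv hcd hpos)).congr fun K t ht x => ?_
    have h1 := (hcd.trans_le (hpos K t ht x)).ne'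
    have h2 := geom_sum₂_mul (F K t (x + stp i)) (F K t x) d
    have := (gh_pos K).ne'
    simp only [Yamabe.lD, ldiff]
    rw [← h2]
    field_simp

lemma llap_eq_sum_ldiff {N : ℕ} {h : ℝ} (f : Grid n N → ℝ) (x : Grid n N) :
    llap h f x = ∑ i, ldiff h i (ldiff h i f) (x - stp i) := by
  simp only [llap, ldiff, sub_add_cancel]
  refine Finset.sum_congr rfl fun i _ => ?_
  ring

lemma CS.lL (hF : CS (k + 2) F) : CS k (lL F) := by
  refine (CS.sum Finset.univ fun i _ => ((hF.lD i).lD i).shift_neg i).congr fun K t _ x => ?_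
  exact llap_eq_sum_ldiff _ _

/-- Elliptic regularity on the lattice. -/
lemma CS.succ_of_lL (hn : 3 ≤ n) (hF : CS k F) (hL : CS k (Yamabe.lL F)) : CS (k + 1) F := by
  induction k generalizing F with
  | zero => exact cs_succ_iff.2 ⟨hF.pm, fun i => cs_zero_iff.2 (hF.pm.ldiff hn hL.pm i)⟩
  | succ k ih =>
    refine cs_succ_iff.2 ⟨hF.pm, fun i => ih (hF.lD i) ((hL.lD i).congr fun K t _ x => ?_)⟩
    exact llap_ldiff i (F K t) x

end Regularity

section Static

variable {n : ℕ}

/-- Position in space of a lattice point. -/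
noncomputable def pos (K : ℕ) (x : Grid n ((K + 1) ^ 2)) : EuclideanSpace ℝ (Fin n) :=
  WithLp.toLp 2 fun i => gh K * ((x i).valMinAbs : ℝ)

/-- Sampling of a function on the lattice. -/
noncomputable def smp (f : EuclideanSpace ℝ (Fin n) → ℝ) : LF n := fun K _ x => f (pos K x)

/-- Lattice point with given integer coordinates. -/
def gcast (K : ℕ) (m : Fin n → ℤ) : Grid n ((K + 1) ^ 2) := fun i => (m i : ZMod ((K + 1) ^ 2))

/-- Point of space with given integer coordinates. -/
noncomputable def ipt (K : ℕ) (m : Fin n → ℤ) : EuclideanSpace ℝ (Fin n) :=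
  WithLp.toLp 2 fun i => gh K * (m i : ℝ)

lemma gcast_add_single (K : ℕ) (m : Fin n → ℤ) (i : Fin n) :
    gcast K (m + Pi.single i 1) = gcast K m + stp i := by
  funext j
  by_cases h : j = i
  · subst h; simp [gcast, stp]
  · simp [gcast, stp, Pi.single_eq_of_ne h]

lemma ipt_add_single (K : ℕ) (m : Fin n → ℤ) (i : Fin n) :
    ipt K (m + Pi.single i 1) = ipt K m + gh K • EuclideanSpace.single i 1 := by
  ext j
  by_cases h : j = i
  · subst h; simp [ipt, mul_add]
  · simp [ipt, h]

lemma gcast_valMinAbs (K : ℕ) (x : Grid n ((K + 1) ^ 2)) :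
    gcast K (fun i => (x i).valMinAbs) = x := by
  funext j; simp [gcast]

lemma pos_gcast {K : ℕ} {m : Fin n → ℤ} (h : ∀ i, 2 * |m i| < (K + 1 : ℤ) ^ 2) :
    pos K (gcast K m) = ipt K m := by
  ext i
  have : ((m i : ZMod ((K + 1) ^ 2))).valMinAbs = m i := by
    rw [ZMod.valMinAbs_spec]
    refine ⟨rfl, ?_⟩
    have := abs_lt.1 (show |2 * m i| < (K + 1 : ℤ) ^ 2 by rw [abs_mul]; simpa using h i)
    push_cast
    constructor <;> linarith
  simp [pos, ipt, gcast, this]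

/-- Forward difference quotient of a function on space. -/
noncomputable def rD {E : Type*} [AddCommGroup E] [Module ℝ E] (h : ℝ) (i : Fin n)
    (f : EuclideanSpace ℝ (Fin n) → E) (x : EuclideanSpace ℝ (Fin n)) : E :=
  h⁻¹ • (f (x + h • EuclideanSpace.single i 1) - f x)

/-- Iterated forward difference quotients. -/
noncomputable def rDs (h : ℝ) : List (Fin n) → (EuclideanSpace ℝ (Fin n) → ℝ) →
    EuclideanSpace ℝ (Fin n) → ℝ
  | [], f => f
  | i :: l, f => rDs h l (rD h i f)

lemma LD_gcast {K : ℕ} {t : ℝ} (l : List (Fin n)) {F : LF n}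
    {f : EuclideanSpace ℝ (Fin n) → ℝ} {L : ℤ}
    (h : ∀ m : Fin n → ℤ, (∀ i, |m i| ≤ L + l.length) → F K t (gcast K m) = f (ipt K m)) :
    ∀ m : Fin n → ℤ, (∀ i, |m i| ≤ L) → LD l F K t (gcast K m) = rDs (gh K) l f (ipt K m) := by
  induction l generalizing F f with
  | nil => intro m hm; simpa [LD, rDs] using h m (by simpa using hm)
  | cons i l ih =>
    refine ih fun m hm => ?_
    have h1 := h m fun j => (hm j).trans (by simp)
    have h2 := h (m + Pi.single i 1) fun j => by
      have h3 := hm j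
      have : |(Pi.single i 1 : Fin n → ℤ) j| ≤ 1 := by
        by_cases hj : j = i
        · subst hj; simp
        · simp [Pi.single_eq_of_ne hj]
      have := abs_add_le (m j) ((Pi.single i 1 : Fin n → ℤ) j)
      simp only [Pi.add_apply, List.length_cons]
      push_cast
      linarith
    rw [gcast_add_single, ipt_add_single] at h2
    simp only [Yamabe.lD, ldiff, rD, h1, h2, smul_eq_mul]
    ring

lemma norm_rD_le {E : Type*} [NormedAddCommGroup E] [NormedSpace ℝ E] {h : ℝ} (hh : 0 < h)
    (h1 : h ≤ 1) (i : Fin n) {f : EuclideanSpace ℝ (Fin n) → E} (hf : Differentiable ℝ f) {r C : ℝ}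
    (hC : ∀ y, ‖y‖ ≤ r + 1 → ‖fderiv ℝ f y‖ ≤ C) {x : EuclideanSpace ℝ (Fin n)} (hx : ‖x‖ ≤ r) :
    ‖rD h i f x‖ ≤ C := by
  have key := (convex_closedBall (0 : EuclideanSpace ℝ (Fin n)) (r + 1)).norm_image_sub_le_of_norm_fderiv_le
    (𝕜 := ℝ) (f := f) (C := C) (x := x) (y := x + h • EuclideanSpace.single i 1)
    (fun y _ => hf y) (fun y hy => hC y (by simpa using hy))
    (by simp; linarith) (by
      simp only [mem_closedBall_zero_iff]
      refine (norm_add_le _ _).trans ?_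
      rw [norm_smul]
      simp [abs_of_pos hh]
      linarith)
  rw [rD, norm_smul, norm_inv, Real.norm_eq_abs, abs_of_pos hh]
  rw [add_sub_cancel_left, norm_smul] at key
  simp [abs_of_pos hh] at key
  rw [inv_mul_le_iff₀ hh, mul_comm]
  exact key

lemma iteratedFDeriv_rD (h : ℝ) (i : Fin n) {f : EuclideanSpace ℝ (Fin n) → ℝ}
    (hf : ContDiff ℝ (⊤ : ℕ∞) f) (k : ℕ) :
    iteratedFDeriv ℝ k (rD h i f) = rD h i (iteratedFDeriv ℝ k f) := by
  funext x
  have hk : ContDiff ℝ k f := hf.of_le (by exact_mod_cast le_top)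
  have hk' : ContDiff ℝ k (fun y => f (y + h • EuclideanSpace.single i 1)) :=
    hk.comp (contDiff_id.add contDiff_const)
  have e : rD h i f = h⁻¹ • ((fun y => f (y + h • EuclideanSpace.single i 1)) - f) := by
    funext y; simp [rD]
  rw [e, iteratedFDeriv_const_smul_apply (f := (fun y => f (y + h • EuclideanSpace.single i 1)) - f)
    (hk'.sub hk).contDiffAt, iteratedFDeriv_sub_apply hk'.contDiffAt hk.contDiffAt, iteratedFDeriv_comp_add_right]
  rfl

lemma contDiff_rD (h : ℝ) (i : Fin n) {f : EuclideanSpace ℝ (Fin n) → ℝ}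
    (hf : ContDiff ℝ (⊤ : ℕ∞) f) : ContDiff ℝ (⊤ : ℕ∞) (rD h i f) :=
  ((hf.comp (contDiff_id.add contDiff_const)).sub hf).const_smul _

lemma exists_bound_rDs (l : List (Fin n)) {fs : ℝ → EuclideanSpace ℝ (Fin n) → ℝ}
    (hs : ∀ h, ContDiff ℝ (⊤ : ℕ∞) (fs h))
    (hb : ∀ (k : ℕ) (r : ℝ), ∃ C, ∀ h, 0 < h → h ≤ 1 → ∀ x, ‖x‖ ≤ r →
      ‖iteratedFDeriv ℝ k (fs h) x‖ ≤ C) (r : ℝ) :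
    ∃ C, ∀ h, 0 < h → h ≤ 1 → ∀ x, ‖x‖ ≤ r → |rDs h l (fs h) x| ≤ C := by
  induction l generalizing fs with
  | nil =>
    obtain ⟨C, hC⟩ := hb 0 r
    refine ⟨C, fun h h0 h1 x hx => ?_⟩
    simpa [rDs] using hC h h0 h1 x hx
  | cons i l ih =>
    refine ih (fs := fun h => rD h i (fs h)) (fun h => contDiff_rD h i (hs h)) fun k r => ?_
    obtain ⟨C, hC⟩ := hb (k + 1) (r + 1)
    refine ⟨C, fun h h0 h1 x hx => ?_⟩
    rw [iteratedFDeriv_rD h i (hs h)]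
    refine norm_rD_le h0 h1 i ?_ (fun y hy => ?_) hx
    · exact (hs h).differentiable_iteratedFDeriv (by exact_mod_cast ENat.natCast_lt_top k)
    · rw [norm_fderiv_iteratedFDeriv]; exact hC h h0 h1 y hy

lemma abs_LD_le {K : ℕ} {t B : ℝ} (l : List (Fin n)) {F : LF n} (h : ∀ x, |F K t x| ≤ B) (x) :
    |LD l F K t x| ≤ B * (2 / gh K) ^ l.length := by
  induction l generalizing F B with
  | nil => simpa [LD] using h x
  | cons i l ih =>
    have h1 : ∀ x, |Yamabe.lD i F K t x| ≤ B * (2 / gh K) := fun x => by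
      have := gh_pos K
      rw [Yamabe.lD, ldiff, abs_div, abs_of_pos this, ← mul_div_assoc]
      gcongr
      have := abs_sub (F K t (x + stp i)) (F K t x)
      linarith [h (x + stp i), h x]
    refine (ih h1).trans (le_of_eq ?_)
    simp only [List.length_cons, pow_succ]
    ring

lemma wt_le_gh {r : ℝ} (hr : 1 ≤ r) {K : ℕ} {x : Grid n ((K + 1) ^ 2)} {j : Fin n}
    (h : r ≤ gh K * |((x j).valMinAbs : ℝ)|) : wt r K x ≤ gh K := by
  have h1 : wt1 r K (x j) = gh K := by
    refine max_eq_left ?_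
    have : 1 ≤ ((x j).valMinAbs.natAbs : ℝ) * gh K / r := by
      rw [le_div_iff₀ (by linarith), one_mul, mul_comm, Nat.cast_natAbs]
      simpa using h
    linarith [gh_pos K]
  rw [wt, ← Finset.mul_prod_erase _ _ (Finset.mem_univ j), h1]
  refine mul_le_of_le_one_right (gh_pos K).le ?_
  exact Finset.prod_le_one (fun i _ => (wt1_pos _).le) fun i _ => wt1_le_one hr _

lemma PM.of_wt_mul_le {F : LF n} (h : ∀ r q : ℝ, 1 ≤ r → 0 ≤ q → ∃ s C : ℝ, 0 ≤ s ∧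
    ∀ K, ∀ t ∈ tI K, ∀ x, wt r K x ^ s * |F K t x| ^ q ≤ C) : PM F := fun r T q hr hq => by
  obtain ⟨s, C, hs, hC⟩ := h r q hr hq
  refine ⟨s + 1, (2 * r + 2) ^ n * |C|, by linarith, fun K t ht _ => ?_⟩
  refine (lsum_mono (g := fun x => |C| * wt r K x ^ (1 : ℝ)) (gh_pos K).le fun x => ?_).trans ?_
  · have p := (isWt_wt hr K).pos x
    rw [Real.rpow_add p, mul_assoc, mul_comm (wt r K x ^ (1 : ℝ)), ← mul_assoc]
    have := (hC K t ht x).trans (le_abs_self C)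
    gcongr
  · rw [lsum_const_mul, mul_comm]
    have := lsum_wt_le (n := n) hr K le_rfl
    gcongr

lemma norm_ipt_le (K : ℕ) (m : Fin n → ℤ) {r : ℝ} (h : ∀ i, gh K * |(m i : ℝ)| ≤ r) (hr : 0 ≤ r) :
    ‖ipt K m‖ ≤ n * r := by
  have h1 : ‖ipt K m‖ ≤ ∑ i, ‖gh K * (m i : ℝ)‖ := by
    rw [EuclideanSpace.norm_eq]
    refine Real.sqrt_le_iff.2 ⟨by positivity, ?_⟩
    simpa [ipt] using Finset.sum_sq_le_sq_sum_of_nonneg (s := Finset.univ)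
      (f := fun i => ‖gh K * (m i : ℝ)‖) fun i _ => norm_nonneg _
  refine h1.trans ((Finset.sum_le_sum (g := fun _ => r) fun i _ => ?_).trans (by simp))
  rw [norm_mul, Real.norm_eq_abs, abs_of_pos (gh_pos K)]
  exact h i

/-- Sampling a smooth bounded function gives a family with controlled difference quotients. -/
lemma CS.smp {f : EuclideanSpace ℝ (Fin n) → ℝ} (hf : ContDiff ℝ (⊤ : ℕ∞) f) {B : ℝ}
    (hB : ∀ x, |f x| ≤ B) (k : ℕ) : CS k (smp f) := by
  intro l _
  refine PM.of_wt_mul_le fun r q hr hq => ?_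
  have hB0 : 0 ≤ B := (abs_nonneg _).trans (hB 0)
  obtain ⟨C, hC⟩ := exists_bound_rDs l (fs := fun _ => f) (fun _ => hf) (fun k r => by
    obtain ⟨C, hC⟩ := (isCompact_closedBall (0 : EuclideanSpace ℝ (Fin n)) r).exists_bound_of_continuousOn
      (hf.continuous_iteratedFDeriv (m := k) (by exact_mod_cast le_top)).continuousOn
    exact ⟨C, fun h _ _ x hx => hC x (by simpa using hx)⟩) (n * r)
  set k := l.length with hk
  set K0 : ℝ := 2 * r + 2 * k + 1 with hK0
  have hK0p : 0 < K0 := by positivity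
  refine ⟨k * q, (B * 2 ^ k) ^ q + |C| ^ q + (B * (2 * K0) ^ k) ^ q, by positivity,
    fun K t ht x => ?_⟩
  have hwp := (isWt_wt hr K).pos x
  have hw1 := (isWt_wt hr K).le_one x
  have hg := gh_pos K
  have crude := abs_LD_le (K := K) (t := t) l (F := Yamabe.smp f) (fun x => hB _) x
  rw [← hk] at crude
  have t1 : 0 ≤ (B * 2 ^ k) ^ q := by positivity
  have t2 : 0 ≤ |C| ^ q := by positivity
  have t3 : 0 ≤ (B * (2 * K0) ^ k) ^ q := by positivity
  have one_side : ∀ D : ℝ, 0 ≤ D → |LD l (Yamabe.smp f) K t x| ≤ D →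
      wt r K x ^ (k * q) * |LD l (Yamabe.smp f) K t x| ^ q ≤ D ^ q := fun D hD h => by
    have h1 := Real.rpow_le_one hwp.le hw1 (show 0 ≤ (k : ℝ) * q by positivity)
    have h2 := Real.rpow_le_rpow (abs_nonneg _) h hq
    calc _ ≤ 1 * D ^ q := by gcongr
      _ = _ := one_mul _
  by_cases hfar : ∃ j, r ≤ gh K * |((x j).valMinAbs : ℝ)|
  · obtain ⟨j, hj⟩ := hfar
    have hw := wt_le_gh hr hj
    have : wt r K x ^ (k * q) * |LD l (Yamabe.smp f) K t x| ^ q ≤ (B * 2 ^ k) ^ q := by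
      rw [Real.rpow_mul hwp.le, ← Real.mul_rpow (by positivity) (abs_nonneg _), Real.rpow_natCast]
      refine Real.rpow_le_rpow (by positivity) ?_ hq
      calc _ ≤ gh K ^ k * (B * (2 / gh K) ^ k) := by gcongr
        _ = _ := by rw [div_pow]; field_simp
    linarith
  · push Not at hfar
    by_cases hKK : (K : ℝ) + 1 < K0
    · have := one_side (B * (2 * K0) ^ k) (by positivity) (crude.trans (by
        have : (gh K)⁻¹ ≤ K0 := by rw [gh, one_div, inv_inv]; exact hKK.le
        rw [div_eq_mul_inv]
        gcongr))
      linarith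
    · push Not at hKK
      have hM : ∀ i, |((x i).valMinAbs : ℝ)| ≤ r * (K + 1) := fun i => by
        have := hfar i
        rw [gh, one_div, inv_mul_lt_iff₀ (by positivity)] at this
        linarith
      have key := LD_gcast (K := K) (t := t) l (F := Yamabe.smp f) (f := f) (L := ⌊r * (K + 1)⌋)
        (fun m hm => by
          rw [Yamabe.smp, pos_gcast fun i => ?_]
          have h1 : ((|m i| : ℤ) : ℝ) ≤ r * (K + 1) + k := by
            have h2 : ((|m i| : ℤ) : ℝ) ≤ ((⌊r * (K + 1)⌋ + k : ℤ) : ℝ) := by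
              exact_mod_cast hm i
            have h3 := Int.floor_le (r * ((K : ℝ) + 1))
            push_cast at h2 ⊢
            linarith
          have h2 : (2 : ℝ) * ((|m i| : ℤ) : ℝ) < ((K : ℝ) + 1) ^ 2 := by
            have h3 : K0 * ((K : ℝ) + 1) ≤ ((K : ℝ) + 1) ^ 2 := by
              rw [sq]; gcongr
            have h4 : 0 ≤ (K : ℝ) * k := by positivity
            have h5 : 0 ≤ (K : ℝ) := by positivity
            rw [hK0] at h3
            linarith
          exact_mod_cast h2) (fun i => (x i).valMinAbs) (fun i => by
            rw [Int.le_floor]; push_cast; exact hM i)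
      rw [gcast_valMinAbs] at key
      have := one_side |C| (abs_nonneg _) (by
        rw [key]
        exact (hC _ hg (gh_le_one K) _ (norm_ipt_le K _ (fun i => (hfar i).le)
          (by linarith))).trans (le_abs_self C))
      linarith

end Static

section ODE

variable {ι : Type*} [Fintype ι]

lemma le_of_deriv_nonpos_above {y y' : ℝ → ℝ} {b T : ℝ}
    (hy : ∀ t ∈ Set.Icc 0 T, HasDerivWithinAt y (y' t) (Set.Icc 0 T) t) (h0 : y 0 ≤ b)
    (hle : ∀ t ∈ Set.Icc 0 T, b ≤ y t → y' t ≤ 0) : ∀ t ∈ Set.Icc 0 T, y t ≤ b := by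
  intro t ht
  refine le_of_forall_pos_le_add fun ε hε => ?_
  have key := image_le_of_deriv_right_lt_deriv_boundary (f := y) (f' := y') (a := 0) (b := T)
    (B := fun τ => b + ε / (1 + T) * τ) (B' := fun _ => ε / (1 + T))
    (fun τ hτ => (hy τ hτ).continuousWithinAt)
    (fun τ hτ => (hy τ ⟨hτ.1, hτ.2.le⟩).mono_of_mem_nhdsWithin ?_) (by simpa using h0)
    (fun τ => (((hasDerivAt_id τ).const_mul _).const_add b).congr_deriv (by simp)) (fun τ hτ e => ?_) ht
  · refine key.trans ?_
    have hT : 0 ≤ T := ht.1.trans ht.2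
    have : ε / (1 + T) * t ≤ ε := by
      rw [div_mul_eq_mul_div, div_le_iff₀ (by linarith)]
      nlinarith [ht.2]
    linarith
  · exact Filter.mem_of_superset (Icc_mem_nhdsGE hτ.2) (Set.Icc_subset_Icc_left hτ.1)
  · have hT : 0 < 1 + T := by linarith [hτ.1, hτ.2]
    have h2 : 0 < ε / (1 + T) := by positivity
    refine (hle τ ⟨hτ.1, hτ.2.le⟩ ?_).trans_lt h2
    rw [e]
    have := mul_nonneg h2.le hτ.1
    linarith

/-- Solutions of an ODE whose field points into a box. -/
lemma exists_solution_in_box {Φ : (ι → ℝ) → ι → ℝ} {lo hi : ι → ℝ} (hlh : lo ≤ hi)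
    (hΦ : ContDiffOn ℝ 1 Φ (Set.Icc lo hi))
    (hhi : ∀ u ∈ Set.Icc lo hi, ∀ x, u x = hi x → Φ u x ≤ 0)
    (hlo : ∀ u ∈ Set.Icc lo hi, ∀ x, u x = lo x → 0 ≤ Φ u x)
    {u₀ : ι → ℝ} (hu₀ : u₀ ∈ Set.Icc lo hi) {T : ℝ} (hT : 0 ≤ T) :
    ∃ u : ℝ → ι → ℝ, u 0 = u₀ ∧ ∀ t ∈ Set.Icc 0 T,
      HasDerivWithinAt u (Φ (u t)) (Set.Icc 0 T) t ∧ u t ∈ Set.Icc lo hi := by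
  obtain ⟨K, hK⟩ := hΦ.exists_lipschitzOnWith one_ne_zero (convex_Icc lo hi) isCompact_Icc
  obtain ⟨L, hL⟩ := isCompact_Icc.exists_bound_of_continuousOn hΦ.continuousOn
  set cl : (ι → ℝ) → ι → ℝ := fun u x => max (lo x) (min (hi x) (u x)) with hcl
  have hclm : ∀ u, cl u ∈ Set.Icc lo hi := fun u =>
    ⟨fun x => le_max_left _ _, fun x => max_le (hlh x) (min_le_left _ _)⟩
  have hcle : ∀ u ∈ Set.Icc lo hi, cl u = u := fun u hu => by
    funext x; simp only [hcl, min_eq_right (hu.2 x), max_eq_right (hu.1 x)]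
  have hcll : LipschitzWith 1 cl := LipschitzWith.of_dist_le_mul fun a b => by
    rw [NNReal.coe_one, one_mul]
    refine (dist_pi_le_iff dist_nonneg).2 fun x => ?_
    refine le_trans ?_ (dist_le_pi_dist a b x)
    simp only [hcl, Real.dist_eq]
    exact (abs_max_sub_max_le_max _ _ _ _).trans (by
      rw [sub_self, abs_zero]
      refine max_le (abs_nonneg _) ((abs_min_sub_min_le_max _ _ _ _).trans ?_)
      rw [sub_self, abs_zero]
      exact max_le (abs_nonneg _) le_rfl)
  have hlip : LipschitzWith (K * 1) (Φ ∘ cl) := by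
    rw [← lipschitzOnWith_univ]
    exact hK.comp hcll.lipschitzOnWith fun u _ => hclm u
  have hPL : IsPicardLindelof (fun _ => Φ ∘ cl) (tmin := 0) (tmax := T) ⟨0, le_rfl, hT⟩ u₀
      (L.toNNReal * T.toNNReal) 0 L.toNNReal (K * 1) := by
    refine IsPicardLindelof.of_time_independent (fun u _ => ?_) hlip.lipschitzOnWith ?_
    · exact (hL _ (hclm u)).trans (Real.le_coe_toNNReal L)
    · simp [hT]
  obtain ⟨u, hu0, hu⟩ := hPL.exists_eq_forall_mem_Icc_hasDerivWithinAt₀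
  have hx : ∀ x, ∀ t ∈ Set.Icc 0 T,
      HasDerivWithinAt (fun τ => u τ x) (Φ (cl (u t)) x) (Set.Icc 0 T) t :=
    fun x t ht => hasDerivWithinAt_pi.1 (hu t ht) x
  have hmem : ∀ t ∈ Set.Icc 0 T, u t ∈ Set.Icc lo hi := by
    intro t ht
    refine ⟨fun x => ?_, fun x => ?_⟩
    · have := le_of_deriv_nonpos_above (y := fun τ => - u τ x) (b := - lo x)
        (fun t ht => (hx x t ht).neg) (by
          have : u 0 = u₀ := hu0
          rw [this]; exact neg_le_neg (hu₀.1 x)) (fun t ht h => ?_) t ht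
      · linarith
      · have := hlo _ (hclm (u t)) x (by
          simp only [hcl]
          rw [max_eq_left]
          exact (min_le_right _ _).trans (by linarith))
        linarith
    · refine le_of_deriv_nonpos_above (y := fun τ => u τ x) (hx x) (by
          have : u 0 = u₀ := hu0
          rw [this]; exact hu₀.2 x) (fun t ht h => ?_) t ht
      refine hhi _ (hclm (u t)) x ?_
      simp only [hcl]
      rw [min_eq_left h, max_eq_right (hlh x)]
  refine ⟨u, hu0, fun t ht => ⟨?_, hmem t ht⟩⟩
  have := hu t ht
  simpa only [Function.comp, hcle _ (hmem t ht)] using this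

end ODE

section Flow

variable {n : ℕ}

lemma llap_const_mul {N : ℕ} (h c : ℝ) (f : Grid n N → ℝ) (x : Grid n N) :
    llap h (fun y => c * f y) x = c * llap h f x := by
  simp only [llap, Finset.mul_sum]
  exact Finset.sum_congr rfl fun i _ => by ring

lemma llap_le_of_touch {N : ℕ} (h : ℝ) {f g : Grid n N → ℝ} (hfg : ∀ y, f y ≤ g y) {x : Grid n N}
    (hx : f x = g x) : llap h f x ≤ llap h g x := by
  refine Finset.sum_le_sum fun i _ => ?_
  rw [hx]
  have := hfg (x + stp i)
  have := hfg (x - stp i)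
  gcongr

/-- Right-hand side of the lattice flow. -/
noncomputable def lfield {N : ℕ} (k₀ α h : ℝ) (R : Grid n N → ℝ) (u : Grid n N → ℝ) :
    Grid n N → ℝ := fun x => k₀ * u x ^ (-α) * (llap h u x - R x * u x)

lemma contDiffOn_lfield {N : ℕ} [NeZero N] (k₀ α h : ℝ) (R : Grid n N → ℝ) :
    ContDiffOn ℝ (⊤ : ℕ∞) (lfield k₀ α h R) {u | ∀ x, 0 < u x} := by
  refine contDiffOn_pi.2 fun x => ?_
  have hx : ∀ y : Grid n N, ContDiff ℝ (⊤ : ℕ∞) fun u : Grid n N → ℝ => u y :=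
    fun y => contDiff_apply ℝ ℝ y
  refine ((contDiffOn_const).mul ((hx x).contDiffOn.rpow_const_of_ne fun u hu => (hu x).ne')).mul ?_
  refine (ContDiff.contDiffOn (ContDiff.sub (ContDiff.sum fun i _ => ?_) (contDiff_const.mul (hx x))))
  exact (((hx _).add (hx _)).sub (contDiff_const.mul (hx x))).div_const _

/-- Lattice approximations of the flow, with all their time derivatives. -/
lemma exists_lattice_flow {α k₀ m M : ℝ} (hk : 0 < k₀) (hm : 0 < m) (hmM : m ≤ M)
    {W U : LF n} (hW : ∀ K t x, W K t x = W K 0 x) (hWp : ∀ K t x, 0 < W K t x)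
    (hU : ∀ K x, m * W K 0 x ≤ U K 0 x ∧ U K 0 x ≤ M * W K 0 x) :
    ∃ V : ℕ → LF n, (∀ j, IsTD (V j) (V (j + 1))) ∧ (∀ K x, V 0 K 0 x = U K 0 x) ∧
      (∀ K, ∀ t ∈ tI K, ∀ x, m * W K t x ≤ V 0 K t x ∧ V 0 K t x ≤ M * W K t x) ∧
      (∀ K, ∀ t ∈ tI K, ∀ x, V 0 K t x ^ α * V 1 K t x =
        k₀ * (lL (V 0) K t x - lL W K t x / W K t x * V 0 K t x)) := by
  have key : ∀ K, ∃ u : ℝ → Grid n ((K + 1) ^ 2) → ℝ, u 0 = U K 0 ∧ ∀ t ∈ tI K,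
      HasDerivWithinAt u (lfield k₀ α (gh K) (fun x => lL W K 0 x / W K 0 x) (u t)) (tI K) t ∧
      u t ∈ Set.Icc (fun x => m * W K 0 x) (fun x => M * W K 0 x) := by
    intro K
    have hM : 0 < M := hm.trans_le hmM
    have hpos : ∀ u ∈ Set.Icc (fun x => m * W K 0 x) (fun x => M * W K 0 x), ∀ x, 0 < u x :=
      fun u hu x => (mul_pos hm (hWp K 0 x)).trans_le (hu.1 x)
    refine exists_solution_in_box (fun x => mul_le_mul_of_nonneg_right hmM (hWp K 0 x).le)
      (((contDiffOn_lfield k₀ α _ _).mono hpos).of_le (by exact_mod_cast le_top))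
      (fun u hu x hx => ?_) (fun u hu x hx => ?_) ⟨fun x => (hU K x).1, fun x => (hU K x).2⟩
      (by positivity)
    · have h1 := llap_le_of_touch (gh K) hu.2 hx
      rw [llap_const_mul] at h1
      refine mul_nonpos_of_nonneg_of_nonpos ?_ ?_
      · have := Real.rpow_pos_of_pos (hpos u hu x) (-α); positivity
      · rw [hx]
        have := (hWp K 0 x).ne'
        have e : lL W K 0 x / W K 0 x * (M * W K 0 x) = M * lL W K 0 x := by field_simp
        rw [e]
        simp only [lL]
        linarith
    · have h1 := llap_le_of_touch (gh K) hu.1 hx.symm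
      rw [llap_const_mul] at h1
      refine mul_nonneg ?_ ?_
      · have := Real.rpow_pos_of_pos (hpos u hu x) (-α); positivity
      · rw [hx]
        have := (hWp K 0 x).ne'
        have e : lL W K 0 x / W K 0 x * (m * W K 0 x) = m * lL W K 0 x := by field_simp
        rw [e]
        simp only [lL]
        linarith
  choose u hu0 hu using key
  have hlt : ∀ K : ℕ, (0 : ℝ) < (K : ℝ) + 1 := fun K => by positivity
  have hpos : ∀ K, ∀ t ∈ tI K, ∀ x, 0 < u K t x := fun K t ht x =>
    (mul_pos hm (hWp K 0 x)).trans_le ((hu K t ht).2.1 x)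
  have hsm : ∀ K x, ContDiffOn ℝ (⊤ : ℕ∞) (fun τ => u K τ x) (tI K) := fun K =>
    contDiffOn_pi.1 (ODE.contDiffOn_enat_Icc_of_hasDerivWithinAt (n := ⊤)
      (f := fun _ => lfield k₀ α (gh K) (fun x => lL W K 0 x / W K 0 x)) (u := {u | ∀ x, 0 < u x})
      ((contDiffOn_lfield k₀ α _ _).comp contDiffOn_snd fun p hp => hp.2)
      (fun t ht => (hu K t ht).1) fun t ht => hpos K t ht)
  have hud : ∀ K, UniqueDiffOn ℝ (tI K) := fun K => uniqueDiffOn_Icc (hlt K)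
  refine ⟨fun j K t x => iteratedDerivWithin j (fun τ => u K τ x) (tI K) t, fun j K t ht x => ?_,
    fun K x => ?_, fun K t ht x => ?_, fun K t ht x => ?_⟩
  · simp only [iteratedDerivWithin_succ]
    exact ((hsm K x).differentiableOn_iteratedDerivWithin
      (by exact_mod_cast ENat.natCast_lt_top j) (hud K) t ht).hasDerivWithinAt
  · simp [hu0]
  · rw [hW K t x]
    simpa using ⟨(hu K t ht).2.1 x, (hu K t ht).2.2 x⟩
  · have h1 := (hasDerivWithinAt_pi.1 (hu K t ht).1 x).derivWithin (hud K t ht)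
    have hW' : W K t = W K 0 := funext fun y => hW K t y
    simp only [iteratedDerivWithin_zero, iteratedDerivWithin_one, h1, lL, lfield, hW']
    have h2 := Real.rpow_pos_of_pos (hpos K t ht x) α
    rw [Real.rpow_neg (hpos K t ht x).le]
    field_simp

end Flow

section Calculus

variable {n : ℕ} {F F' G G' : LF n}

lemma IsTD.congr (hG : IsTD G F') (h : ∀ K, ∀ t ∈ tI K, ∀ x, F K t x = G K t x) : IsTD F F' :=
  fun K t ht x => (hG K t ht x).congr_of_mem (fun τ hτ => h K τ hτ x) ht

lemma IsTD.congr_deriv (hF : IsTD F G) (h : ∀ K, ∀ t ∈ tI K, ∀ x, G K t x = G' K t x) :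
    IsTD F G' := fun K t ht x => (hF K t ht x).congr_deriv (h K t ht x)

lemma IsTD.unique (hF : IsTD F F') (hG : IsTD G G') (h : ∀ K, ∀ t ∈ tI K, ∀ x, F K t x = G K t x) :
    ∀ K, ∀ t ∈ tI K, ∀ x, F' K t x = G' K t x := fun K t ht x =>
  (uniqueDiffOn_Icc (show (0 : ℝ) < (K : ℝ) + 1 by positivity) t ht).eq_deriv _ (hF K t ht x)
    (hG.congr h K t ht x)

lemma IsTD.const (c : ℝ) : IsTD (n := n) (fun _ _ _ => c) fun _ _ _ => 0 :=
  fun _ _ _ _ => hasDerivWithinAt_const _ _ _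

lemma IsTD.add (hF : IsTD F F') (hG : IsTD G G') :
    IsTD (fun K t x => F K t x + G K t x) fun K t x => F' K t x + G' K t x :=
  fun K t ht x => (hF K t ht x).add (hG K t ht x)

lemma IsTD.const_mul (hF : IsTD F F') (c : ℝ) :
    IsTD (fun K t x => c * F K t x) fun K t x => c * F' K t x :=
  fun K t ht x => (hF K t ht x).const_mul c

lemma IsTD.lD (hF : IsTD F F') (i : Fin n) : IsTD (lD i F) (lD i F') :=
  fun K t ht x => ((hF K t ht (x + stp i)).sub (hF K t ht x)).div_const _

lemma IsTD.lL (hF : IsTD F F') : IsTD (lL F) (lL F') := fun K t ht x => by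
  simp only [Yamabe.lL, llap]
  exact HasDerivWithinAt.fun_sum fun i _ => (((hF K t ht (x + stp i)).fun_add
    (hF K t ht (x - stp i))).fun_sub ((hF K t ht x).const_mul 2)).div_const _

lemma CS.rpow_four_div {m M α : ℝ} {d k : ℕ} (hd : 0 < d) (hα : α * d = 4) (hm : 0 < m)
    (h0 : ∀ K, ∀ t ∈ tI K, ∀ x, m ≤ F K t x) (h1 : ∀ K, ∀ t ∈ tI K, ∀ x, F K t x ≤ M)
    (hF : CS k F) : CS k fun K t x => F K t x ^ α := by
  have hd' : (d : ℝ) ≠ 0 := by positivity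
  have hp : ∀ K, ∀ t ∈ tI K, ∀ x, 0 < F K t x := fun K t ht x => hm.trans_le (h0 K t ht x)
  have hr : CS k fun K t x => F K t x ^ (1 / (d : ℝ)) := by
    refine CS.root (c := m ^ (1 / (d : ℝ))) (B := M ^ (1 / (d : ℝ))) hd (by positivity)
      (fun K t ht x => ?_) (fun K t ht x => ?_) (hF.congr fun K t ht x => ?_)
    · have := h0 K t ht x
      gcongr
    · have := h1 K t ht x
      have := hp K t ht x
      gcongr
    · rw [← Real.rpow_natCast, ← Real.rpow_mul (hp K t ht x).le, one_div, inv_mul_cancel₀ hd',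
        Real.rpow_one]
  refine (hr.pow 4).congr fun K t ht x => ?_
  rw [← Real.rpow_natCast, ← Real.rpow_mul (hp K t ht x).le]
  congr 1
  field_simp
  rw [hα]; norm_num

end Calculus

/-- Solutions of the lattice flow with their time derivatives. -/
structure LatFlow {n : ℕ} (α k₀ m M : ℝ) (R : LF n) (V : ℕ → LF n) : Prop where
  td : ∀ j, IsTD (V j) (V (j + 1))
  le : ∀ K, ∀ t ∈ tI K, ∀ x, m ≤ V 0 K t x
  ge : ∀ K, ∀ t ∈ tI K, ∀ x, V 0 K t x ≤ M
  eqn : ∀ K, ∀ t ∈ tI K, ∀ x, V 0 K t x ^ α * V 1 K t x =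
    k₀ * (lL (V 0) K t x - R K t x * V 0 K t x)
  stat : IsTD R fun _ _ _ => 0

/-- Polynomial expressions in the data and the time derivatives up to order `m`. -/
inductive Gen {n : ℕ} (P Q R : LF n) (V : ℕ → LF n) (m : ℕ) : LF n → Prop
  | const (c : ℝ) : Gen P Q R V m fun _ _ _ => c
  | left : Gen P Q R V m P
  | right : Gen P Q R V m Q
  | coef : Gen P Q R V m R
  | deriv (j : ℕ) (hj : j ≤ m) : Gen P Q R V m (V j)
  | add {F G : LF n} : Gen P Q R V m F → Gen P Q R V m G →
      Gen P Q R V m fun K t x => F K t x + G K t x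
  | mul {F G : LF n} : Gen P Q R V m F → Gen P Q R V m G →
      Gen P Q R V m fun K t x => F K t x * G K t x

section Gen

variable {n : ℕ} {P Q R : LF n} {V : ℕ → LF n} {m m' : ℕ} {F G : LF n} {α : ℝ}

lemma Gen.mono (h : Gen P Q R V m F) (hm : m ≤ m') : Gen P Q R V m' F := by
  induction h with
  | const c => exact .const c
  | left => exact .left
  | right => exact .right
  | coef => exact .coef
  | deriv j hj => exact .deriv j (hj.trans hm)
  | add _ _ h1 h2 => exact h1.add h2
  | mul _ _ h1 h2 => exact h1.mul h2

lemma Gen.mem {p : LF n → Prop} (h : Gen P Q R V m F) (hc : ∀ c : ℝ, p fun _ _ _ => c) (hP : p P)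
    (hQ : p Q) (hR : p R) (hV : ∀ j ≤ m, p (V j))
    (ha : ∀ F G, p F → p G → p fun K t x => F K t x + G K t x)
    (hm : ∀ F G, p F → p G → p fun K t x => F K t x * G K t x) : p F := by
  induction h with
  | const c => exact hc c
  | left => exact hP
  | right => exact hQ
  | coef => exact hR
  | deriv j hj => exact hV j hj
  | add _ _ h1 h2 => exact ha _ _ h1 h2
  | mul _ _ h1 h2 => exact hm _ _ h1 h2

/-- The time derivative is affine in the highest order term. -/
lemma Gen.exists_td (hP : IsTD P fun K t x => α * (P K t x * Q K t x) * V 1 K t x)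
    (hQ : IsTD Q fun K t x => -1 * (Q K t x * Q K t x) * V 1 K t x) (hR : IsTD R fun _ _ _ => 0)
    (hV : ∀ j, IsTD (V j) (V (j + 1))) (h : Gen P Q R V m F) :
    ∃ F₁ F₀, Gen P Q R V m F₁ ∧ Gen P Q R V m F₀ ∧
      IsTD F fun K t x => F₁ K t x * V (m + 1) K t x + F₀ K t x := by
  have one : ∀ {F C : LF n}, Gen P Q R V m C → IsTD F (fun K t x => C K t x * V 1 K t x) →
      ∃ F₁ F₀, Gen P Q R V m F₁ ∧ Gen P Q R V m F₀ ∧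
      IsTD F fun K t x => F₁ K t x * V (m + 1) K t x + F₀ K t x := by
    intro F C hC hF
    rcases Nat.eq_zero_or_pos m with rfl | hm
    · exact ⟨C, _, hC, .const 0, by simpa using hF⟩
    · exact ⟨_, _, .const 0, hC.mul (.deriv 1 hm), by simpa using hF⟩
  induction h with
  | const c => exact ⟨_, _, .const 0, .const 0, by simpa using IsTD.const c⟩
  | left => exact one ((Gen.const α).mul (Gen.left.mul .right)) hP
  | right => exact one ((Gen.const (-1)).mul (Gen.right.mul .right)) hQ
  | coef => exact ⟨_, _, .const 0, .const 0, by simpa using hR⟩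
  | deriv j hj =>
    rcases hj.eq_or_lt with rfl | hj
    · exact ⟨_, _, .const 1, .const 0, by simpa using hV j⟩
    · exact ⟨_, _, .const 0, .deriv (j + 1) hj, by simpa using hV j⟩
  | add _ _ h1 h2 =>
    obtain ⟨A, B, hA, hB, h⟩ := h1
    obtain ⟨A', B', hA', hB', h'⟩ := h2
    exact ⟨_, _, hA.add hA', hB.add hB', (h.add h').congr_deriv fun K t _ x => by ring⟩
  | mul hF hG h1 h2 =>
    obtain ⟨A, B, hA, hB, h⟩ := h1
    obtain ⟨A', B', hA', hB', h'⟩ := h2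
    exact ⟨_, _, (hA.mul hG).add (hF.mul hA'), (hB.mul hG).add (hF.mul hB'),
      (h.mul h').congr_deriv fun K t _ x => by ring⟩

end Gen

section Flow

variable {n : ℕ} {α k₀ m M : ℝ} {R : LF n} {V : ℕ → LF n}

lemma LatFlow.pos (h : LatFlow α k₀ m M R V) (hm : 0 < m) : ∀ K, ∀ t ∈ tI K, ∀ x, 0 < V 0 K t x :=
  fun K t ht x => hm.trans_le (h.le K t ht x)

lemma LatFlow.td_rpow (h : LatFlow α k₀ m M R V) (hm : 0 < m) :
    IsTD (fun K t x => V 0 K t x ^ α)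
      fun K t x => α * (V 0 K t x ^ α * (V 0 K t x)⁻¹) * V 1 K t x := fun K t ht x => by
  have hp := h.pos hm K t ht x
  refine ((h.td 0 K t ht x).rpow_const (Or.inl hp.ne')).congr_deriv ?_
  rw [Real.rpow_sub_one hp.ne']
  field_simp

lemma LatFlow.td_inv (h : LatFlow α k₀ m M R V) (hm : 0 < m) :
    IsTD (fun K t x => (V 0 K t x)⁻¹)
      fun K t x => -1 * ((V 0 K t x)⁻¹ * (V 0 K t x)⁻¹) * V 1 K t x := fun K t ht x => by
  have hp := h.pos hm K t ht x
  refine ((h.td 0 K t ht x).inv hp.ne').congr_deriv ?_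
  field_simp

/-- Equations for the higher time derivatives. -/
lemma LatFlow.exists_eqn (h : LatFlow α k₀ m M R V) (hm : 0 < m) (j : ℕ) :
    ∃ H F₁ F₀ : LF n,
      Gen (fun K t x => V 0 K t x ^ α) (fun K t x => (V 0 K t x)⁻¹) R V j H ∧
      Gen (fun K t x => V 0 K t x ^ α) (fun K t x => (V 0 K t x)⁻¹) R V j F₁ ∧
      Gen (fun K t x => V 0 K t x ^ α) (fun K t x => (V 0 K t x)⁻¹) R V j F₀ ∧
      (∀ K, ∀ t ∈ tI K, ∀ x, V 0 K t x ^ α * V (j + 1) K t x =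
        k₀ * lL (V j) K t x + H K t x) ∧
      (∀ K, ∀ t ∈ tI K, ∀ x, V 0 K t x ^ α * V (j + 2) K t x =
        k₀ * lL (V (j + 1)) K t x + (F₁ K t x + -α * (V 0 K t x ^ α * (V 0 K t x)⁻¹) * V 1 K t x) *
          V (j + 1) K t x + F₀ K t x) := by
  have step : ∀ j H, Gen (fun K t x => V 0 K t x ^ α) (fun K t x => (V 0 K t x)⁻¹) R V j H →
      (∀ K, ∀ t ∈ tI K, ∀ x, V 0 K t x ^ α * V (j + 1) K t x = k₀ * lL (V j) K t x + H K t x) →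
      ∃ F₁ F₀ : LF n,
      Gen (fun K t x => V 0 K t x ^ α) (fun K t x => (V 0 K t x)⁻¹) R V j F₁ ∧
      Gen (fun K t x => V 0 K t x ^ α) (fun K t x => (V 0 K t x)⁻¹) R V j F₀ ∧
      (∀ K, ∀ t ∈ tI K, ∀ x, V 0 K t x ^ α * V (j + 2) K t x =
        k₀ * lL (V (j + 1)) K t x + (F₁ K t x + -α * (V 0 K t x ^ α * (V 0 K t x)⁻¹) * V 1 K t x) *
          V (j + 1) K t x + F₀ K t x) := by
    intro j H hH e
    obtain ⟨F₁, F₀, h1, h0, hd⟩ := hH.exists_td (h.td_rpow hm) (h.td_inv hm) h.stat h.td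
    refine ⟨F₁, F₀, h1, h0, fun K t ht x => ?_⟩
    have := IsTD.unique ((h.td_rpow hm).mul (h.td (j + 1)))
      (((h.td j).lL.const_mul k₀).add hd) e K t ht x
    linear_combination this
  suffices hs : ∃ H, Gen (fun K t x => V 0 K t x ^ α) (fun K t x => (V 0 K t x)⁻¹) R V j H ∧
      ∀ K, ∀ t ∈ tI K, ∀ x, V 0 K t x ^ α * V (j + 1) K t x = k₀ * lL (V j) K t x + H K t x by
    obtain ⟨H, hH, e⟩ := hs
    obtain ⟨F₁, F₀, h1, h0, e'⟩ := step j H hH e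
    exact ⟨H, F₁, F₀, hH, h1, h0, e, e'⟩
  induction j with
  | zero =>
    refine ⟨_, (Gen.const (-k₀)).mul (Gen.coef.mul (.deriv 0 le_rfl)), fun K t ht x => ?_⟩
    have := h.eqn K t ht x
    linear_combination this
  | succ j ih =>
    obtain ⟨H, hH, e⟩ := ih
    obtain ⟨F₁, F₀, h1, h0, e'⟩ := step j H hH e
    refine ⟨_, (((h1.mono j.le_succ).add (((Gen.const (-α)).mul (Gen.left.mul .right)).mul
      (.deriv 1 (by omega)))).mul (.deriv (j + 1) le_rfl)).add (h0.mono j.le_succ),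
      fun K t ht x => ?_⟩
    have := e' K t ht x
    linear_combination this

end Flow

section Flow

variable {n : ℕ} {α k₀ m M : ℝ} {R : LF n} {V : ℕ → LF n}

lemma IsTD.const_in_time {F : LF n} (h : IsTD F fun _ _ _ => 0) :
    ∀ K, ∀ t ∈ tI K, ∀ x, F K t x = F K 0 x := fun K t ht x => by
  have := constant_of_has_deriv_right_zero (f := fun τ => F K τ x) (a := 0) (b := (K : ℝ) + 1)
    (fun τ hτ => (h K τ hτ x).continuousWithinAt)
    (fun τ hτ => (h K τ ⟨hτ.1, hτ.2.le⟩ x).mono_of_mem_nhdsWithin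
      (Filter.mem_of_superset (Icc_mem_nhdsGE hτ.2) (Set.Icc_subset_Icc_left hτ.1)))
  exact this t ht

lemma LatFlow.cs_rpow (h : LatFlow α k₀ m M R V) (hn : 3 ≤ n) (hα : α * ((n : ℝ) - 2) = 4)
    (hm : 0 < m) {k : ℕ} (h0 : CS k (V 0)) : CS k fun K t x => V 0 K t x ^ α := by
  refine CS.rpow_four_div (d := n - 2) (by omega) ?_ hm h.le h.ge h0
  rw [Nat.cast_sub (by omega)]
  exact_mod_cast hα

lemma LatFlow.cs_inv (h : LatFlow α k₀ m M R V) (hm : 0 < m) {k : ℕ} (h0 : CS k (V 0)) :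
    CS k fun K t x => (V 0 K t x)⁻¹ := h0.inv hm h.le

lemma LatFlow.rpow_bounds (h : LatFlow α k₀ m M R V) (hα : 0 < α) (hm : 0 < m) :
    ∀ K, ∀ t ∈ tI K, ∀ x, m ^ α ≤ V 0 K t x ^ α ∧ V 0 K t x ^ α ≤ M ^ α := fun K t ht x => by
  have h0 := h.le K t ht x
  have h1 := h.ge K t ht x
  have := h.pos hm K t ht x
  constructor <;> gcongr

/-- Regularity of the time derivatives at the initial time. -/
lemma LatFlow.cs_frz (h : LatFlow α k₀ m M R V) (hn : 3 ≤ n) (hα : α * ((n : ℝ) - 2) = 4)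
    (hα0 : 0 < α) (hm : 0 < m) (hR : ∀ k, CS k R) (h0 : ∀ k, CS k (frz (V 0))) (j : ℕ) :
    ∀ k, CS k (frz (V j)) := by
  have hle : ∀ K, ∀ t ∈ tI K, ∀ x, m ≤ frz (V 0) K t x := fun K _ _ x => h.le K 0 (zero_mem_tI K) x
  have hge : ∀ K, ∀ t ∈ tI K, ∀ x, frz (V 0) K t x ≤ M := fun K _ _ x => h.ge K 0 (zero_mem_tI K) x
  have hP : ∀ k, CS k (frz fun K t x => V 0 K t x ^ α) := fun k => by
    refine CS.rpow_four_div (d := n - 2) (by omega) ?_ hm hle hge (h0 k)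
    rw [Nat.cast_sub (by omega)]
    exact_mod_cast hα
  have hQ : ∀ k, CS k (frz fun K t x => (V 0 K t x)⁻¹) := fun k => (h0 k).inv hm hle
  have hRf : ∀ k, CS k (frz R) := fun k => (hR k).congr fun K t ht x =>
    (h.stat.const_in_time K t ht x).symm
  induction j using Nat.strong_induction_on with
  | _ j ih =>
    rcases j with _ | j
    · exact h0
    · intro k
      obtain ⟨H, -, -, hH, -, -, e, -⟩ := h.exists_eqn hm j
      have hHf : ∀ k, CS k (frz H) := fun k => hH.mem (p := fun F => CS k (frz F))
        (fun c => CS.const c) (hP k) (hQ k) (hRf k) (fun i hi => ih i (by omega) k)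
        (fun F G hF hG => hF.add hG) (fun F G hF hG => hF.mul hG)
      have hPi := (hP k).inv (Real.rpow_pos_of_pos hm α)
        fun K _ _ x => (h.rpow_bounds hα0 hm K 0 (zero_mem_tI K) x).1
      refine (hPi.mul ((((ih j j.lt_succ_self (k + 2)).lL).const_mul k₀).add (hHf k))).congr
        fun K t ht x => ?_
      have e1 := e K 0 (zero_mem_tI K) x
      have := Real.rpow_pos_of_pos (h.pos hm K 0 (zero_mem_tI K) x) α
      simp only [frz]
      change _ = (V 0 K 0 x ^ α)⁻¹ * (k₀ * Yamabe.lL (V j) K 0 x + H K 0 x)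
      rw [← e1]
      field_simp

/-- Moment bounds for the velocity. -/
lemma LatFlow.pm_one (h : LatFlow α k₀ m M R V) (hn : 3 ≤ n) (hα : α * ((n : ℝ) - 2) = 4)
    (hα0 : 0 < α) (hk : 0 < k₀) (hm : 0 < m) (hmM : m ≤ M) (hR : ∀ k, CS k R)
    (h0 : ∀ k, CS k (frz (V 0))) : PM (V 1) := by
  have hM : 0 < M := hm.trans_le hmM
  have hfrz := h.cs_frz hn hα hα0 hm hR h0
  have hu := h.pos hm
  have hPp : ∀ K, ∀ t ∈ tI K, ∀ x, 0 < V 0 K t x ^ α := fun K t ht x =>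
    Real.rpow_pos_of_pos (hu K t ht x) α
  have d1 := IsTD.unique ((h.td_rpow hm).mul (h.td 1))
    (((h.td 0).lL.add ((h.stat.mul (h.td 0)).const_mul (-1))).const_mul k₀)
    fun K t ht x => by rw [h.eqn K t ht x]; ring
  set z : LF n := fun K t x => (V 0 K t x)⁻¹ * V 1 K t x with hz
  have hzu : ∀ K, ∀ t ∈ tI K, ∀ x, z K t x * V 0 K t x = V 1 K t x := fun K t ht x => by
    have := (hu K t ht x).ne'
    simp only [hz]; field_simp
  have hzu' : ∀ K, ∀ t ∈ tI K, (fun x => z K t x * V 0 K t x) = V 1 K t := fun K t ht =>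
    funext fun x => hzu K t ht x
  have hPb := h.rpow_bounds hα0 hm
  intro r T q hr hq
  obtain ⟨q₀, hq₀, hzq⟩ := exists_bd_velocity (a := fun K t x => V 0 K t x ^ α) (u := V 0) (z := z)
    (zt := fun K t x => -1 * ((V 0 K t x)⁻¹ * (V 0 K t x)⁻¹) * V 1 K t x * V 1 K t x +
      (V 0 K t x)⁻¹ * V 2 K t x) (R := R) (α := α) (a₀ := m ^ α) (a₁ := M ^ α) (m := m) (M := M)
    hn hα hm hmM (by positivity) (by gcongr) hk h.le h.ge (fun K t ht x => (hPb K t ht x).1)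
    (fun K t ht x => (hPb K t ht x).2)
    (fun K t ht x => by
      have := h.eqn K t ht x
      rw [mul_assoc, mul_comm (V 0 K t x), hzu K t ht x]
      exact this)
    (fun K t ht x => by
      have e1 := h.eqn K t ht x
      have e2 := d1 K t ht x
      have hp := (hu K t ht x).ne'
      rw [hzu' K t ht, hzu K t ht x]
      simp only [lL, hz] at e1 e2 ⊢
      field_simp at e1 e2 ⊢
      linear_combination e2 - V 1 K t x * e1)
    (by
      refine ((h.td_rpow hm).mul ((h.td 0).mul (h.td 0))).congr (fun K t ht x => ?_)
        |>.congr_deriv fun K t ht x => ?_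
      · ring
      · have hp := (hu K t ht x).ne'
        simp only [hz]
        field_simp
        ring)
    ((h.td_inv hm).mul (h.td 1)) (hR 0).pm
    (((h0 0).inv hm fun K _ _ x => h.le K 0 (zero_mem_tI K) x).mul (hfrz 1 0)).pm hr T
  have hn' : (3 : ℝ) ≤ n := by exact_mod_cast hn
  have hq₀0 : 0 ≤ q₀ := by linarith
  have scale : ∀ {F G : LF n} (c : ℝ), 0 ≤ c → Bd r T q₀ G →
      (∀ K, ∀ t ∈ tI K, ∀ x, |F K t x| ≤ c * |G K t x|) → Bd r T q₀ F := by
    intro F G c hc hG hFG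
    refine Bd.of_le hr hG (c ^ q₀) fun K t ht _ x => ?_
    have h1 := Real.rpow_le_rpow (abs_nonneg _) (hFG K t ht x) hq₀0
    rw [Real.mul_rpow hc (abs_nonneg _)] at h1
    have := Real.rpow_nonneg hc q₀
    linarith
  have hV1 : Bd r T q₀ (V 1) := scale M hM.le hzq fun K t ht x => by
    rw [← hzu K t ht x, abs_mul, abs_of_pos (hu K t ht x), mul_comm]
    have := h.ge K t ht x
    gcongr
  have hA' : Bd r T q₀ (fun K t x => α * (V 0 K t x ^ α * (V 0 K t x)⁻¹) * V 1 K t x) :=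
    scale (α * M ^ α) (by positivity) hzq fun K t ht x => by
      have e : α * (V 0 K t x ^ α * (V 0 K t x)⁻¹) * V 1 K t x = α * V 0 K t x ^ α * z K t x := by
        simp only [hz]; ring
      rw [e, abs_mul, abs_of_pos (mul_pos hα0 (hPp K t ht x))]
      have := (hPb K t ht x).2
      gcongr
  have hE₁ : Bd r T q₀ (fun K t x => - (k₀ * R K t x) -
      α * (V 0 K t x ^ α * (V 0 K t x)⁻¹) * V 1 K t x) := by
    refine scale 1 zero_le_one ((((hR 0).pm.const_mul k₀) r T q₀ hr hq₀0).add hr hq₀0 hA')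
      fun K t ht x => ?_
    rw [one_mul, abs_of_nonneg (by positivity : 0 ≤ |k₀ * R K t x| +
      |α * (V 0 K t x ^ α * (V 0 K t x)⁻¹) * V 1 K t x|)]
    refine (abs_sub _ _).trans ?_
    rw [abs_neg]
  refine (bd_of_parabolic hn hr hk (by positivity) (h.td_rpow hm) (h.td 1)
    (fun K t ht x => (hPb K t ht x).1) (fun K t ht x => (hPb K t ht x).2)
    (E₀ := fun _ _ _ => 0) (fun K t ht x => ?_) (p := q + 2) (p₀ := q₀) (q₀ := q₀) (by linarith)
    (by linarith) hq₀ hV1 hA' hE₁ (PM.const 0 r T q₀ hr hq₀0)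
    ((hfrz 1 0).pm r T (q + 2) hr (by linarith))).of_exp_le hr hq (by linarith)
  have := d1 K t ht x
  simp only [lL] at this
  linear_combination this

/-- All difference quotients of all time derivatives are controlled. -/
theorem LatFlow.cs (h : LatFlow α k₀ m M R V) (hn : 3 ≤ n) (hα : α * ((n : ℝ) - 2) = 4)
    (hα0 : 0 < α) (hk : 0 < k₀) (hm : 0 < m) (hmM : m ≤ M) (hR : ∀ k, CS k R)
    (h0 : ∀ k, CS k (frz (V 0))) (k : ℕ) : ∀ j, CS k (V j) := by
  have hM : 0 < M := hm.trans_le hmM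
  have hfrz := h.cs_frz hn hα hα0 hm hR h0
  have hPb := h.rpow_bounds hα0 hm
  have hu := h.pos hm
  induction k with
  | zero =>
    have b0 : PM (V 0) := PM.of_bounded M fun K t ht x => by
      rw [abs_of_pos (hu K t ht x)]; exact h.ge K t ht x
    have b1 := h.pm_one hn hα hα0 hk hm hmM hR h0
    have bP : PM fun K t x => V 0 K t x ^ α :=
      (h.cs_rpow hn hα hm (cs_zero_iff.2 b0)).pm
    have bQ : PM fun K t x => (V 0 K t x)⁻¹ := (h.cs_inv hm (cs_zero_iff.2 b0)).pm
    intro j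
    rw [cs_zero_iff]
    induction j using Nat.strong_induction_on with
    | _ j ih =>
      rcases j with _ | _ | j
      · exact b0
      · exact b1
      · obtain ⟨H, F₁, F₀, hH, h1, h0, e, -⟩ := h.exists_eqn hm (j + 1)
        obtain ⟨-, G₁, G₀, -, g1, g0, -, e'⟩ := h.exists_eqn hm (j + 1)
        have mem : ∀ {F}, Gen (fun K t x => V 0 K t x ^ α) (fun K t x => (V 0 K t x)⁻¹) R V (j + 1) F →
            PM F := fun hF => hF.mem (p := PM) (fun c => PM.const c) bP bQ (hR 0).pm
          (fun i hi => ih i (by omega)) (fun F G hF hG => hF.add hG) (fun F G hF hG => hF.mul hG)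
        exact PM.of_parabolic hn hk (a₀ := m ^ α) (a₁ := M ^ α) (by positivity) (by gcongr)
          (h.td_rpow hm) (h.td (j + 2)) (fun K t ht x => (hPb K t ht x).1)
          (fun K t ht x => (hPb K t ht x).2) (fun K t ht x => e K t ht x)
          (fun K t ht x => e' K t ht x) (ih (j + 1) (by omega)) (mem hH)
          ((mem ((Gen.const α).mul (Gen.left.mul .right))).mul b1)
          ((mem g1).add ((mem ((Gen.const (-α)).mul (Gen.left.mul .right))).mul b1)) (mem g0)
          (hfrz (j + 2) 0).pm
  | succ k ih =>
    have cP := h.cs_rpow hn hα hm (ih 0)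
    have cQ := h.cs_inv hm (ih 0)
    intro j
    obtain ⟨H, -, -, hH, -, -, e, -⟩ := h.exists_eqn hm j
    have cH : CS k H := hH.mem (p := CS k) (fun c => CS.const c) cP cQ (hR k)
      (fun i _ => ih i) (fun F G hF hG => hF.add hG) (fun F G hF hG => hF.mul hG)
    refine CS.succ_of_lL hn (ih j) (((((cP.mul (ih (j + 1))).add (cH.const_mul (-1))).const_mul
      k₀⁻¹)).congr fun K t ht x => ?_)
    have := e K t ht x
    rw [this]
    field_simp
    ring

end Flow

/-- Riemann sum over the coordinates in `S`, the other coordinates being frozen. -/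
noncomputable def psum {n N : ℕ} [NeZero N] (h : ℝ) (S : Finset (Fin n)) (f : Grid n N → ℝ)
    (x : Grid n N) : ℝ :=
  h ^ S.card * ∑ y with ∀ j ∉ S, y j = x j, f y

section PartialSum

variable {n N : ℕ} [NeZero N] {h : ℝ} {S : Finset (Fin n)} {f g : Grid n N → ℝ}

lemma psum_mono (hh : 0 ≤ h) (hfg : ∀ y, f y ≤ g y) (x : Grid n N) :
    psum h S f x ≤ psum h S g x :=
  mul_le_mul_of_nonneg_left (Finset.sum_le_sum fun y _ => hfg y) (by positivity)

lemma psum_const_mul (c : ℝ) (x : Grid n N) :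
    psum h S (fun y => c * f y) x = c * psum h S f x := by
  simp only [psum, ← Finset.mul_sum]; ring

lemma psum_add (x : Grid n N) :
    psum h S (fun y => f y + g y) x = psum h S f x + psum h S g x := by
  simp only [psum, Finset.sum_add_distrib, mul_add]

lemma psum_empty (x : Grid n N) : psum h ∅ f x = f x := by
  have : (Finset.univ.filter fun y : Grid n N => ∀ j ∉ (∅ : Finset (Fin n)), y j = x j) = {x} := by
    ext y; simp [funext_iff]
  rw [psum, this]; simp

lemma psum_univ (x : Grid n N) : psum h Finset.univ f x = lsum h f := by
  simp [psum, lsum]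

lemma psum_line {i : Fin n} (hi : i ∉ S) (x : Grid n N) :
    psum h S (fun y => h * ∑ t, f (Function.update y i t)) x = psum h (insert i S) f x := by
  simp only [psum, Finset.card_insert_of_notMem hi, pow_succ, mul_assoc, ← Finset.mul_sum]
  congr 2
  rw [← Finset.sum_product']
  refine Finset.sum_nbij' (fun p => Function.update p.1 i p.2)
    (fun z => (Function.update z i (x i), z i)) ?_ ?_ ?_ ?_ ?_
  · rintro ⟨y, t⟩ h
    simp only [Finset.mem_product, Finset.mem_filter, Finset.mem_univ, true_and, and_true,
      Finset.mem_insert, not_or] at h ⊢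
    intro j hj
    rw [Function.update_of_ne hj.1, h j hj.2]
  · intro z h
    simp only [Finset.mem_product, Finset.mem_filter, Finset.mem_univ, true_and, and_true,
      Finset.mem_insert, not_or] at h ⊢
    intro j hj
    by_cases hji : j = i
    · subst hji; simp
    · rw [Function.update_of_ne hji, h j ⟨hji, hj⟩]
  · rintro ⟨y, t⟩ h
    simp only [Finset.mem_product, Finset.mem_filter, Finset.mem_univ, true_and, and_true] at h
    simp [← h i hi]
  · intro z _
    simp
  · rintro ⟨y, t⟩ _
    rfl

end PartialSum

section SupBound

variable {n : ℕ} {F : LF n}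

lemma CS.exists_psum_bound {r T : ℝ} (hr : 1 ≤ r) (A : Finset (Fin n)) :
    ∀ {F : LF n}, CS A.card F → ∃ s C : ℝ, 0 ≤ s ∧ ∀ K, ∀ t ∈ tI K, t ≤ T → ∀ x,
      psum (gh K) Aᶜ (fun y => wt r K y ^ s * |F K t y|) x ≤ C := by
  induction A using Finset.induction_on with
  | empty =>
    intro F hF
    obtain ⟨s, C, hs, hC⟩ := hF.pm r T 1 hr zero_le_one
    refine ⟨s, C, hs, fun K t ht htT x => ?_⟩
    have := hC K t ht htT
    simp only [Real.rpow_one] at this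
    rwa [Finset.compl_empty, psum_univ]
  | insert i A hi ih =>
    intro F hF
    rw [Finset.card_insert_of_notMem hi] at hF
    obtain ⟨s₁, C₁, hs₁, h₁⟩ := ih (hF.mono (Nat.le_succ _))
    obtain ⟨s₂, C₂, hs₂, h₂⟩ := ih (hF.lD i)
    set s := max s₁ s₂ + 1 with hs
    have l₁ : s₁ ≤ s - 1 := by rw [hs]; linarith [le_max_left s₁ s₂]
    have l₂ : s₂ ≤ s - 1 := by rw [hs]; linarith [le_max_right s₁ s₂]
    set c : ℝ := 1 + 2 ^ s + (1 + s) * 2 ^ s with hc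
    have hp2 : (0 : ℝ) < 2 ^ s := by positivity
    have hsp : 0 < (1 + s) * 2 ^ s := mul_pos (by linarith) hp2
    refine ⟨s, c * (C₁ + C₂), by linarith, fun K t ht htT x => ?_⟩
    have hη := isWt_wt (n := n) hr K
    have hh := gh_pos K
    have hiS : i ∉ (insert i A)ᶜ := by simp
    have hS : insert i (insert i A)ᶜ = Aᶜ := by
      ext j
      by_cases hj : j = i
      · subst hj; simp [hi]
      · simp [hj]
    set f : Grid n ((K + 1) ^ 2) → ℝ := fun y => wt r K y ^ s * |F K t y| with hf
    have step : ∀ y, |f y| + |ldiff (gh K) i f y| ≤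
        c * (wt r K y ^ s₁ * |F K t y| + wt r K y ^ s₂ * |Yamabe.lD i F K t y|) := fun y => by
      have hy := hη.pos y
      have hy1 := hη.le_one y
      have e₁ : wt r K y ^ s ≤ wt r K y ^ s₁ :=
        Real.rpow_le_rpow_of_exponent_ge hy hy1 (by linarith)
      have e₂ : wt r K y ^ s ≤ wt r K y ^ s₂ :=
        Real.rpow_le_rpow_of_exponent_ge hy hy1 (by linarith)
      have e₃ : wt r K y ^ (s - 1) ≤ wt r K y ^ s₁ :=
        Real.rpow_le_rpow_of_exponent_ge hy hy1 l₁
      have g1 := abs_wt_rpow_sub_le (s := s) (by linarith) hy (hη.pos (y + stp i)) (hη.lip i y)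
        (hη.dbl i y)
      have g2 := rpow_dbl (s := s) hy (hη.pos (y + stp i)) (hη.dbl i y) (by linarith)
      have split : ldiff (gh K) i f y = wt r K (y + stp i) ^ s *
          ((|F K t (y + stp i)| - |F K t y|) / gh K) +
          (wt r K (y + stp i) ^ s - wt r K y ^ s) / gh K * |F K t y| := by
        simp only [ldiff, hf]; ring
      have b1 : |(|F K t (y + stp i)| - |F K t y|) / gh K| ≤ |Yamabe.lD i F K t y| := by
        simp only [Yamabe.lD, ldiff, abs_div]
        exact div_le_div_of_nonneg_right (abs_abs_sub_abs_le _ _) (abs_nonneg _)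
      have b2 : |(wt r K (y + stp i) ^ s - wt r K y ^ s) / gh K| ≤
          (1 + s) * 2 ^ s * wt r K y ^ (s - 1) := by
        rw [abs_div, abs_of_pos hh, div_le_iff₀ hh]
        exact g1.trans (le_of_eq (by ring))
      have b3 : |ldiff (gh K) i f y| ≤ 2 ^ s * wt r K y ^ s₂ * |Yamabe.lD i F K t y| +
          (1 + s) * 2 ^ s * wt r K y ^ s₁ * |F K t y| := by
        rw [split]
        refine (abs_add_le _ _).trans (add_le_add ?_ ?_)
        · rw [abs_mul, abs_of_pos (Real.rpow_pos_of_pos (hη.pos _) s)]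
          have : wt r K (y + stp i) ^ s ≤ 2 ^ s * wt r K y ^ s₂ :=
            g2.trans (mul_le_mul_of_nonneg_left e₂ hp2.le)
          have := Real.rpow_pos_of_pos hy s₂
          gcongr
        · rw [abs_mul, abs_abs]
          have : (1 + s) * 2 ^ s * wt r K y ^ (s - 1) ≤ (1 + s) * 2 ^ s * wt r K y ^ s₁ :=
            mul_le_mul_of_nonneg_left e₃ hsp.le
          exact mul_le_mul_of_nonneg_right (b2.trans this) (abs_nonneg _)
      have b4 : |f y| ≤ wt r K y ^ s₁ * |F K t y| := by
        rw [hf, abs_mul, abs_abs, abs_of_pos (Real.rpow_pos_of_pos hy s)]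
        gcongr
      have p1 : 0 ≤ wt r K y ^ s₁ * |F K t y| := by positivity
      have p2 : 0 ≤ wt r K y ^ s₂ * |Yamabe.lD i F K t y| := by positivity
      have q1 := mul_nonneg hp2.le p1
      have q2 := mul_nonneg hsp.le p2
      calc _ ≤ _ := add_le_add b4 b3
        _ ≤ _ := by rw [hc]; linarith only [q1, q2, p1, p2]
    calc psum (gh K) (insert i A)ᶜ f x
        ≤ psum (gh K) (insert i A)ᶜ (fun y => gh K * ∑ τ, (fun y' => |f y'| +
            |ldiff (gh K) i f y'|) (Function.update y i τ)) x :=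
          psum_mono hh.le (fun y => (le_abs_self _).trans
            (abs_le_line_sum hh (by exact_mod_cast hη.len) f i y)) x
      _ = psum (gh K) Aᶜ (fun y' => |f y'| + |ldiff (gh K) i f y'|) x := by
          rw [psum_line (f := fun y' => |f y'| + |ldiff (gh K) i f y'|) hiS, hS]
      _ ≤ psum (gh K) Aᶜ (fun y => c * (wt r K y ^ s₁ * |F K t y| +
            wt r K y ^ s₂ * |Yamabe.lD i F K t y|)) x := psum_mono hh.le step x
      _ ≤ c * (C₁ + C₂) := by
          rw [psum_const_mul, psum_add]
          have := h₁ K t ht htT x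
          have := h₂ K t ht htT x
          gcongr

lemma half_pow_le_wt {r : ℝ} (hr : 0 < r) {K : ℕ} {m : Fin n → ℤ} (hm : ∀ i, gh K * |(m i : ℝ)| ≤ r) :
    (1 / 2 : ℝ) ^ n ≤ wt (2 * r) K (gcast K m) := by
  have hh := gh_pos K
  have : ∏ _i : Fin n, (1 / 2 : ℝ) ≤ wt (2 * r) K (gcast K m) := by
    refine Finset.prod_le_prod (fun _ _ => by norm_num) fun i _ => le_max_of_le_right ?_
    have h1 : ((gcast K m i).valMinAbs.natAbs : ℝ) ≤ |(m i : ℝ)| := by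
      have := ZMod.natAbs_min_of_le_div_two ((K + 1) ^ 2) (gcast K m i).valMinAbs (m i)
        (by rw [ZMod.coe_valMinAbs]; rfl) (ZMod.natAbs_valMinAbs_le _)
      rw [← Int.cast_abs, ← Nat.cast_natAbs]
      exact_mod_cast this
    have h2 : ((gcast K m i).valMinAbs.natAbs : ℝ) * gh K ≤ r := by
      refine le_trans ?_ (hm i)
      rw [mul_comm]
      gcongr
    have : ((gcast K m i).valMinAbs.natAbs : ℝ) * gh K / (2 * r) ≤ 1 / 2 := by
      rw [div_le_iff₀ (by linarith)]; linarith
    linarith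
  simpa using this

/-- Local uniform bounds from integral bounds on difference quotients. -/
theorem CS.exists_sup_bound (hF : CS n F) (r T : ℝ) :
    ∃ C, 0 ≤ C ∧ ∀ K, ∀ t ∈ tI K, t ≤ T → ∀ m : Fin n → ℤ, (∀ i, gh K * |(m i : ℝ)| ≤ r) →
      |F K t (gcast K m)| ≤ C := by
  set ρ := max r 1 with hρ
  have hρ1 : 1 ≤ ρ := le_max_right _ _
  obtain ⟨s, C, hs, h⟩ := CS.exists_psum_bound (r := 2 * ρ) (T := T) (by linarith) Finset.univ
    (F := F) (by simpa using hF)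
  refine ⟨|C| / ((1 / 2 : ℝ) ^ n) ^ s, by positivity, fun K t ht htT m hm => ?_⟩
  have h1 := h K t ht htT (gcast K m)
  rw [Finset.compl_univ, psum_empty] at h1
  rw [le_div_iff₀ (by positivity)]
  have h2 := Real.rpow_le_rpow (by positivity) (half_pow_le_wt (r := ρ) (by linarith)
    fun i => (hm i).trans (le_max_left _ _)) hs
  calc _ ≤ |F K t (gcast K m)| * wt (2 * ρ) K (gcast K m) ^ s := by gcongr
    _ ≤ C := by rw [mul_comm]; exact h1
    _ ≤ |C| := le_abs_self C

end SupBound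

section Taylor

variable {n : ℕ}

lemma abs_sub_le_of_steps {φ : (Fin n → ℤ) → ℝ} {κ : ℝ} {m m' : Fin n → ℤ}
    (h : ∀ p : Fin n → ℤ, (∀ j, p j ∈ Set.uIcc (m j) (m' j)) →
      ∀ i, |φ (p + Pi.single i 1) - φ p| ≤ κ) :
    |φ m' - φ m| ≤ κ * ∑ i, |(m' i : ℝ) - m i| := by
  have cast : ∀ m' : Fin n → ℤ, ∑ i, |(m' i : ℝ) - m i| = ((∑ i, (m' i - m i).natAbs : ℕ) : ℝ) := by
    intro m'
    push_cast
    refine Finset.sum_congr rfl fun i _ => ?_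
    rw [Nat.cast_natAbs]; push_cast; rfl
  rw [cast]
  induction hN : ∑ i, (m' i - m i).natAbs generalizing m' with
  | zero =>
    have : m' = m := by
      funext i
      have := (Finset.sum_eq_zero_iff.1 hN) i (Finset.mem_univ i)
      omega
    subst this; simp
  | succ N ih =>
    obtain ⟨i, hi⟩ : ∃ i, m' i ≠ m i := by
      by_contra! hc
      simp [hc] at hN
    have key : ∀ m'' : Fin n → ℤ, (∀ j ≠ i, m'' j = m' j) →
        m'' i ∈ Set.uIcc (m i) (m' i) →
        (m' i - m i).natAbs = (m'' i - m i).natAbs + 1 → |φ m' - φ m''| ≤ κ →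
        |φ m' - φ m| ≤ κ * ((N + 1 : ℕ) : ℝ) := by
      intro m'' h1 h0 h2 h3
      have h4 : ∑ j, (m' j - m j).natAbs = ∑ j, (m'' j - m j).natAbs + 1 := by
        rw [← Finset.add_sum_erase _ _ (Finset.mem_univ i),
          ← Finset.add_sum_erase _ (fun j => (m'' j - m j).natAbs) (Finset.mem_univ i), h2,
          Finset.sum_congr rfl fun j hj => by rw [← h1 j (Finset.ne_of_mem_erase hj)]]
        ring
      have h5 := ih (m' := m'') (fun p hp j => h p (fun j => by
        have := hp j
        by_cases hj : j = i
        · subst hj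
          rw [Set.mem_uIcc] at this h0 ⊢; omega
        · rwa [h1 j hj] at this) j) (by omega)
      have := abs_sub_le (φ m') (φ m'') (φ m)
      push_cast
      linarith
    rcases lt_or_gt_of_ne hi with hlt | hlt
    · refine key (m' + Pi.single i 1) (fun j hj => by simp [hj])
        (by rw [Set.mem_uIcc]; simp; omega) (by simp; omega) ?_
      rw [abs_sub_comm]
      exact h m' (fun j => Set.right_mem_uIcc) i
    · refine key (m' - Pi.single i 1) (fun j hj => by simp [hj])
        (by rw [Set.mem_uIcc]; simp; omega) (by simp; omega) ?_
      have := h (m' - Pi.single i 1) (fun j => by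
        by_cases hj : j = i
        · subst hj; rw [Set.mem_uIcc]; simp; omega
        · simp [hj]) i
      rwa [sub_add_cancel] at this

lemma abs_le_of_mem_uIcc {h r : ℝ} (hh : 0 < h) {a b p : ℤ} (ha : h * |(a : ℝ)| ≤ r)
    (hb : h * |(b : ℝ)| ≤ r) (hp : p ∈ Set.uIcc a b) : h * |(p : ℝ)| ≤ r := by
  have : |(p : ℝ)| ≤ max |(a : ℝ)| |(b : ℝ)| := by
    rw [← Int.cast_abs, ← Int.cast_abs, ← Int.cast_abs]
    rw [Set.mem_uIcc] at hp
    have : |p| ≤ max |a| |b| := by simp only [Int.abs_eq_natAbs]; omega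
    exact_mod_cast this
  rcases le_max_iff.1 this with h' | h' <;> nlinarith

lemma CS.exists_lip_bound {F : LF n} (hF : CS (n + 1) F) (r T : ℝ) :
    ∃ C, 0 ≤ C ∧ ∀ K, ∀ t ∈ tI K, t ≤ T → ∀ m m' : Fin n → ℤ, (∀ i, gh K * |(m i : ℝ)| ≤ r) →
      (∀ i, gh K * |(m' i : ℝ)| ≤ r) →
      |F K t (gcast K m') - F K t (gcast K m)| ≤ C * (gh K * ∑ i, |(m' i : ℝ) - m i|) := by
  choose C hC0 hC using fun i => (hF.lD i).exists_sup_bound r T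
  refine ⟨∑ i, C i, Finset.sum_nonneg fun i _ => hC0 i, fun K t ht htT m m' hm hm' => ?_⟩
  have hh := gh_pos K
  rw [← mul_assoc]
  refine abs_sub_le_of_steps (φ := fun m => F K t (gcast K m)) fun p hp i => ?_
  have h1 := hC i K t ht htT p fun j => abs_le_of_mem_uIcc hh (hm j) (hm' j) (hp j)
  have h2 : C i ≤ ∑ i, C i := Finset.single_le_sum (fun i _ => hC0 i) (Finset.mem_univ i)
  have h3 : F K t (gcast K (p + Pi.single i 1)) - F K t (gcast K p) =
      gh K * Yamabe.lD i F K t (gcast K p) := by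
    rw [gcast_add_single]; simp only [Yamabe.lD, ldiff]; field_simp
  rw [h3, abs_mul, abs_of_pos hh, mul_comm]
  have := h1.trans h2
  gcongr

/-- Second order spatial Taylor estimate on the lattice. -/
lemma CS.exists_taylor_bound {F : LF n} (hF : CS (n + 2) F) (r T : ℝ) :
    ∃ C, 0 ≤ C ∧ ∀ K, ∀ t ∈ tI K, t ≤ T → ∀ m m' : Fin n → ℤ, (∀ i, gh K * |(m i : ℝ)| ≤ r) →
      (∀ i, gh K * |(m' i : ℝ)| ≤ r) →
      |F K t (gcast K m') - F K t (gcast K m) -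
        ∑ i, gh K * ((m' i : ℝ) - m i) * Yamabe.lD i F K t (gcast K m)| ≤
        C * (gh K * ∑ i, |(m' i : ℝ) - m i|) ^ 2 := by
  choose C hC0 hC using fun i => (hF.lD i).exists_lip_bound r T
  refine ⟨∑ i, C i, Finset.sum_nonneg fun i _ => hC0 i, fun K t ht htT m m' hm hm' => ?_⟩
  have hh := gh_pos K
  set D : ℝ := gh K * ∑ i, |(m' i : ℝ) - m i| with hD
  have hD0 : 0 ≤ D := by positivity
  have key := abs_sub_le_of_steps (m := m) (m' := m') (κ := (∑ i, C i) * D * gh K)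
    (φ := fun p => F K t (gcast K p) - ∑ i, gh K * (p i : ℝ) * Yamabe.lD i F K t (gcast K m))
    fun p hp i => by
      have hpr : ∀ j, gh K * |(p j : ℝ)| ≤ r := fun j =>
        abs_le_of_mem_uIcc hh (hm j) (hm' j) (hp j)
      have h1 := hC i K t ht htT m p hm hpr
      have h2 : C i ≤ ∑ i, C i := Finset.single_le_sum (fun i _ => hC0 i) (Finset.mem_univ i)
      have h3 : F K t (gcast K (p + Pi.single i 1)) - F K t (gcast K p) =
          gh K * Yamabe.lD i F K t (gcast K p) := by
        rw [gcast_add_single]; simp only [Yamabe.lD, ldiff]; field_simp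
      have h4 : ∑ j, gh K * ((p + Pi.single i 1 : Fin n → ℤ) j : ℝ) * Yamabe.lD j F K t (gcast K m) =
          ∑ j, gh K * (p j : ℝ) * Yamabe.lD j F K t (gcast K m) +
            gh K * Yamabe.lD i F K t (gcast K m) := by
        have : ∀ j, gh K * ((p + Pi.single i 1 : Fin n → ℤ) j : ℝ) * Yamabe.lD j F K t (gcast K m) =
            gh K * (p j : ℝ) * Yamabe.lD j F K t (gcast K m) +
              if j = i then gh K * Yamabe.lD i F K t (gcast K m) else 0 := fun j => by
          by_cases hj : j = i
          · subst hj; simp; ring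
          · simp [hj]
        simp only [this, Finset.sum_add_distrib, Finset.sum_ite_eq', Finset.mem_univ, if_true]
      have h5 : gh K * ∑ j, |(p j : ℝ) - m j| ≤ D := by
        rw [hD]
        refine mul_le_mul_of_nonneg_left (Finset.sum_le_sum fun j _ => ?_) hh.le
        have : |p j - m j| ≤ |m' j - m j| := by
          have := hp j
          rw [Set.mem_uIcc] at this; simp only [Int.abs_eq_natAbs]; omega
        exact_mod_cast this
      have h6 : F K t (gcast K (p + Pi.single i 1)) -
          ∑ j, gh K * ((p + Pi.single i 1 : Fin n → ℤ) j : ℝ) * Yamabe.lD j F K t (gcast K m) -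
          (F K t (gcast K p) - ∑ j, gh K * (p j : ℝ) * Yamabe.lD j F K t (gcast K m)) =
          (Yamabe.lD i F K t (gcast K p) - Yamabe.lD i F K t (gcast K m)) * gh K := by
        rw [h4]; linear_combination h3
      rw [h6, abs_mul, abs_of_pos hh]
      refine mul_le_mul_of_nonneg_right (h1.trans ?_) hh.le
      have := (hC0 i).trans h2
      gcongr
  have e : F K t (gcast K m') - F K t (gcast K m) -
      ∑ i, gh K * ((m' i : ℝ) - m i) * Yamabe.lD i F K t (gcast K m) =
      F K t (gcast K m') - ∑ i, gh K * (m' i : ℝ) * Yamabe.lD i F K t (gcast K m) -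
      (F K t (gcast K m) - ∑ i, gh K * (m i : ℝ) * Yamabe.lD i F K t (gcast K m)) := by
    simp only [mul_sub, sub_mul, Finset.sum_sub_distrib]; ring
  rw [e]
  refine key.trans (le_of_eq ?_)
  rw [hD]; ring

/-- Families smooth in space and time, uniformly in the mesh. -/
def Sm (F : LF n) : Prop :=
  ∃ V : ℕ → LF n, V 0 = F ∧ (∀ j, IsTD (V j) (V (j + 1))) ∧ ∀ j k, CS k (V j)

lemma Sm.cs {F : LF n} (h : Sm F) (k : ℕ) : CS k F := by
  obtain ⟨V, rfl, -, h⟩ := h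
  exact h 0 k

lemma Sm.exists_td {F : LF n} (h : Sm F) : ∃ F', IsTD F F' ∧ Sm F' := by
  obtain ⟨V, rfl, h1, h2⟩ := h
  exact ⟨V 1, h1 0, fun j => V (j + 1), rfl, fun j => h1 (j + 1), fun j k => h2 (j + 1) k⟩

lemma Sm.lD {F : LF n} (h : Sm F) (i : Fin n) : Sm (Yamabe.lD i F) := by
  obtain ⟨V, rfl, h1, h2⟩ := h
  exact ⟨fun j => Yamabe.lD i (V j), rfl, fun j => (h1 j).lD i, fun j k => (h2 j (k + 1)).lD i⟩

lemma Sm.of_static {F : LF n} (h : ∀ k, CS k F) (hs : ∀ K t x, F K t x = F K 0 x) : Sm F := by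
  refine ⟨fun j => if j = 0 then F else fun _ _ _ => 0, rfl, fun j => ?_, fun j k => ?_⟩
  · rcases j with _ | j
    · intro K t ht x
      simp only [if_true, Nat.add_eq_zero_iff, one_ne_zero, and_false, if_false]
      exact (hasDerivWithinAt_const t (tI K) (F K 0 x)).congr (fun τ _ => hs K τ x) (hs K t x)
    · simpa using IsTD.const 0
  · rcases j with _ | j
    · simpa using h k
    · simpa using CS.const 0

lemma abs_taylor_le {f f' f'' : ℝ → ℝ} {a b C : ℝ} (hf : ∀ t ∈ Set.Icc a b,
    HasDerivWithinAt f (f' t) (Set.Icc a b) t) (hf' : ∀ t ∈ Set.Icc a b,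
    HasDerivWithinAt f' (f'' t) (Set.Icc a b) t) (hC : ∀ t ∈ Set.Icc a b, |f'' t| ≤ C) {s t : ℝ}
    (hs : s ∈ Set.Icc a b) (ht : t ∈ Set.Icc a b) :
    |f s - f t - (s - t) * f' t| ≤ C * |s - t| ^ 2 := by
  have hsub : Set.uIcc t s ⊆ Set.Icc a b := Set.uIcc_subset_Icc ht hs
  have h1 : ∀ τ ∈ Set.uIcc t s, |f' τ - f' t| ≤ C * |s - t| := fun τ hτ => by
    have := (convex_Icc a b).norm_image_sub_le_of_norm_hasDerivWithin_le hf' hC ht (hsub hτ)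
    have h0 : 0 ≤ C := (abs_nonneg _).trans (hC t ht)
    refine this.trans (mul_le_mul_of_nonneg_left ?_ h0)
    exact Set.abs_sub_left_of_mem_uIcc hτ
  have h2 := (convex_uIcc t s).norm_image_sub_le_of_norm_hasDerivWithin_le
    (f := fun τ => f τ - τ * f' t) (f' := fun τ => f' τ - 1 * f' t)
    (fun τ hτ => ((hf τ (hsub hτ)).mono hsub).fun_sub ((hasDerivWithinAt_id τ _).mul_const _))
    (C := C * |s - t|) (fun τ hτ => by simpa using h1 τ hτ) Set.left_mem_uIcc Set.right_mem_uIcc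
  rw [Real.norm_eq_abs, Real.norm_eq_abs] at h2
  calc _ = _ := by congr 1; ring
    _ ≤ _ := h2
    _ = _ := by ring

/-- Second order Taylor estimate in space and time, uniform in the mesh. -/
theorem Sm.exists_taylor_bound {F F' : LF n} (hF : Sm F) (hF' : IsTD F F') (hS : Sm F') (r T : ℝ) :
    ∃ C, 0 ≤ C ∧ ∀ K, ∀ s ∈ tI K, ∀ t ∈ tI K, s ≤ T → t ≤ T → T ≤ K + 1 → ∀ m m' : Fin n → ℤ,
      (∀ i, gh K * |(m i : ℝ)| ≤ r) → (∀ i, gh K * |(m' i : ℝ)| ≤ r) →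
      |F K s (gcast K m') - F K t (gcast K m) - ((s - t) * F' K t (gcast K m) +
        ∑ i, gh K * ((m' i : ℝ) - m i) * Yamabe.lD i F K t (gcast K m))| ≤
        C * (|s - t| + gh K * ∑ i, |(m' i : ℝ) - m i|) ^ 2 := by
  obtain ⟨F'', hF'', hS''⟩ := hS.exists_td
  obtain ⟨C₁, hC₁, h₁⟩ := (hF.cs (n + 2)).exists_taylor_bound r T
  obtain ⟨C₂, hC₂, h₂⟩ := (hS.cs (n + 1)).exists_lip_bound r T
  obtain ⟨C₃, hC₃, h₃⟩ := (hS''.cs n).exists_sup_bound r T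
  refine ⟨C₁ + C₂ + C₃, by linarith, fun K s hs t ht hsT htT hTK m m' hm hm' => ?_⟩
  have hh := gh_pos K
  set D : ℝ := gh K * ∑ i, |(m' i : ℝ) - m i| with hD
  have hD0 : 0 ≤ D := by positivity
  have e₁ := h₁ K t ht htT m m' hm hm'
  have e₂ := h₂ K t ht htT m m' hm hm'
  have sub : Set.Icc 0 T ⊆ tI K := Set.Icc_subset_Icc_right hTK
  have e₃ := abs_taylor_le (f := fun τ => F K τ (gcast K m')) (a := 0) (b := T)
    (fun τ hτ => (hF' K τ (sub hτ) _).mono sub) (fun τ hτ => (hF'' K τ (sub hτ) _).mono sub)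
    (C := C₃) (fun τ hτ => h₃ K τ (sub hτ) hτ.2 m' hm') ⟨hs.1, hsT⟩ ⟨ht.1, htT⟩
  rw [← hD] at e₁ e₂
  set d := |s - t| with hd
  have hd0 : 0 ≤ d := abs_nonneg _
  have e₄ : |(s - t) * (F' K t (gcast K m') - F' K t (gcast K m))| ≤ d * (C₂ * D) := by
    rw [abs_mul]; gcongr
  calc _ = |(F K s (gcast K m') - F K t (gcast K m') - (s - t) * F' K t (gcast K m')) +
        (s - t) * (F' K t (gcast K m') - F' K t (gcast K m)) +
        (F K t (gcast K m') - F K t (gcast K m) -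
          ∑ i, gh K * ((m' i : ℝ) - m i) * Yamabe.lD i F K t (gcast K m))| := by congr 1; ring
    _ ≤ C₃ * d ^ 2 + d * (C₂ * D) + C₁ * D ^ 2 :=
        (abs_add_le _ _).trans (add_le_add ((abs_add_le _ _).trans (add_le_add e₃ e₄)) e₁)
    _ ≤ _ := by
        have := mul_nonneg hd0 hD0
        have a1 := mul_nonneg hC₁ (by positivity : 0 ≤ d ^ 2 + 2 * (d * D))
        have a2 := mul_nonneg hC₂ (by positivity : 0 ≤ d ^ 2 + d * D + D ^ 2)
        have a3 := mul_nonneg hC₃ (by positivity : 0 ≤ D ^ 2 + 2 * (d * D))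
        linarith only [a1, a2, a3]

end Taylor

section Limit

variable {n : ℕ}

/-- A fixed nonprincipal ultrafilter along which the mesh tends to zero. -/
noncomputable abbrev ult : Filter ℕ := (Filter.hyperfilter ℕ : Filter ℕ)

lemma tendsto_gh : Filter.Tendsto gh ult (nhds 0) :=
  tendsto_one_div_add_atTop_nhds_zero_nat.mono_left Nat.hyperfilter_le_atTop

lemma eventually_le_ult (T : ℝ) : ∀ᶠ K : ℕ in ult, T ≤ (K : ℝ) + 1 := by
  have : ∀ᶠ K : ℕ in Filter.atTop, T ≤ (K : ℝ) :=
    tendsto_natCast_atTop_atTop.eventually_ge_atTop T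
  exact (this.mono fun K h => by linarith).filter_mono Nat.hyperfilter_le_atTop

/-- Integer coordinates of the lattice point next to `x`. -/
noncomputable def flr (K : ℕ) (x : EuclideanSpace ℝ (Fin n)) : Fin n → ℤ := fun i => ⌊x i / gh K⌋

lemma abs_flr_sub_le (K : ℕ) (x : EuclideanSpace ℝ (Fin n)) (i : Fin n) :
    |gh K * (flr K x i : ℝ) - x i| ≤ gh K := by
  have hh := gh_pos K
  have h1 : (flr K x i : ℝ) ≤ x i / gh K := Int.floor_le _
  have h2 : x i / gh K < flr K x i + 1 := Int.lt_floor_add_one _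
  rw [le_div_iff₀ hh] at h1
  rw [div_lt_iff₀ hh] at h2
  rw [abs_le]; constructor <;> linarith

lemma gh_mul_abs_flr_le (K : ℕ) (x : EuclideanSpace ℝ (Fin n)) (i : Fin n) :
    gh K * |(flr K x i : ℝ)| ≤ ‖x‖ + 1 := by
  have h1 := abs_flr_sub_le K x i
  have h2 := gh_le_one K
  have h3 : |x i| ≤ ‖x‖ := PiLp.norm_apply_le x i
  have h4 : gh K * |(flr K x i : ℝ)| = |gh K * (flr K x i : ℝ)| := by
    rw [abs_mul, abs_of_pos (gh_pos K)]
  have h5 := abs_sub_abs_le_abs_sub (gh K * (flr K x i : ℝ)) (x i)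
  linarith

lemma tendsto_gh_mul_flr (x : EuclideanSpace ℝ (Fin n)) (i : Fin n) :
    Filter.Tendsto (fun K => gh K * (flr K x i : ℝ)) ult (nhds (x i)) := by
  rw [tendsto_iff_norm_sub_tendsto_zero]
  exact squeeze_zero (fun K => norm_nonneg _) (fun K => abs_flr_sub_le K x i) tendsto_gh

/-- Evaluation of a family near a point of space-time. -/
noncomputable def val (F : LF n) (p : ℝ × EuclideanSpace ℝ (Fin n)) (K : ℕ) : ℝ :=
  F K p.1 (gcast K (flr K p.2))

/-- Continuum limit of a family. -/
noncomputable def Lm (F : LF n) (p : ℝ × EuclideanSpace ℝ (Fin n)) : ℝ := Filter.limUnder ult (val F p)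

lemma CS.tendsto_val {F : LF n} (hF : CS n F) {p : ℝ × EuclideanSpace ℝ (Fin n)} (hp : 0 ≤ p.1) :
    Filter.Tendsto (val F p) ult (nhds (Lm F p)) := by
  obtain ⟨C, -, hC⟩ := hF.exists_sup_bound (‖p.2‖ + 1) p.1
  have h1 : ∀ᶠ K in ult, val F p K ∈ Set.Icc (-C) C := by
    filter_upwards [eventually_le_ult p.1] with K hK
    exact abs_le.1 (hC K p.1 ⟨hp, hK⟩ le_rfl _ fun i => gh_mul_abs_flr_le K p.2 i)
  obtain ⟨y, -, hy⟩ := (isCompact_Icc (a := -C) (b := C)).ultrafilter_le_nhds'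
    ((Filter.hyperfilter ℕ).map (val F p)) h1
  exact tendsto_nhds_limUnder ⟨y, hy⟩

/-- The linear form with given time and space components. -/
noncomputable def lform (a : ℝ) (b : Fin n → ℝ) : ℝ × EuclideanSpace ℝ (Fin n) →L[ℝ] ℝ :=
  a • ContinuousLinearMap.fst ℝ ℝ (EuclideanSpace ℝ (Fin n)) +
    ∑ i, b i • (EuclideanSpace.proj i : EuclideanSpace ℝ (Fin n) →L[ℝ] ℝ).comp
      (ContinuousLinearMap.snd ℝ ℝ (EuclideanSpace ℝ (Fin n)))

lemma lform_apply (a : ℝ) (b : Fin n → ℝ) (p : ℝ × EuclideanSpace ℝ (Fin n)) :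
    lform a b p = p.1 * a + ∑ i, p.2 i * b i := by
  simp [lform, mul_comm]

lemma Sm.abs_Lm_sub_le {F F' : LF n} (hF : Sm F) (hF' : IsTD F F') (hS : Sm F')
    {p : ℝ × EuclideanSpace ℝ (Fin n)} (hp : 0 ≤ p.1) :
    ∃ C, ∀ p' : ℝ × EuclideanSpace ℝ (Fin n), 0 ≤ p'.1 → ‖p' - p‖ ≤ 1 →
      |Lm F p' - Lm F p - lform (Lm F' p) (fun i => Lm (Yamabe.lD i F) p) (p' - p)| ≤
        C * ‖p' - p‖ ^ 2 := by
  obtain ⟨C, hC0, hC⟩ := hF.exists_taylor_bound hF' hS (‖p.2‖ + 2) (p.1 + 1)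
  refine ⟨C * (1 + n) ^ 2, fun p' hp' hpp => ?_⟩
  have n1 : |p'.1 - p.1| ≤ ‖p' - p‖ := norm_fst_le (p' - p)
  have n2 : ‖p'.2 - p.2‖ ≤ ‖p' - p‖ := norm_snd_le (p' - p)
  have tF := (hF.cs n).tendsto_val hp
  have tF' := (hS.cs n).tendsto_val hp
  have tFp := (hF.cs n).tendsto_val hp'
  have tD := fun i => ((hF.lD i).cs n).tendsto_val hp
  have td : ∀ i, Filter.Tendsto (fun K => gh K * ((flr K p'.2 i : ℝ) - flr K p.2 i)) ult
      (nhds (p'.2 i - p.2 i)) := fun i => by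
    simpa only [mul_sub] using (tendsto_gh_mul_flr p'.2 i).sub (tendsto_gh_mul_flr p.2 i)
  have tS : Filter.Tendsto (fun K => gh K * ∑ i, |(flr K p'.2 i : ℝ) - flr K p.2 i|) ult
      (nhds (∑ i, |p'.2 i - p.2 i|)) := by
    have : ∀ K, gh K * ∑ i, |(flr K p'.2 i : ℝ) - flr K p.2 i| =
        ∑ i, |gh K * ((flr K p'.2 i : ℝ) - flr K p.2 i)| := fun K => by
      rw [Finset.mul_sum]
      exact Finset.sum_congr rfl fun i _ => by rw [abs_mul, abs_of_pos (gh_pos K)]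
    simp only [this]
    exact tendsto_finsetSum _ fun i _ => (td i).abs
  have lim := le_of_tendsto_of_tendsto
    ((tFp.sub tF).sub ((tF'.const_mul (p'.1 - p.1)).add
      (tendsto_finsetSum Finset.univ fun i _ => (td i).mul (tD i)))).abs
    (((tS.const_add |p'.1 - p.1|).pow 2).const_mul C) (by
      filter_upwards [eventually_le_ult (p.1 + 1)] with K hK
      have a1 := (abs_le.1 (n1.trans hpp)).2
      refine hC K p'.1 ⟨hp', by linarith⟩ p.1 ⟨hp, by linarith⟩ (by linarith) (by linarith) hK
        (flr K p.2) (flr K p'.2) (fun i => (gh_mul_abs_flr_le K p.2 i).trans (by linarith))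
        fun i => (gh_mul_abs_flr_le K p'.2 i).trans ?_
      have := norm_sub_norm_le p'.2 p.2
      linarith)
  rw [lform_apply]
  refine lim.trans ?_
  rw [mul_assoc, ← mul_pow]
  have s1 : ∑ i, |p'.2 i - p.2 i| ≤ n * ‖p' - p‖ := by
    have : ∑ i, |p'.2 i - p.2 i| ≤ ∑ _i : Fin n, ‖p' - p‖ := Finset.sum_le_sum fun i _ =>
      (PiLp.norm_apply_le (p'.2 - p.2) i).trans n2
    simpa using this
  have s0 : 0 ≤ ∑ i, |p'.2 i - p.2 i| := Finset.sum_nonneg fun i _ => abs_nonneg _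
  gcongr
  linarith

/-- The space-time domain of the flow. -/
abbrev dom (n : ℕ) : Set (ℝ × EuclideanSpace ℝ (Fin n)) := Set.Ici 0 ×ˢ Set.univ

lemma Sm.hasFDerivWithinAt_Lm {F F' : LF n} (hF : Sm F) (hF' : IsTD F F') (hS : Sm F')
    {p : ℝ × EuclideanSpace ℝ (Fin n)} (hp : 0 ≤ p.1) :
    HasFDerivWithinAt (Lm F) (lform (Lm F' p) fun i => Lm (Yamabe.lD i F) p) (dom n) p := by
  obtain ⟨C, hC⟩ := hF.abs_Lm_sub_le hF' hS hp
  rw [hasFDerivWithinAt_iff_isLittleO]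
  refine Asymptotics.IsBigO.trans_isLittleO (g := fun p' => ‖p' - p‖ ^ 2) ?_
    ((Asymptotics.isLittleO_pow_sub_sub p one_lt_two).mono nhdsWithin_le_nhds)
  refine Asymptotics.IsBigO.of_bound C ?_
  have : ∀ᶠ p' in nhdsWithin p (dom n), p' ∈ Metric.closedBall p 1 :=
    nhdsWithin_le_nhds (Metric.closedBall_mem_nhds p one_pos)
  filter_upwards [this, self_mem_nhdsWithin] with p' h1 h2
  rw [norm_pow, norm_norm]
  exact hC p' h2.1 (by simpa [dist_eq_norm] using h1)

lemma uniqueDiffOn_dom : UniqueDiffOn ℝ (dom n) := (uniqueDiffOn_Ici 0).prod uniqueDiffOn_univ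

lemma contDiff_lform : ContDiff ℝ (⊤ : ℕ∞) fun q : ℝ × (Fin n → ℝ) => lform q.1 q.2 := by
  unfold lform
  refine (contDiff_fst.smul contDiff_const).add (ContDiff.sum fun i _ => ?_)
  exact ((contDiff_apply ℝ ℝ i).comp contDiff_snd).smul contDiff_const

lemma Sm.contDiffOn_Lm_nat {F : LF n} (hF : Sm F) (k : ℕ) : ContDiffOn ℝ k (Lm F) (dom n) := by
  induction k generalizing F with
  | zero =>
    obtain ⟨F', hF', hS⟩ := hF.exists_td
    exact contDiffOn_zero.2 fun p hp => (hF.hasFDerivWithinAt_Lm hF' hS hp.1).continuousWithinAt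
  | succ k ih =>
    obtain ⟨F', hF', hS⟩ := hF.exists_td
    have hd := fun p (hp : p ∈ dom n) => hF.hasFDerivWithinAt_Lm hF' hS hp.1
    rw [Nat.cast_succ, contDiffOn_succ_iff_fderivWithin uniqueDiffOn_dom]
    refine ⟨fun p hp => (hd p hp).differentiableWithinAt, by simp, ?_⟩
    refine ContDiffOn.congr ?_ fun p hp => (hd p hp).fderivWithin (uniqueDiffOn_dom p hp)
    exact (contDiff_lform.of_le (by exact_mod_cast le_top)).comp_contDiffOn
      ((ih hS).prodMk (contDiffOn_pi.2 fun i => ih (hF.lD i)))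

lemma Sm.contDiffOn_Lm {F : LF n} (hF : Sm F) : ContDiffOn ℝ (⊤ : ℕ∞) (Lm F) (dom n) :=
  contDiffOn_infty.2 hF.contDiffOn_Lm_nat

lemma Sm.derivWithin_Lm {F F' : LF n} (hF : Sm F) (hF' : IsTD F F') (hS : Sm F') {t : ℝ}
    (ht : 0 ≤ t) (x : EuclideanSpace ℝ (Fin n)) :
    derivWithin (fun s => Lm F (s, x)) (Set.Ici 0) t = Lm F' (t, x) := by
  have h := (hF.hasFDerivWithinAt_Lm hF' hS (p := (t, x)) ht).comp_hasDerivWithinAt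
    (f := fun s : ℝ => (s, x)) (f' := (1, 0)) (s := Set.Ici 0) t
    ((hasDerivWithinAt_id t _).prodMk (hasDerivWithinAt_const t _ x))
    (fun s hs => ⟨hs, trivial⟩)
  have e : (Lm F ∘ fun s : ℝ => (s, x)) = fun s => Lm F (s, x) := rfl
  rw [lform_apply, e] at h
  simpa using h.derivWithin (uniqueDiffOn_Ici 0 t ht)

lemma Sm.fderiv_Lm_single {F : LF n} (hF : Sm F) {t : ℝ} (ht : 0 ≤ t)
    (x : EuclideanSpace ℝ (Fin n)) (i : Fin n) :
    fderiv ℝ (fun y => Lm F (t, y)) x (EuclideanSpace.single i 1) =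
      Lm (Yamabe.lD i F) (t, x) := by
  obtain ⟨F', hF', hS⟩ := hF.exists_td
  have h := (hF.hasFDerivWithinAt_Lm hF' hS (p := (t, x)) ht).comp
    (f := fun y : EuclideanSpace ℝ (Fin n) => (t, y)) (s := Set.univ) x
    ((hasFDerivWithinAt_const t x _).prodMk (hasFDerivWithinAt_id x _)) (fun y _ => ⟨ht, trivial⟩)
  rw [hasFDerivWithinAt_univ] at h
  have e : (Lm F ∘ fun y : EuclideanSpace ℝ (Fin n) => (t, y)) = fun y => Lm F (t, y) := rfl
  rw [e] at h
  rw [h.fderiv, ContinuousLinearMap.comp_apply, lform_apply]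
  simp

lemma Sm.lap_Lm {F : LF n} (hF : Sm F) {t : ℝ} (ht : 0 ≤ t) (x : EuclideanSpace ℝ (Fin n)) :
    lap (fun y => Lm F (t, y)) x = ∑ i, Lm (Yamabe.lD i (Yamabe.lD i F)) (t, x) := by
  unfold lap
  refine Finset.sum_congr rfl fun i _ => ?_
  have : (fun y => fderiv ℝ (fun y => Lm F (t, y)) y (EuclideanSpace.single i 1)) =
      fun y => Lm (Yamabe.lD i F) (t, y) := funext fun y => hF.fderiv_Lm_single ht y i
  rw [this, (hF.lD i).fderiv_Lm_single ht x i]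

lemma CS.tendsto_shift_neg {F : LF n} (hF : CS (n + 1) F) {p : ℝ × EuclideanSpace ℝ (Fin n)}
    (hp : 0 ≤ p.1) (i : Fin n) :
    Filter.Tendsto (val (fun K t x => F K t (x - stp i)) p) ult (nhds (Lm F p)) := by
  obtain ⟨C, hC0, hC⟩ := hF.exists_lip_bound (‖p.2‖ + 2) p.1
  have h0 : Filter.Tendsto (fun K => val (fun K t x => F K t (x - stp i)) p K - val F p K) ult
      (nhds 0) := by
    refine squeeze_zero_norm' (a := fun K => C * gh K) ?_ (by simpa using tendsto_gh.const_mul C)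
    filter_upwards [eventually_le_ult p.1] with K hK
    have hh := gh_pos K
    have h1 := hC K p.1 ⟨hp, hK⟩ le_rfl (flr K p.2) (flr K p.2 - Pi.single i 1)
      (fun j => (gh_mul_abs_flr_le K p.2 j).trans (by linarith)) (fun j => by
        have a1 := gh_mul_abs_flr_le K p.2 j
        have a2 : |(((flr K p.2 - Pi.single i 1 : Fin n → ℤ) j : ℤ) : ℝ)| ≤
            |(flr K p.2 j : ℝ)| + 1 := by
          by_cases hj : j = i
          · subst hj
            simp only [Pi.sub_apply, Pi.single_eq_same, Int.cast_sub, Int.cast_one]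
            exact (abs_sub _ _).trans (by simp)
          · simp [hj]
        have a3 := gh_le_one K
        have := mul_le_mul_of_nonneg_left a2 hh.le
        linarith)
    have e1 : gcast K (flr K p.2 - Pi.single i 1) = gcast K (flr K p.2) - stp i := by
      rw [eq_sub_iff_add_eq, ← gcast_add_single, sub_add_cancel]
    have e2 : ∑ j, |(((flr K p.2 - Pi.single i 1 : Fin n → ℤ) j : ℤ) : ℝ) - flr K p.2 j| = 1 := by
      rw [Finset.sum_eq_single i (fun j _ hj => by simp [hj]) (by simp)]
      simp
    rw [e1, e2, mul_one] at h1
    exact h1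
  simpa using h0.add ((hF.mono (Nat.le_succ n)).tendsto_val hp)

lemma Sm.tendsto_lL {F : LF n} (hF : Sm F) {p : ℝ × EuclideanSpace ℝ (Fin n)} (hp : 0 ≤ p.1) :
    Filter.Tendsto (val (Yamabe.lL F) p) ult (nhds (lap (fun y => Lm F (p.1, y)) p.2)) := by
  rw [hF.lap_Lm hp]
  have e : val (Yamabe.lL F) p = fun K =>
      ∑ i, val (fun K t x => Yamabe.lD i (Yamabe.lD i F) K t (x - stp i)) p K := by
    funext K
    have := gh_pos K
    simp only [val, Yamabe.lL, llap, Yamabe.lD, ldiff, sub_add_cancel]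
    exact Finset.sum_congr rfl fun i _ => by field_simp; ring
  rw [e]
  exact tendsto_finsetSum _ fun i _ => (((hF.lD i).lD i).cs (n + 1)).tendsto_shift_neg hp i

lemma tendsto_val_smp {f : EuclideanSpace ℝ (Fin n) → ℝ} (hf : Continuous f)
    (p : ℝ × EuclideanSpace ℝ (Fin n)) :
    Filter.Tendsto (val (smp f) p) ult (nhds (f p.2)) := by
  have h1 : Filter.Tendsto (fun K => ipt K (flr K p.2)) ult (nhds p.2) := by
    have : Filter.Tendsto (fun K => (fun i => gh K * (flr K p.2 i : ℝ) : Fin n → ℝ)) ult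
        (nhds (fun i => p.2 i)) := tendsto_pi_nhds.2 fun i => tendsto_gh_mul_flr p.2 i
    exact ((PiLp.continuous_toLp 2 _).tendsto _).comp this
  refine ((hf.tendsto _).comp h1).congr' ?_
  filter_upwards [eventually_le_ult (2 * (‖p.2‖ + 1) + 1)] with K hK
  simp only [val, smp, Function.comp]
  rw [pos_gcast]
  intro i
  have a := gh_mul_abs_flr_le K p.2 i
  have hK0 : (0 : ℝ) < (K : ℝ) + 1 := by positivity
  have e : gh K * |(flr K p.2 i : ℝ)| = |(flr K p.2 i : ℝ)| / ((K : ℝ) + 1) := by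
    unfold gh; ring
  rw [e, div_le_iff₀ hK0] at a
  have : 2 * |(flr K p.2 i : ℝ)| < ((K : ℝ) + 1) ^ 2 := by nlinarith
  exact_mod_cast this

lemma Lm_smp {f : EuclideanSpace ℝ (Fin n) → ℝ} (hf : Continuous f)
    (p : ℝ × EuclideanSpace ℝ (Fin n)) : Lm (smp f) p = f p.2 := (tendsto_val_smp hf p).limUnder_eq

lemma sm_smp {f : EuclideanSpace ℝ (Fin n) → ℝ} (hf : ContDiff ℝ (⊤ : ℕ∞) f) {B : ℝ}
    (hB : ∀ x, |f x| ≤ B) : Sm (smp f) := Sm.of_static (CS.smp hf hB) fun _ _ _ => rfl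

end Limit

/-- Smooth solutions of the flow by conformal change of the background, trapped between multiples
of a positive function `w`. -/
theorem exists_flow {n : ℕ} (hn : 3 ≤ n) {α k₀ a m M : ℝ} (hα : α * ((n : ℝ) - 2) = 4)
    (hα0 : 0 < α) (hk : 0 < k₀) (ha : 0 < a) (hm : 0 < m) (hmM : m ≤ M)
    {w u₀ : EuclideanSpace ℝ (Fin n) → ℝ} (hw : ContDiff ℝ (⊤ : ℕ∞) w)
    (hu₀ : ContDiff ℝ (⊤ : ℕ∞) u₀) (hwa : ∀ x, a ≤ w x) (hw1 : ∀ x, w x ≤ 1)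
    (hu : ∀ x, m * w x ≤ u₀ x ∧ u₀ x ≤ M * w x) :
    ∃ u : ℝ × EuclideanSpace ℝ (Fin n) → ℝ, ContDiffOn ℝ (⊤ : ℕ∞) u (Set.Ici 0 ×ˢ Set.univ) ∧
      (∀ x, u (0, x) = u₀ x) ∧
      (∀ t, 0 ≤ t → ∀ x, m * w x ≤ u (t, x) ∧ u (t, x) ≤ M * w x) ∧
      ∀ t, 0 ≤ t → ∀ x, u (t, x) ^ α * derivWithin (fun s => u (s, x)) (Set.Ici 0) t * w x =
        k₀ * (lap (fun y => u (t, y)) x * w x - lap w x * u (t, x)) := by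
  have hM : 0 < M := hm.trans_le hmM
  have hw0 : ∀ x, 0 < w x := fun x => ha.trans_le (hwa x)
  have wB : ∀ x, |w x| ≤ 1 := fun x => by rw [abs_of_pos (hw0 x)]; exact hw1 x
  have uB : ∀ x, |u₀ x| ≤ M := fun x => by
    rw [abs_of_pos ((mul_pos hm (hw0 x)).trans_le (hu x).1)]
    exact (hu x).2.trans (mul_le_of_le_one_right hM.le (hw1 x))
  obtain ⟨V, h1, h2, h3, h4⟩ := exists_lattice_flow (α := α) (W := smp w) (U := smp u₀) hk hm hmM
    (fun _ _ _ => rfl) (fun _ _ _ => hw0 _) fun _ _ => hu _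
  have hWs : ∀ k, CS k (smp w) := CS.smp hw wB
  have hRs : ∀ k, CS k fun K t x => lL (smp w) K t x / smp w K t x := fun k => by
    simp only [div_eq_mul_inv]
    exact (hWs (k + 2)).lL.mul ((hWs k).inv ha fun _ _ _ _ => hwa _)
  have lf : LatFlow α k₀ (m * a) M (fun K t x => lL (smp w) K t x / smp w K t x) V :=
    { td := h1
      le := fun K t ht x => (mul_le_mul_of_nonneg_left (hwa _) hm.le).trans (h3 K t ht x).1
      ge := fun K t ht x => (h3 K t ht x).2.trans (mul_le_of_le_one_right hM.le (hw1 _))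
      eqn := h4
      stat := fun K t _ x => hasDerivWithinAt_const t _ (lL (smp w) K 0 x / smp w K 0 x) }
  have ha1 : a ≤ 1 := (hwa 0).trans (hw1 0)
  have hcs := lf.cs hn hα hα0 hk (mul_pos hm ha)
    ((mul_le_of_le_one_right hm.le ha1).trans hmM) hRs fun k =>
    (CS.smp hu₀ uB k).congr fun K t _ x => h2 K x
  have s0 : Sm (V 0) := ⟨V, rfl, h1, fun j k => hcs k j⟩
  have s1 : Sm (V 1) := ⟨fun j => V (j + 1), rfl, fun j => h1 (j + 1), fun j k => hcs k (j + 1)⟩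
  have sw : Sm (smp w) := sm_smp hw wB
  have hwc := hw.continuous
  have bd : ∀ t, 0 ≤ t → ∀ x, m * w x ≤ Lm (V 0) (t, x) ∧ Lm (V 0) (t, x) ≤ M * w x := by
    intro t ht x
    have l0 := (hcs n 0).tendsto_val (p := (t, x)) ht
    have lw := tendsto_val_smp hwc (t, x)
    have e := eventually_le_ult t
    exact ⟨le_of_tendsto_of_tendsto (lw.const_mul m) l0 (e.mono fun K hK => (h3 K t ⟨ht, hK⟩ _).1),
      le_of_tendsto_of_tendsto l0 (lw.const_mul M) (e.mono fun K hK => (h3 K t ⟨ht, hK⟩ _).2)⟩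
  refine ⟨Lm (V 0), s0.contDiffOn_Lm, fun x => ?_, bd, fun t ht x => ?_⟩
  · have : val (V 0) (0, x) = val (smp u₀) (0, x) := funext fun K => h2 K _
    rw [Lm, this]
    exact Lm_smp hu₀.continuous (0, x)
  · rw [s0.derivWithin_Lm (h1 0) s1 ht]
    have l0 := (hcs n 0).tendsto_val (p := (t, x)) ht
    have l1 := (hcs n 1).tendsto_val (p := (t, x)) ht
    have lw := tendsto_val_smp hwc (t, x)
    have ll := s0.tendsto_lL (p := (t, x)) ht
    have llw := sw.tendsto_lL (p := (t, x)) ht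
    simp only [Lm_smp hwc] at llw
    have hpos : 0 < Lm (V 0) (t, x) := (mul_pos hm (hw0 x)).trans_le (bd t ht x).1
    have lp := l0.rpow_const (p := α) (Or.inl hpos.ne')
    refine tendsto_nhds_unique ((lp.mul l1).mul lw)
      ((((ll.mul lw).sub (llw.mul l0)).const_mul k₀).congr' ?_)
    filter_upwards [eventually_le_ult t] with K hK
    have h := h4 K t ⟨ht, hK⟩ (gcast K (flr K x))
    have hp : smp w K t (gcast K (flr K x)) ≠ 0 := (hw0 _).ne'
    simp only [val]
    rw [h]
    field_simp

section Comparison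

variable {n : ℕ} {f g : EuclideanSpace ℝ (Fin n) → ℝ}

lemma contDiff_fderiv_apply (hf : ContDiff ℝ 2 f) (e : EuclideanSpace ℝ (Fin n)) :
    ContDiff ℝ 1 fun y => fderiv ℝ f y e :=
  (hf.fderiv_right (m := 1) (by norm_num)).clm_apply contDiff_const

lemma lap_add (hf : ContDiff ℝ 2 f) (hg : ContDiff ℝ 2 g) (x : EuclideanSpace ℝ (Fin n)) :
    lap (fun y => f y + g y) x = lap f x + lap g x := by
  unfold lap
  rw [← Finset.sum_add_distrib]
  refine Finset.sum_congr rfl fun i _ => ?_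
  have h : (fun y => fderiv ℝ (fun y => f y + g y) y (EuclideanSpace.single i 1)) = fun y =>
      fderiv ℝ f y (EuclideanSpace.single i 1) + fderiv ℝ g y (EuclideanSpace.single i 1) := by
    funext y
    rw [fderiv_fun_add (hf.differentiable (by norm_num) y) (hg.differentiable (by norm_num) y)]
    rfl
  rw [h, fderiv_fun_add ((contDiff_fderiv_apply hf _).differentiable (by norm_num) x)
    ((contDiff_fderiv_apply hg _).differentiable (by norm_num) x)]
  rfl

lemma lap_const_mul (hf : ContDiff ℝ 2 f) (b : ℝ) (x : EuclideanSpace ℝ (Fin n)) :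
    lap (fun y => b * f y) x = b * lap f x := by
  unfold lap
  rw [Finset.mul_sum]
  refine Finset.sum_congr rfl fun i _ => ?_
  have h : (fun y => fderiv ℝ (fun y => b * f y) y (EuclideanSpace.single i 1)) = fun y =>
      b * fderiv ℝ f y (EuclideanSpace.single i 1) := by
    funext y
    rw [fderiv_const_mul (hf.differentiable (by norm_num) y)]
    rfl
  rw [h, fderiv_const_mul ((contDiff_fderiv_apply hf _).differentiable (by norm_num) x)]
  rfl

lemma lap_const (b : ℝ) (x : EuclideanSpace ℝ (Fin n)) : lap (fun _ => b) x = 0 := by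
  simp [lap]

lemma lap_norm_sq (x : EuclideanSpace ℝ (Fin n)) : lap (fun y => ‖y‖ ^ 2) x = 2 * n := by
  unfold lap
  have h : ∀ i : Fin n, (fun y : EuclideanSpace ℝ (Fin n) =>
      fderiv ℝ (fun y : EuclideanSpace ℝ (Fin n) => ‖y‖ ^ 2) y (EuclideanSpace.single i 1)) =
      fun y => 2 * y i := fun i => by
    funext y
    rw [(hasStrictFDerivAt_norm_sq y).hasFDerivAt.fderiv]
    simp [EuclideanSpace.inner_single_right]
  have h2 : ∀ i : Fin n, fderiv ℝ (fun y : EuclideanSpace ℝ (Fin n) => 2 * y i) x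
      (EuclideanSpace.single i 1) = 2 := fun i => by
    have := ((EuclideanSpace.proj i : EuclideanSpace ℝ (Fin n) →L[ℝ] ℝ).hasFDerivAt
      (x := x)).const_mul (2 : ℝ)
    have e : (fun y : EuclideanSpace ℝ (Fin n) => 2 * y i) =
      fun y => 2 * (EuclideanSpace.proj i : EuclideanSpace ℝ (Fin n) →L[ℝ] ℝ) y := rfl
    rw [e, this.fderiv]
    simp
  simp only [h, h2]
  simp [mul_comm]

lemma lap_nonneg_of_isLocalMin (hf : ContDiff ℝ 2 f) {x : EuclideanSpace ℝ (Fin n)}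
    (h : IsLocalMin f x) : 0 ≤ lap f x := by
  refine Finset.sum_nonneg fun i _ => ?_
  set e : EuclideanSpace ℝ (Fin n) := EuclideanSpace.single i 1
  have hl : ∀ s : ℝ, HasDerivAt (fun s : ℝ => x + s • e) e s := fun s => by
    simpa using ((hasDerivAt_id s).smul_const e).const_add x
  have d1 : ∀ s : ℝ, HasDerivAt (fun s : ℝ => f (x + s • e)) (fderiv ℝ f (x + s • e) e) s :=
    fun s => (hf.differentiable (by norm_num) _).hasFDerivAt.comp_hasDerivAt s (hl s)
  have d2 : HasDerivAt (fun s : ℝ => fderiv ℝ f (x + s • e) e)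
      (fderiv ℝ (fun y => fderiv ℝ f y e) x e) 0 := by
    have := ((contDiff_fderiv_apply hf e).differentiable (by norm_num)
      (x + (0 : ℝ) • e)).hasFDerivAt.comp_hasDerivAt 0 (hl 0)
    rw [zero_smul, add_zero] at this
    exact this
  have hd : deriv (fun s : ℝ => f (x + s • e)) = fun s => fderiv ℝ f (x + s • e) e :=
    funext fun s => (d1 s).deriv
  have hmin : IsLocalMin (fun s : ℝ => f (x + s • e)) 0 := by
    have hc : Filter.Tendsto (fun s : ℝ => x + s • e) (nhds 0) (nhds x) := by
      simpa using (hl 0).continuousAt.tendsto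
    simpa [IsLocalMin, IsMinFilter] using hc.eventually h
  by_contra! hneg
  have hmax : IsLocalMax (fun s : ℝ => f (x + s • e)) 0 := by
    refine isLocalMax_of_deriv_deriv_neg ?_ hmin.deriv_eq_zero (d1 0).continuousAt
    rw [hd, d2.deriv]
    exact hneg
  have hconst : (fun s : ℝ => f (x + s • e)) =ᶠ[nhds 0] fun _ => f (x + (0 : ℝ) • e) := by
    filter_upwards [hmin, hmax] with s h1 h2 using le_antisymm h2 h1
  have := hconst.deriv.deriv_eq
  rw [hd, d2.deriv] at this
  simp at this
  exact hneg.ne this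

/-- A time derivative is nonpositive at a point where the minimum over the past is attained. -/
lemma deriv_nonpos_of_past_min {φ : ℝ → ℝ} {φ' t : ℝ} (ht : 0 < t) (h : HasDerivAt φ φ' t)
    (hmin : ∀ s ∈ Set.Icc 0 t, φ t ≤ φ s) : φ' ≤ 0 := by
  have hs := (hasDerivAt_iff_tendsto_slope.1 h).mono_left
    (nhdsWithin_mono t (fun s (hs : s ∈ Set.Iio t) => ne_of_lt hs))
  refine le_of_tendsto hs ?_
  filter_upwards [Ioo_mem_nhdsLT ht] with s hs
  rw [slope_def_field]
  exact div_nonpos_of_nonneg_of_nonpos (sub_nonneg.2 (hmin s ⟨hs.1.le, hs.2.le⟩))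
    (sub_nonpos.2 hs.2.le)

/-- Comparison with a strict supersolution on a cylinder. -/
lemma neg_le_of_strict_supersolution {z ψ : ℝ → EuclideanSpace ℝ (Fin n) → ℝ} {T ρ c : ℝ}
    {A zt ψt : ℝ → EuclideanSpace ℝ (Fin n) → ℝ} {r : EuclideanSpace ℝ (Fin n) → ℝ}
    (hcz : ContinuousOn (fun p : ℝ × EuclideanSpace ℝ (Fin n) => z p.1 p.2)
      (Set.Icc 0 T ×ˢ Metric.closedBall 0 ρ))
    (hcψ : ContinuousOn (fun p : ℝ × EuclideanSpace ℝ (Fin n) => ψ p.1 p.2)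
      (Set.Icc 0 T ×ˢ Metric.closedBall 0 ρ))
    (hz : ∀ t, 0 < t → ContDiff ℝ 2 (z t)) (hψ : ∀ t, 0 < t → ContDiff ℝ 2 (ψ t))
    (hzt : ∀ t, 0 < t → ∀ x, HasDerivAt (fun s => z s x) (zt t x) t)
    (hψt : ∀ t, 0 < t → ∀ x, HasDerivAt (fun s => ψ s x) (ψt t x) t)
    (hA : ∀ t, 0 < t → ∀ x, 0 < A t x) (hc : 0 ≤ c) (hr : ∀ x, 0 ≤ r x)
    (heq : ∀ t, 0 < t → ∀ x, A t x * zt t x = c * lap (z t) x - r x * z t x)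
    (hsup : ∀ t, 0 < t → ∀ x, ‖x‖ < ρ → c * lap (ψ t) x - r x * ψ t x < A t x * ψt t x)
    (hini : ∀ x, ‖x‖ ≤ ρ → 0 ≤ z 0 x + ψ 0 x)
    (hbd : ∀ t, 0 ≤ t → ∀ x, ‖x‖ = ρ → 0 ≤ z t x + ψ t x) :
    ∀ t ∈ Set.Icc 0 T, ∀ x, ‖x‖ ≤ ρ → -ψ t x ≤ z t x := by
  intro t₁ ht₁ x₁ hx₁
  obtain ⟨⟨t, x⟩, ⟨ht, hx⟩, hmin⟩ := (isCompact_Icc.prod (isCompact_closedBall 0 ρ)).exists_isMinOn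
    ⟨(t₁, x₁), ht₁, by simpa using hx₁⟩ (hcz.add hcψ)
  rw [isMinOn_iff] at hmin
  simp only at ht hx
  rw [mem_closedBall_zero_iff] at hx
  have hle : z t x + ψ t x ≤ z t₁ x₁ + ψ t₁ x₁ := hmin (t₁, x₁) ⟨ht₁, by simpa using hx₁⟩
  suffices 0 ≤ z t x + ψ t x by linarith
  by_contra! hneg
  have ht0 : 0 < t := lt_of_le_of_ne ht.1 fun h => by
    subst h
    exact absurd (hini x hx) (not_le.2 hneg)
  have hxρ : ‖x‖ < ρ := lt_of_le_of_ne hx fun h => absurd (hbd t ht.1 x h) (not_le.2 hneg)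
  have h1 : zt t x + ψt t x ≤ 0 :=
    deriv_nonpos_of_past_min ht0 ((hzt t ht0 x).add (hψt t ht0 x)) fun s hs =>
      hmin (s, x) ⟨⟨hs.1, hs.2.trans ht.2⟩, by simpa using hx⟩
  have h2 : 0 ≤ lap (fun y => z t y + ψ t y) x := by
    refine lap_nonneg_of_isLocalMin ((hz t ht0).add (hψ t ht0)) ?_
    filter_upwards [Metric.isOpen_ball.mem_nhds (mem_ball_zero_iff.2 hxρ)] with y hy
    exact hmin (t, y) ⟨ht, Metric.ball_subset_closedBall hy⟩
  rw [lap_add (hz t ht0) (hψ t ht0)] at h2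
  have h3 := heq t ht0 x
  have h4 := hsup t ht0 x hxρ
  have h5 := mul_nonpos_of_nonneg_of_nonpos (hA t ht0 x).le h1
  have h6 := mul_nonneg hc h2
  have h7 := mul_nonpos_of_nonneg_of_nonpos (hr x) hneg.le
  linarith

end Comparison

section Flow

variable {n : ℕ} {u : ℝ × EuclideanSpace ℝ (Fin n) → ℝ} {w v r : EuclideanSpace ℝ (Fin n) → ℝ}
  {A : ℝ → EuclideanSpace ℝ (Fin n) → ℝ} {c : ℝ}

/-- A quadratic barrier for the distance of a solution to a stationary one. -/
lemma neg_barrier_le (hu : ContDiffOn ℝ (⊤ : ℕ∞) u (Set.Ici 0 ×ˢ Set.univ))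
    (hw : ContDiff ℝ 2 w) (hv : ContDiff ℝ 2 v) (hc : 0 ≤ c) (hr : ∀ x, 0 ≤ r x)
    (hA : ∀ t, 0 ≤ t → ∀ x, 0 < A t x)
    (heq : ∀ t, 0 ≤ t → ∀ x, A t x * derivWithin (fun s => u (s, x)) (Set.Ici 0) t =
      c * lap (fun y => u (t, y)) x - r x * u (t, x))
    (hweq : ∀ x, c * lap w x = r x * w x) {a d a' d' : ℝ → ℝ} (ha : ∀ t, HasDerivAt a (a' t) t)
    (hd : ∀ t, HasDerivAt d (d' t) t) {σ b T ρ : ℝ}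
    (hsup : ∀ t, 0 ≤ t → ∀ x, ‖x‖ < ρ →
      b * (c * lap v x - r x * v x) + 2 * n * c * a t - r x * (a t * ‖x‖ ^ 2 + d t) <
        A t x * (a' t * ‖x‖ ^ 2 + d' t))
    (hini : ∀ x, ‖x‖ ≤ ρ → 0 ≤ σ * (u (0, x) - w x) + (b * v x + (a 0 * ‖x‖ ^ 2 + d 0)))
    (hbd : ∀ t, 0 ≤ t → ∀ x, ‖x‖ = ρ →
      0 ≤ σ * (u (t, x) - w x) + (b * v x + (a t * ‖x‖ ^ 2 + d t))) :
    ∀ t ∈ Set.Icc 0 T, ∀ x, ‖x‖ ≤ ρ →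
      -(b * v x + (a t * ‖x‖ ^ 2 + d t)) ≤ σ * (u (t, x) - w x) := by
  have hux : ∀ t, 0 ≤ t → ContDiff ℝ 2 fun y => u (t, y) := fun t ht =>
    contDiffOn_univ.1 ((hu.of_le (WithTop.coe_le_coe.2 (le_top (a := (2 : ℕ∞))))).comp
      (contDiff_const.prodMk contDiff_id).contDiffOn fun y _ => ⟨ht, trivial⟩)
  have hn2 : ContDiff ℝ 2 fun y : EuclideanSpace ℝ (Fin n) => ‖y‖ ^ 2 := contDiff_norm_sq ℝ
  have hut : ∀ t, 0 < t → ∀ x,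
      HasDerivAt (fun s => u (s, x)) (derivWithin (fun s => u (s, x)) (Set.Ici 0) t) t := by
    intro t ht x
    have h1 : ContDiffOn ℝ 1 (fun s => u (s, x)) (Set.Ici 0) :=
      (hu.of_le (by exact_mod_cast le_top)).comp
        (contDiff_id.prodMk contDiff_const).contDiffOn fun s hs => ⟨hs, trivial⟩
    exact ((h1.differentiableOn (by norm_num)) t ht.le).hasDerivWithinAt.hasDerivAt (Ici_mem_nhds ht)
  have hac : Continuous a := continuous_iff_continuousAt.2 fun t => (ha t).continuousAt
  have hdc : Continuous d := continuous_iff_continuousAt.2 fun t => (hd t).continuousAt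
  refine neg_le_of_strict_supersolution (z := fun t x => σ * (u (t, x) - w x))
    (ψ := fun t x => b * v x + (a t * ‖x‖ ^ 2 + d t)) (c := c) (A := A) (r := r)
    (zt := fun t x => σ * derivWithin (fun s => u (s, x)) (Set.Ici 0) t)
    (ψt := fun t x => a' t * ‖x‖ ^ 2 + d' t) ?_ ?_ (fun t ht => ?_) (fun t _ => ?_)
    (fun t ht x => ?_) (fun t _ x => ?_) (fun t ht => hA t ht.le) hc hr (fun t ht x => ?_)
    (fun t ht x hx => ?_) hini hbd
  · have h1 : ContinuousOn u (Set.Icc 0 T ×ˢ Metric.closedBall 0 ρ) :=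
      hu.continuousOn.mono (Set.prod_mono Set.Icc_subset_Ici_self (Set.subset_univ _))
    exact continuousOn_const.mul (h1.sub (hw.continuous.comp continuous_snd).continuousOn)
  · have := hv.continuous
    fun_prop
  · exact contDiff_const.mul ((hux t ht.le).sub hw)
  · exact (contDiff_const.mul hv).add ((contDiff_const.mul hn2).add contDiff_const)
  · exact ((hut t ht x).sub_const _).const_mul σ
  · exact (((ha t).mul_const _).add (hd t)).const_add _
  · have e : (fun x => σ * (u (t, x) - w x)) = fun x => σ * u (t, x) + -σ * w x := by
      funext y; ring
    rw [e, lap_add (contDiff_const.mul (hux t ht.le)) (contDiff_const.mul hw),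
      lap_const_mul (hux t ht.le), lap_const_mul hw]
    linear_combination σ * heq t ht.le x + σ * hweq x
  · rw [lap_add (contDiff_const.mul hv) ((contDiff_const.mul hn2).add contDiff_const),
      lap_add (contDiff_const.mul hn2) contDiff_const, lap_const_mul hv, lap_const_mul hn2,
      lap_const, lap_norm_sq]
    have := hsup t ht.le x hx
    linarith

/-- Solutions stay within the initial distance, measured by a potential, of a stationary one. -/
lemma neg_mul_le_of_initial (hu : ContDiffOn ℝ (⊤ : ℕ∞) u (Set.Ici 0 ×ˢ Set.univ))
    (hw : ContDiff ℝ 2 w) (hv : ContDiff ℝ 2 v) (hc : 0 ≤ c) (hr : ∀ x, 0 ≤ r x)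
    {δ B : ℝ} (hδ : 0 < δ) (hA : ∀ t, 0 ≤ t → ∀ x, δ ≤ A t x)
    (heq : ∀ t, 0 ≤ t → ∀ x, A t x * derivWithin (fun s => u (s, x)) (Set.Ici 0) t =
      c * lap (fun y => u (t, y)) x - r x * u (t, x))
    (hweq : ∀ x, c * lap w x = r x * w x) (hveq : ∀ x, c * lap v x - r x * v x ≤ 0)
    (hv0 : ∀ x, 0 ≤ v x) {σ b : ℝ} (hb : 0 ≤ b)
    (hB : ∀ t, 0 ≤ t → ∀ x, -B ≤ σ * (u (t, x) - w x))
    (hini : ∀ x, -(b * v x) ≤ σ * (u (0, x) - w x)) {t : ℝ} (ht : 0 ≤ t)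
    (x : EuclideanSpace ℝ (Fin n)) : -(b * v x) ≤ σ * (u (t, x) - w x) := by
  set κ := 2 * n * c / δ + 1
  have hκ : 2 * n * c < δ * κ := by
    have : δ * κ = 2 * n * c + δ := by simp only [κ]; field_simp
    linarith
  have hn0 : (0 : ℝ) ≤ n := n.cast_nonneg
  have hκ0 : 0 < κ := by positivity
  have key : ∀ ε, 0 < ε → -(b * v x + ε * (‖x‖ ^ 2 + 1 + κ * t)) ≤ σ * (u (t, x) - w x) := by
    intro ε hε
    set ρ := ‖x‖ + |B| / ε + 1
    have hρ1 : 1 ≤ ρ := by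
      have : 0 ≤ |B| / ε := by positivity
      have := norm_nonneg x
      simp only [ρ]; linarith
    have hρB : B ≤ ε * ρ ^ 2 := by
      have h1 : |B| / ε ≤ ρ := by
        have := norm_nonneg x
        simp only [ρ]; linarith
      rw [div_le_iff₀ hε] at h1
      have h2 : ρ ≤ ρ ^ 2 := le_self_pow₀ hρ1 two_ne_zero
      have := mul_le_mul_of_nonneg_left h2 hε.le
      linarith [le_abs_self B]
    have h := neg_barrier_le (a := fun _ => ε) (d := fun s => ε * (1 + κ * s)) (a' := fun _ => 0)
      (d' := fun _ => ε * κ) (σ := σ) (b := b) (T := t) (ρ := ρ) hu hw hv hc hr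
      (fun s hs y => hδ.trans_le (hA s hs y)) heq hweq (fun s => hasDerivAt_const s ε)
      (fun s => by simpa using (((hasDerivAt_id s).const_mul κ).const_add 1).const_mul ε)
      (fun s hs y _ => ?_) (fun y _ => ?_) (fun s hs y hy => ?_) t ⟨ht, le_rfl⟩ x ?_
    · refine le_trans (le_of_eq ?_) h
      ring
    · have h1 := mul_nonpos_of_nonneg_of_nonpos hb (hveq y)
      have h2 : 0 ≤ r y * (ε * ‖y‖ ^ 2 + ε * (1 + κ * s)) := mul_nonneg (hr y) (by positivity)
      have h3 := mul_lt_mul_of_pos_left hκ hε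
      have h4 := mul_le_mul_of_nonneg_right (hA s hs y) (mul_pos hε hκ0).le
      linarith only [h1, h2, h3, h4]
    · have h1 := hini y
      have h2 : 0 ≤ ε * ‖y‖ ^ 2 := by positivity
      simp only [mul_zero, add_zero]
      linarith
    · have h1 := hB s hs y
      have h2 : 0 ≤ ε * (1 + κ * s) := by positivity
      have h3 := mul_nonneg hb (hv0 y)
      rw [hy]
      linarith
    · have : 0 ≤ |B| / ε := by positivity
      simp only [ρ]; linarith
  refine le_of_forall_pos_le_add fun η hη => ?_
  have hq : 0 < ‖x‖ ^ 2 + 1 + κ * t := by positivity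
  have := key (η / (‖x‖ ^ 2 + 1 + κ * t)) (by positivity)
  rw [div_mul_cancel₀ _ hq.ne'] at this
  linarith

/-- Exponential decay on balls, up to the size of the solution on the boundary. -/
lemma neg_decay_le (hu : ContDiffOn ℝ (⊤ : ℕ∞) u (Set.Ici 0 ×ˢ Set.univ)) (hn : 0 < n)
    (hw : ContDiff ℝ 2 w) (hc : 0 < c) (hr : ∀ x, 0 ≤ r x)
    {Λ B ε ρ : ℝ} (hA : ∀ t, 0 ≤ t → ∀ x, 0 < A t x ∧ A t x ≤ Λ)
    (heq : ∀ t, 0 ≤ t → ∀ x, A t x * derivWithin (fun s => u (s, x)) (Set.Ici 0) t =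
      c * lap (fun y => u (t, y)) x - r x * u (t, x))
    (hweq : ∀ x, c * lap w x = r x * w x) {σ : ℝ} (hε : 0 ≤ ε) (hB0 : 0 < B)
    (hB : ∀ x, -B ≤ σ * (u (0, x) - w x))
    (hbd : ∀ t, 0 ≤ t → ∀ x, ‖x‖ = ρ → -ε ≤ σ * (u (t, x) - w x)) {t : ℝ} (ht : 0 ≤ t)
    {x : EuclideanSpace ℝ (Fin n)} (hx : ‖x‖ ≤ ρ) :
    -(ε + B * (ρ ^ 2 + 1) * Real.exp (-(n * c / (Λ * (ρ ^ 2 + 1)) * t))) ≤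
      σ * (u (t, x) - w x) := by
  have hΛ : 0 < Λ := (hA 0 le_rfl 0).1.trans_le (hA 0 le_rfl 0).2
  have hn0 : (0 : ℝ) < n := by exact_mod_cast hn
  set μ := n * c / (Λ * (ρ ^ 2 + 1))
  have hμ : 0 < μ := by positivity
  have hμe : Λ * (μ * (ρ ^ 2 + 1)) = n * c := by simp only [μ]; field_simp
  have hE : ∀ s, HasDerivAt (fun s => Real.exp (-(μ * s))) (-(μ * Real.exp (-(μ * s)))) s := by
    intro s
    have := (((hasDerivAt_id s).const_mul μ).neg).exp
    simpa [mul_comm] using this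
  have sq : ∀ y : EuclideanSpace ℝ (Fin n), ‖y‖ ≤ ρ → ‖y‖ ^ 2 ≤ ρ ^ 2 := fun y hy =>
    pow_le_pow_left₀ (norm_nonneg y) hy 2
  have h := neg_barrier_le (a := fun s => -B * Real.exp (-(μ * s)))
    (d := fun s => ε + B * (ρ ^ 2 + 1) * Real.exp (-(μ * s)))
    (a' := fun s => -B * -(μ * Real.exp (-(μ * s))))
    (d' := fun s => B * (ρ ^ 2 + 1) * -(μ * Real.exp (-(μ * s))))
    (v := fun _ => 0) (σ := σ) (b := 0) (T := t) (ρ := ρ) hu hw contDiff_const hc.le hr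
    (fun s hs y => (hA s hs y).1) heq hweq (fun s => (hE s).const_mul _)
    (fun s => ((hE s).const_mul _).const_add ε)
    (fun s hs y hy => ?_) (fun y hy => ?_) (fun s hs y hy => ?_) t ⟨ht, le_rfl⟩ x hx
  · refine le_trans ?_ h
    have : 0 ≤ B * Real.exp (-(μ * t)) * ‖x‖ ^ 2 := by positivity
    linarith
  · set E := Real.exp (-(μ * s))
    have hE0 : 0 < E := Real.exp_pos _
    have h1 : 0 ≤ r y * (ε + B * E * (ρ ^ 2 + 1 - ‖y‖ ^ 2)) := by
      have := sq y hy.le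
      exact mul_nonneg (hr y) (add_nonneg hε (mul_nonneg (by positivity) (by linarith)))
    have h2 : A s y * (B * E * μ * (ρ ^ 2 + 1 - ‖y‖ ^ 2)) ≤ B * E * (n * c) := by
      rw [← hμe]
      have q1 : 0 ≤ ρ ^ 2 + 1 - ‖y‖ ^ 2 := by linarith [sq y hy.le]
      have q2 : ρ ^ 2 + 1 - ‖y‖ ^ 2 ≤ ρ ^ 2 + 1 := by linarith [sq_nonneg ‖y‖]
      calc A s y * (B * E * μ * (ρ ^ 2 + 1 - ‖y‖ ^ 2))
          ≤ Λ * (B * E * μ * (ρ ^ 2 + 1)) := by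
            have := (hA s hs y).2
            gcongr
        _ = _ := by ring
    have h3 : 0 < B * E * (n * c) := by positivity
    linarith only [h1, h2, h3]
  · have h1 := hB y
    have h2 := mul_le_mul_of_nonneg_left (sq y hy) hB0.le
    simp only [mul_zero, neg_zero, Real.exp_zero, mul_one]
    linarith
  · have h1 := hbd s hs y hy
    have h2 : 0 < B * Real.exp (-(μ * s)) := by positivity
    rw [hy]
    linarith

end Flow

end Yamabe

/-- Global existence of a fine solution to the Yamabe flow for initial data in the class
`A_C = {u : |u - 1| ≤ C v}`, and convergence to the Yamabe metric with zero scalar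
curvature. -/
theorem yamabe_flow_fine_solution (n : ℕ) (hn : 3 ≤ n)
    (R₀ : EuclideanSpace ℝ (Fin n) → ℝ) (hR₀s : ContDiff ℝ (⊤ : ℕ∞) R₀) (hR₀ : ∀ x, 0 ≤ R₀ x)
    (hR₀bdd : ∃ B, ∀ x, R₀ x ≤ B)
    (v : EuclideanSpace ℝ (Fin n) → ℝ) (hv : ContDiff ℝ (⊤ : ℕ∞) v) (hvpos : ∀ x, 0 < v x)
    (hvbdd : ∃ B, ∀ x, v x ≤ B)
    (hveq : ∀ x, -(4 * ((n : ℝ) - 1) / ((n : ℝ) - 2)) * lap v x + R₀ x * v x = R₀ x)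
    (hvlim : Tendsto v (cocompact (EuclideanSpace ℝ (Fin n))) (nhds 0))
    (C : ℝ) (hC : 1 ≤ C) (hCsup : C * (⨆ x, v x) < 1)
    (u₀ : EuclideanSpace ℝ (Fin n) → ℝ) (hu₀ : ContDiff ℝ (⊤ : ℕ∞) u₀)
    (hu₀v : ∀ x, |u₀ x - 1| ≤ C * v x) :
    ∃ u : ℝ × EuclideanSpace ℝ (Fin n) → ℝ,
      ContDiffOn ℝ (⊤ : ℕ∞) u (Set.Ici 0 ×ˢ Set.univ) ∧
      (∀ t ∈ Set.Ici (0 : ℝ), ∀ x, 0 < u (t, x)) ∧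
      (∀ x, u (0, x) = u₀ x) ∧
      (∀ t ∈ Set.Ici (0 : ℝ), ∀ x,
        (((n : ℝ) + 2) / ((n : ℝ) - 2)) * u (t, x) ^ ((4 : ℝ) / ((n : ℝ) - 2)) *
            derivWithin (fun s => u (s, x)) (Set.Ici 0) t
          = (4 * ((n : ℝ) - 1) / ((n : ℝ) - 2)) * lap (fun y => u (t, y)) x
            - R₀ x * u (t, x)) ∧
      (∀ t ∈ Set.Ici (0 : ℝ), ∀ x, |u (t, x) - 1| ≤ C * v x) ∧
      ∃ w : EuclideanSpace ℝ (Fin n) → ℝ, ContDiff ℝ 2 w ∧ (∀ x, 0 < w x) ∧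
        (∀ x, Tendsto (fun t => u (t, x)) atTop (nhds (w x))) ∧
        (∀ x, -(4 * ((n : ℝ) - 1) / ((n : ℝ) - 2)) * lap w x + R₀ x * w x = 0) ∧
        Tendsto w (cocompact (EuclideanSpace ℝ (Fin n))) (nhds 1) := by
  obtain ⟨S, hS⟩ : ∃ S, S = ⨆ x, v x := ⟨_, rfl⟩
  rw [← hS] at hCsup
  have hvS : ∀ x, v x ≤ S := fun x => hS ▸ le_ciSup (by
    obtain ⟨B, hB⟩ := hvbdd
    exact ⟨B, by rintro _ ⟨y, rfl⟩; exact hB y⟩) x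
  have hS0 : 0 < S := (hvpos 0).trans_le (hvS 0)
  obtain ⟨θ, hθ⟩ : ∃ θ, θ = C * S := ⟨_, rfl⟩
  rw [← hθ] at hCsup
  have hCv : ∀ x, C * v x ≤ θ := fun x => hθ ▸ mul_le_mul_of_nonneg_left (hvS x) (by linarith)
  have hvC : ∀ x, v x ≤ C * v x := fun x => le_mul_of_one_le_left (hvpos x).le hC
  have hn' : (3 : ℝ) ≤ n := by exact_mod_cast hn
  obtain ⟨c, hcd⟩ : ∃ c, c = 4 * ((n : ℝ) - 1) / ((n : ℝ) - 2) := ⟨_, rfl⟩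
  obtain ⟨q, hqd⟩ : ∃ q, q = ((n : ℝ) + 2) / ((n : ℝ) - 2) := ⟨_, rfl⟩
  obtain ⟨α, hαd⟩ : ∃ α, α = (4 : ℝ) / ((n : ℝ) - 2) := ⟨_, rfl⟩
  have hd : (0 : ℝ) < (n : ℝ) - 2 := by linarith
  have hc0 : 0 < c := hcd ▸ div_pos (by linarith) hd
  have hq0 : 0 < q := hqd ▸ div_pos (by linarith) hd
  have hα0 : 0 < α := hαd ▸ div_pos (by norm_num) hd
  have hα : α * ((n : ℝ) - 2) = 4 := by rw [hαd, div_mul_cancel₀ _ hd.ne']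
  rw [← hcd, ← hqd, ← hαd]
  rw [← hcd] at hveq
  set w : EuclideanSpace ℝ (Fin n) → ℝ := fun x => 1 + -1 * v x with hwd
  have hw : ContDiff ℝ (⊤ : ℕ∞) w := contDiff_const.add (contDiff_const.mul hv)
  have h2 : (2 : WithTop ℕ∞) ≤ ((⊤ : ℕ∞) : WithTop ℕ∞) :=
    WithTop.coe_le_coe.2 (le_top (a := (2 : ℕ∞)))
  have hv2 := hv.of_le h2
  have hw2 := hw.of_le h2
  have hlw : ∀ x, lap w x = -lap v x := fun x => by
    rw [hwd, Yamabe.lap_add contDiff_const (contDiff_const.mul hv2), Yamabe.lap_const,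
      Yamabe.lap_const_mul hv2]
    ring
  have hweq : ∀ x, c * lap w x = R₀ x * w x := fun x => by
    rw [hlw]
    simp only [hwd]
    linear_combination hveq x
  have hwa : ∀ x, 1 - θ ≤ w x := fun x => by
    simp only [hwd]; linarith [hCv x, hvC x]
  have hw1 : ∀ x, w x ≤ 1 := fun x => by
    simp only [hwd]; linarith [hvpos x]
  have ha : 0 < 1 - θ := by linarith
  have hw0 : ∀ x, 0 < w x := fun x => ha.trans_le (hwa x)
  have hθ0 : 0 < θ := hθ ▸ mul_pos (by linarith) hS0
  obtain ⟨M, hMd⟩ : ∃ M, M = (1 + θ) / (1 - θ) := ⟨_, rfl⟩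
  have hM1 : 1 ≤ M := by rw [hMd, le_div_iff₀ ha]; linarith
  have hM : M * (1 - θ) = 1 + θ := by rw [hMd, div_mul_cancel₀ _ ha.ne']
  obtain ⟨u, hu, hu0, hub, hueq⟩ := Yamabe.exists_flow (k₀ := c / q) (m := 1 - θ) (M := M) hn hα
    hα0 (div_pos hc0 hq0) ha ha (by linarith) hw hu₀ hwa hw1 fun x => by
      have h := abs_le.1 (hu₀v x)
      have h3 := mul_le_of_le_one_right ha.le (hw1 x)
      have h4 := mul_le_mul_of_nonneg_left (hwa x) (zero_le_one.trans hM1)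
      exact ⟨by linarith [hCv x], by linarith [hCv x]⟩
  have hul : ∀ t, 0 ≤ t → ∀ x, (1 - θ) * (1 - θ) ≤ u (t, x) := fun t ht x =>
    (mul_le_mul_of_nonneg_left (hwa x) ha.le).trans (hub t ht x).1
  have huM : ∀ t, 0 ≤ t → ∀ x, u (t, x) ≤ M := fun t ht x =>
    (hub t ht x).2.trans (mul_le_of_le_one_right (by linarith) (hw1 x))
  have hup : ∀ t, 0 ≤ t → ∀ x, 0 < u (t, x) := fun t ht x => (mul_pos ha ha).trans_le (hul t ht x)
  have hpde : ∀ t, 0 ≤ t → ∀ x, q * u (t, x) ^ α * derivWithin (fun s => u (s, x)) (Set.Ici 0) t =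
      c * lap (fun y => u (t, y)) x - R₀ x * u (t, x) := fun t ht x => by
    have h := hueq t ht x
    refine mul_right_cancel₀ (hw0 x).ne' ?_
    have e : q * (c / q) = c := mul_div_cancel₀ c hq0.ne'
    linear_combination q * h + (lap (fun y => u (t, y)) x * w x - lap w x * u (t, x)) * e -
      u (t, x) * hweq x
  have hAl : ∀ t, 0 ≤ t → ∀ x, q * ((1 - θ) * (1 - θ)) ^ α ≤ q * u (t, x) ^ α := fun t ht x =>
    mul_le_mul_of_nonneg_left (Real.rpow_le_rpow (mul_pos ha ha).le (hul t ht x) hα0.le) hq0.le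
  have hδ : 0 < q * ((1 - θ) * (1 - θ)) ^ α := mul_pos hq0 (Real.rpow_pos_of_pos (mul_pos ha ha) _)
  have hAu : ∀ t, 0 ≤ t → ∀ x, 0 < q * u (t, x) ^ α ∧ q * u (t, x) ^ α ≤ q * M ^ α := fun t ht x =>
    ⟨hδ.trans_le (hAl t ht x), mul_le_mul_of_nonneg_left
      (Real.rpow_le_rpow (hup t ht x).le (huM t ht x) hα0.le) hq0.le⟩
  have hB1 : ∀ t, 0 ≤ t → ∀ x, -(M + 1) ≤ 1 * (u (t, x) - w x) := fun t ht x => by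
    linarith [hup t ht x, hw1 x]
  have hB2 : ∀ t, 0 ≤ t → ∀ x, -(M + 1) ≤ -1 * (u (t, x) - w x) := fun t ht x => by
    linarith [huM t ht x, hw0 x]
  have hvs : ∀ x, c * lap v x - R₀ x * v x ≤ 0 := fun x => by linarith [hveq x, hR₀ x]
  have hfine : ∀ t, 0 ≤ t → ∀ x, |u (t, x) - 1| ≤ C * v x := fun t ht x => by
    have l1 := Yamabe.neg_mul_le_of_initial hu hw2 hv2 hc0.le hR₀ hδ hAl hpde hweq hvs
      (fun y => (hvpos y).le) (σ := 1) (b := C - 1) (by linarith) hB1 (fun y => by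
        have := (abs_le.1 (hu₀v y)).1
        simp only [hu0, hwd]
        linarith) ht x
    have l2 := Yamabe.neg_mul_le_of_initial hu hw2 hv2 hc0.le hR₀ hδ hAl hpde hweq hvs
      (fun y => (hvpos y).le) (σ := -1) (b := C + 1) (by linarith) hB2 (fun y => by
        have := (abs_le.1 (hu₀v y)).2
        simp only [hu0, hwd]
        linarith) ht x
    simp only [hwd] at l1 l2
    rw [abs_le]
    constructor <;> linarith
  refine ⟨u, hu, fun t ht x => hup t ht x, hu0, fun t ht x => hpde t ht x,
    fun t ht x => hfine t ht x, w, hw2, hw0, fun x => ?_, fun x => by linarith [hweq x], ?_⟩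
  · refine Metric.tendsto_nhds.2 fun ε hε => ?_
    have hC1 : 0 < C + 1 := by linarith
    have hev : ∀ᶠ y in cocompact (EuclideanSpace ℝ (Fin n)), v y < ε / 2 / (C + 1) :=
      hvlim.eventually (gt_mem_nhds (by positivity))
    rw [← Metric.cobounded_eq_cocompact, hasBasis_cobounded_norm.eventually_iff] at hev
    obtain ⟨ρ₀, -, hρ₀⟩ := hev
    set ρ := max ρ₀ ‖x‖
    have hout : ∀ t, 0 ≤ t → ∀ y, ‖y‖ = ρ → |u (t, y) - w y| ≤ ε / 2 := fun t ht y hy => by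
      have h3 : v y < ε / 2 / (C + 1) := hρ₀ (by
        simp only [Set.mem_ofPred_eq, hy]; exact le_max_left _ _)
      rw [lt_div_iff₀ hC1] at h3
      have h4 := abs_le.1 (hfine t ht y)
      have h5 := hvpos y
      simp only [hwd]
      rw [abs_le]
      constructor <;> linarith
    have hlim : Tendsto (fun t : ℝ => ε / 2 + (M + 1) * (ρ ^ 2 + 1) *
        Real.exp (-(n * c / (q * M ^ α * (ρ ^ 2 + 1)) * t))) atTop (nhds (ε / 2)) := by
      have hμ : 0 < n * c / (q * M ^ α * (ρ ^ 2 + 1)) := by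
        have : (0 : ℝ) < n := by linarith
        have hMp : 0 < M ^ α := Real.rpow_pos_of_pos (by linarith) _
        positivity
      have := (Real.tendsto_exp_neg_atTop_nhds_zero.comp
        (tendsto_id.const_mul_atTop hμ)).const_mul ((M + 1) * (ρ ^ 2 + 1))
      simpa using this.const_add (ε / 2)
    filter_upwards [hlim.eventually (gt_mem_nhds (show ε / 2 < ε by linarith)),
      eventually_ge_atTop 0] with t hlt ht
    have hn0 : 0 < n := by omega
    have l1 := Yamabe.neg_decay_le hu hn0 hw2 hc0 hR₀ hAu hpde hweq (σ := 1) (half_pos hε).le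
      (by linarith) (hB1 0 le_rfl) (fun s hs y hy => by linarith [(abs_le.1 (hout s hs y hy)).1]) ht
      (le_max_right ρ₀ ‖x‖)
    have l2 := Yamabe.neg_decay_le hu hn0 hw2 hc0 hR₀ hAu hpde hweq (σ := -1) (half_pos hε).le
      (by linarith) (hB2 0 le_rfl) (fun s hs y hy => by linarith [(abs_le.1 (hout s hs y hy)).2]) ht
      (le_max_right ρ₀ ‖x‖)
    rw [Real.dist_eq, abs_lt]
    constructor <;> linarith
  · have := (hvlim.const_mul (-1)).const_add 1
    simpa [hwd] using this
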